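/- arXiv:2305.00612 — 2 statements merged into one kernel-verified Lean document; each statement's English description precedes it below -/
import Mathlib

section
/- Let d ≥ 2 and let Γ ⊂ ℝ^d be a nonempty open cone (λx ∈ Γ whenever x ∈ Γ and λ > 0). Let u be continuous on cl(Γ) ∩ B_1, harmonic in Γ ∩ B_1, vanishing on ∂Γ ∩ B_1, not identically zero, and satisfying ∫_{Γ∩B_r} |∇u|² dx < ∞ for every r ∈ (0,1). Then the frequency F(r) = r ∫_{Γ∩B_r} |∇u|² dx / ∫_{∂B_r∩Γ} |u|² dH^{d−1} is a monotonically nondecreasing function of r on (0,1). -/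
open MeasureTheory Topology Filter Metric Set ENNReal

noncomputable section

/-- The Laplacian of `u : ℝ^d → ℝ` at `x`. -/
def lap {d : ℕ} (u : EuclideanSpace ℝ (Fin d) → ℝ) (x : EuclideanSpace ℝ (Fin d)) : ℝ :=
  ∑ i : Fin d, fderiv ℝ (fun y => fderiv ℝ u y (EuclideanSpace.single i 1)) x
    (EuclideanSpace.single i 1)

/-- `u` is harmonic on `s`: twice continuously differentiable with vanishing Laplacian. -/
def HarmonicOn {d : ℕ} (u : EuclideanSpace ℝ (Fin d) → ℝ) (s : Set (EuclideanSpace ℝ (Fin d))) :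
    Prop :=
  ContDiffOn ℝ 2 u s ∧ ∀ x ∈ s, lap u x = 0

section
open scoped Pointwise
set_option linter.unusedSectionVars false

theorem unif_meas_le {X : Type*} [PseudoMetricSpace X] [SecondCountableTopology X]
    [MeasurableSpace X] [BorelSpace X] (μ ν : Measure X) [IsFiniteMeasure μ] [IsFiniteMeasure ν]
    (c : ℝ≥0∞) (g h : ℝ → ℝ≥0∞) (hμ : ∀ x r, 0 < r → μ (ball x r) = g r)
    (hν : ∀ x r, 0 < r → ν (ball x r) = h r) (hh : ∀ r, 0 < r → h r ≠ 0)
    (hc : ∀ r, 0 < r → g r = c * h r) (U : Set X) (hU : IsOpen U) : μ U ≤ c * ν U := by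
  rcases U.eq_empty_or_nonempty with rfl | ⟨x0, hx0⟩
  · simp
  have hht : ∀ r, 0 < r → h r ≠ ∞ := fun r hr => by
    rw [← hν x0 r hr]; exact measure_ne_top _ _
  set r : ℕ → ℝ := fun n => 1 / ((n : ℝ) + 1) with hr
  have hrpos : ∀ n, 0 < r n := fun n => by simp only [hr]; positivity
  have hr0 : Tendsto r atTop (𝓝 0) := tendsto_one_div_add_atTop_nhds_zero_nat
  have hS : ∀ n, MeasurableSet {p : X × X | dist p.2 p.1 < r n} := fun n =>
    (isOpen_lt (by fun_prop) (by fun_prop)).measurableSet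
  set F : ℕ → X → ℝ≥0∞ := fun n x => (ν.restrict U) (ball x (r n)) / h (r n) with hF
  have hFm : ∀ n, Measurable (F n) := fun n => by
    have := measurable_measure_prodMk_left (ν := ν.restrict U) (hS n)
    exact this.div_const _
  have hlim : ∀ x ∈ U, 1 ≤ liminf (fun n => F n x) atTop := by
    intro x hx
    obtain ⟨ε, hε, hεU⟩ := Metric.isOpen_iff.1 hU x hx
    refine le_liminf_of_le (by isBoundedDefault) ?_
    filter_upwards [hr0.eventually (gt_mem_nhds hε)] with n hn
    simp only [hF]
    rw [Measure.restrict_apply measurableSet_ball,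
      inter_eq_left.2 ((ball_subset_ball hn.le).trans hεU), hν _ _ (hrpos n),
      ENNReal.div_self (hh _ (hrpos n)) (hht _ (hrpos n))]
  have h_intg : ∀ n, ∫⁻ x in U, F n x ∂μ ≤ c * ν U := by
    intro n
    have h1 : ∫⁻ x in U, (ν.restrict U) (ball x (r n)) ∂μ ≤ g (r n) * ν U := by
      have e1 := Measure.prod_apply (μ := μ.restrict U) (ν := ν.restrict U) (hS n)
      have e2 := Measure.prod_apply_symm (μ := μ.restrict U) (ν := ν.restrict U) (hS n)
      have e3 : ∫⁻ x in U, (ν.restrict U) (ball x (r n)) ∂μ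
          = ∫⁻ y in U, (μ.restrict U) ((fun x => (x, y)) ⁻¹' {p : X × X | dist p.2 p.1 < r n}) ∂ν := by
        rw [← e2, e1]; rfl
      rw [e3]
      calc _ ≤ ∫⁻ y in U, g (r n) ∂ν := by
            refine lintegral_mono fun y => ?_
            rw [← hμ y _ (hrpos n)]
            refine (Measure.restrict_apply_le _ _).trans (measure_mono ?_)
            intro z hz
            simpa [dist_comm] using hz
        _ = _ := by simp
    simp only [hF, div_eq_mul_inv]
    rw [lintegral_mul_const' _ _ (ENNReal.inv_ne_top.2 (hh _ (hrpos n)))]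
    calc _ ≤ g (r n) * ν U * (h (r n))⁻¹ := by gcongr
      _ = c * ν U * (h (r n) * (h (r n))⁻¹) := by rw [hc _ (hrpos n)]; ring
      _ = _ := by rw [ENNReal.mul_inv_cancel (hh _ (hrpos n)) (hht _ (hrpos n)), mul_one]
  calc μ U = ∫⁻ x in U, 1 ∂μ := by simp
    _ ≤ ∫⁻ x in U, liminf (fun n => F n x) atTop ∂μ :=
      setLIntegral_mono (Measurable.liminf hFm) hlim
    _ ≤ liminf (fun n => ∫⁻ x in U, F n x ∂μ) atTop := lintegral_liminf_le hFm
    _ ≤ c * ν U := by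
      refine (liminf_le_liminf (Eventually.of_forall h_intg)
        (by isBoundedDefault) (by isBoundedDefault)).trans ?_
      simp

theorem unif_meas_eq {X : Type*} [PseudoMetricSpace X] [SecondCountableTopology X] [Nonempty X]
    [MeasurableSpace X] [BorelSpace X] (μ ν : Measure X) [IsFiniteMeasure μ] [IsFiniteMeasure ν]
    (g h : ℝ → ℝ≥0∞) (hμ : ∀ x r, 0 < r → μ (ball x r) = g r)
    (hν : ∀ x r, 0 < r → ν (ball x r) = h r) (hg : ∀ r, 0 < r → g r ≠ 0)
    (hh : ∀ r, 0 < r → h r ≠ 0) :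
    ∃ c : ℝ≥0∞, c ≠ 0 ∧ c ≠ ∞ ∧ μ = c • ν := by
  obtain ⟨x0⟩ := ‹Nonempty X›
  have hμ0 : μ univ ≠ 0 := fun h0 => hg 1 one_pos (by
    rw [← hμ x0 1 one_pos]; exact measure_mono_null (subset_univ _) h0)
  have hν0 : ν univ ≠ 0 := fun h0 => hh 1 one_pos (by
    rw [← hν x0 1 one_pos]; exact measure_mono_null (subset_univ _) h0)
  set c := μ univ / ν univ with hcdef
  have hc0 : c ≠ 0 := ENNReal.div_ne_zero.2 ⟨hμ0, measure_ne_top _ _⟩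
  have hct : c ≠ ∞ := ENNReal.div_ne_top (measure_ne_top _ _) hν0
  have key : ∀ r, 0 < r → h r * μ univ = g r * ν univ := by
    intro r hr
    have hS : MeasurableSet {p : X × X | dist p.2 p.1 < r} :=
      (isOpen_lt (by fun_prop) (by fun_prop)).measurableSet
    have e1 := Measure.prod_apply (μ := μ) (ν := ν) hS
    have e2 := Measure.prod_apply_symm (μ := μ) (ν := ν) hS
    rw [e1] at e2
    have a1 : ∀ x : X, ν (Prod.mk x ⁻¹' {p : X × X | dist p.2 p.1 < r}) = h r := fun x =>
      hν x r hr
    have a2 : ∀ y : X, μ ((fun x => (x, y)) ⁻¹' {p : X × X | dist p.2 p.1 < r}) = g r := by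
      intro y
      rw [← hμ y r hr]
      congr 1
      ext z
      simp [dist_comm]
    rw [lintegral_congr a1, lintegral_congr a2] at e2
    simpa using e2
  have hgc : ∀ r, 0 < r → g r = c * h r := by
    intro r hr
    rw [hcdef, div_eq_mul_inv]
    calc g r = g r * (ν univ * (ν univ)⁻¹) := by
          rw [ENNReal.mul_inv_cancel hν0 (measure_ne_top _ _), mul_one]
      _ = (g r * ν univ) * (ν univ)⁻¹ := by ring
      _ = _ := by rw [← key r hr]; ring
  have hhc : ∀ r, 0 < r → h r = c⁻¹ * g r := by
    intro r hr
    rw [hgc r hr, ← mul_assoc, ENNReal.inv_mul_cancel hc0 hct, one_mul]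
  refine ⟨c, hc0, hct, ?_⟩
  have hU : ∀ U, IsOpen U → μ U = (c • ν) U := by
    intro U hU
    refine le_antisymm (unif_meas_le μ ν c g h hμ hν hh hgc U hU) ?_
    have := unif_meas_le ν μ c⁻¹ h g hν hμ hg hhc U hU
    calc (c • ν) U = c * ν U := rfl
      _ ≤ c * (c⁻¹ * μ U) := by gcongr
      _ = μ U := by rw [← mul_assoc, ENNReal.mul_inv_cancel hc0 hct, one_mul]
  refine ext_of_generate_finite {s | IsOpen s} ?_ isPiSystem_isOpen (fun s hs => hU s hs)
    (hU univ isOpen_univ)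
  exact BorelSpace.measurable_eq

/-- A measure with uniform balls on a compact space. -/
theorem unif_meas_zero {X : Type*} [PseudoMetricSpace X] [CompactSpace X]
    [MeasurableSpace X] (μ : Measure X)
    (g : ℝ → ℝ≥0∞) (hμ : ∀ x r, 0 < r → μ (ball x r) = g r) (r : ℝ) (hr : 0 < r) (h : g r = 0) :
    μ = 0 := by
  obtain ⟨t, -, htf, ht⟩ := finite_cover_balls_of_compact (isCompact_univ (X := X)) hr
  rw [← Measure.measure_univ_eq_zero]
  refine measure_mono_null ht ?_
  rw [measure_biUnion_null_iff htf.countable]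
  intro x _
  rw [hμ x r hr, h]

theorem unif_meas_fin {X : Type*} [PseudoMetricSpace X] [CompactSpace X]
    [MeasurableSpace X] (μ : Measure X)
    (g : ℝ → ℝ≥0∞) (hμ : ∀ x r, 0 < r → μ (ball x r) = g r) (r : ℝ) (hr : 0 < r) (h : g r ≠ ∞) :
    IsFiniteMeasure μ := by
  obtain ⟨t, -, htf, ht⟩ := finite_cover_balls_of_compact (isCompact_univ (X := X)) hr
  refine ⟨(measure_mono ht).trans_lt ?_⟩
  refine (measure_biUnion_lt_top htf ?_)
  intro x _
  rw [hμ x r hr]; exact h.lt_top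

section sph
variable {E : Type*} [NormedAddCommGroup E] [InnerProductSpace ℝ E] [FiniteDimensional ℝ E]
  [MeasurableSpace E] [BorelSpace E]

/-- Restriction of a linear isometry to the unit sphere. -/
def sphIso (L : E ≃ₗᵢ[ℝ] E) : sphere (0 : E) 1 ≃ᵢ sphere (0 : E) 1 where
  toFun x := ⟨L x, by simp⟩
  invFun x := ⟨L.symm x, by simp⟩
  left_inv x := by simp
  right_inv x := by simp
  isometry_toFun := by
    intro x y
    exact L.isometry x y

theorem sph_trans (x y : sphere (0 : E) 1) : ∃ L : E ≃ₗᵢ[ℝ] E, sphIso L x = y := by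
  refine ⟨Submodule.reflection (Submodule.span ℝ {(x : E) - y})ᗮ, ?_⟩
  ext
  exact Submodule.reflection_sub (by simp)

theorem sph_ball (m : Measure (sphere (0 : E) 1))
    (hm : ∀ (L : E ≃ₗᵢ[ℝ] E) (x : sphere (0 : E) 1) (r : ℝ),
      m (sphIso L '' ball x r) = m (ball x r)) (x y : sphere (0 : E) 1) (r : ℝ) :
    m (ball x r) = m (ball y r) := by
  obtain ⟨L, hL⟩ := sph_trans x y
  rw [← hm L x r, IsometryEquiv.image_ball, hL]

theorem sph_ball_toSphere (x y : sphere (0 : E) 1) (r : ℝ) :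
    (volume : Measure E).toSphere (ball x r) = (volume : Measure E).toSphere (ball y r) := by
  refine sph_ball _ (fun L x r => ?_) x y r
  rw [IsometryEquiv.image_ball, Measure.toSphere_apply' _ measurableSet_ball,
    Measure.toSphere_apply' _ measurableSet_ball]
  congr 1
  rw [← (L.measurePreserving).measure_preimage_equiv (f := L.toMeasurableEquiv)
     (Ioo (0:ℝ) 1 • (Subtype.val '' ball ((sphIso L) x) r))]
  congr 1
  rw [← IsometryEquiv.image_ball]
  ext z
  simp only [mem_preimage, Set.mem_smul, mem_image]
  constructor
  · rintro ⟨a, ha, _, ⟨_, ⟨w, hw, rfl⟩, rfl⟩, hz⟩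
    refine ⟨a, ha, w, ⟨w, hw, rfl⟩, ?_⟩
    apply L.injective
    rw [map_smul]; exact hz
  · rintro ⟨a, ha, _, ⟨w, hw, rfl⟩, rfl⟩
    refine ⟨a, ha, _, ⟨_, ⟨w, hw, rfl⟩, rfl⟩, ?_⟩
    exact (map_smul L a (w : E)).symm

theorem sph_ball_haus (s : ℝ) (x y : sphere (0 : E) 1) (r : ℝ) :
    (μH[s] : Measure (sphere (0 : E) 1)) (ball x r) = μH[s] (ball y r) := by
  refine sph_ball _ (fun L x r => ?_) x y r
  rw [IsometryEquiv.hausdorffMeasure_image]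

/-- Trichotomy for Hausdorff measure on the sphere. -/
theorem haus_sphere_cases [Nontrivial E] (s : ℝ) :
    ((μH[s] : Measure (sphere (0 : E) 1)) = 0) ∨
    (∀ x : sphere (0 : E) 1, ∀ r, 0 < r → (μH[s] : Measure (sphere (0 : E) 1)) (ball x r) = ∞) ∨
    (∃ c : ℝ≥0∞, c ≠ 0 ∧ c ≠ ∞ ∧
      (μH[s] : Measure (sphere (0 : E) 1)) = c • (volume : Measure E).toSphere) := by
  have hne : Nonempty (sphere (0 : E) 1) := (NormedSpace.sphere_nonempty.2 zero_le_one).to_subtype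
  obtain ⟨x0⟩ := id hne
  have hg : ∀ x r, 0 < r → (μH[s] : Measure (sphere (0 : E) 1)) (ball x r)
    = (fun r => μH[s] (ball x0 r)) r := fun x r _ => sph_ball_haus s x x0 r
  by_cases h0 : ∃ r, 0 < r ∧ (μH[s] : Measure (sphere (0 : E) 1)) (ball x0 r) = 0
  · obtain ⟨r, hr, h0⟩ := h0
    exact Or.inl (unif_meas_zero _ _ hg r hr h0)
  right
  by_cases ht : ∃ r, 0 < r ∧ (μH[s] : Measure (sphere (0 : E) 1)) (ball x0 r) ≠ ∞
  · right
    obtain ⟨r, hr, ht⟩ := ht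
    have := unif_meas_fin _ _ hg r hr ht
    push Not at h0
    exact unif_meas_eq _ _ _ (fun r => (volume : Measure E).toSphere (ball x0 r)) hg
      (fun x r _ => sph_ball_toSphere x x0 r) h0
      (fun r hr => (isOpen_ball.measure_pos _ ⟨x0, mem_ball_self hr⟩).ne')
  · left
    push Not at ht
    intro x r hr
    rw [hg x r hr]
    exact ht r hr
end sph
end

section
theorem inner_grad_eq_sum {d : ℕ} (w v : EuclideanSpace ℝ (Fin d) → ℝ)
    (x : EuclideanSpace ℝ (Fin d)) :
    inner ℝ (gradient w x) (gradient v x) =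
      ∑ i : Fin d, fderiv ℝ w x (EuclideanSpace.single i 1) *
        fderiv ℝ v x (EuclideanSpace.single i 1) := by
  rw [← (EuclideanSpace.basisFun (Fin d) ℝ).sum_inner_mul_inner]
  refine Finset.sum_congr rfl fun i _ => ?_
  rw [inner_gradient_left, inner_gradient_right]
  simp

theorem integrable_of_cont_compact {d : ℕ} {U K : Set (EuclideanSpace ℝ (Fin d))}
    (hK : IsCompact K) (hKU : K ⊆ U) (F : EuclideanSpace ℝ (Fin d) → ℝ) (hF : ContinuousOn F U)
    (h0 : ∀ x, x ∉ K → F x = 0) : Integrable F := by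
  rw [← integrableOn_iff_integrable_of_support_subset (s := K)]
  · exact (hF.mono hKU).integrableOn_compact hK
  · intro x hx
    by_contra h
    exact hx (h0 x h)

theorem weak0 {d : ℕ} {U : Set (EuclideanSpace ℝ (Fin d))} (hU : IsOpen U)
    (v w : EuclideanSpace ℝ (Fin d) → ℝ) (hv : ContDiffOn ℝ 2 v U)
    (hlap : ∀ x ∈ U, lap v x = 0) (hw : ContDiff ℝ 1 w) {K : Set (EuclideanSpace ℝ (Fin d))}
    (hK : IsCompact K) (hKU : K ⊆ U) (hwK : ∀ x, x ∉ K → w x = 0) :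
    ∫ x, inner ℝ (gradient w x) (gradient v x) = 0 := by
  have hts : tsupport w ⊆ K :=
    closure_minimal (fun x hx => by by_contra h; exact hx (hwK x h)) hK.isClosed
  have hfw : ∀ x, x ∉ K → fderiv ℝ w x = 0 := fun x hx => by
    by_contra h
    exact hx (hts (support_fderiv_subset ℝ h))
  have hdv : ContDiffOn ℝ 1 (fderiv ℝ v) U := hv.fderiv_of_isOpen hU (by norm_num)
  have hdvi : ∀ i : Fin d, ContDiffOn ℝ 1 (fun y => fderiv ℝ v y (EuclideanSpace.single i 1)) U :=
    fun i => hdv.clm_apply contDiffOn_const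
  have hddv : ∀ i : Fin d, ContinuousOn
      (fun x => fderiv ℝ (fun y => fderiv ℝ v y (EuclideanSpace.single i 1)) x
        (EuclideanSpace.single i 1)) U := fun i =>
    ((hdvi i).continuousOn_fderiv_of_isOpen hU le_rfl).clm_apply continuousOn_const
  have hcw : ∀ i : Fin d, Continuous (fun x => fderiv ℝ w x (EuclideanSpace.single i 1)) :=
    fun i => (hw.continuous_fderiv (by norm_num)).clm_apply continuous_const
  have I1 : ∀ i : Fin d, Integrable (fun x => fderiv ℝ w x (EuclideanSpace.single i 1) *
        fderiv ℝ v x (EuclideanSpace.single i 1)) := fun i =>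
    integrable_of_cont_compact hK hKU _ ((hcw i).continuousOn.mul (hdvi i).continuousOn)
      (fun x hx => by simp [hfw x hx])
  have I2 : ∀ i : Fin d, Integrable (fun x => w x *
      fderiv ℝ (fun y => fderiv ℝ v y (EuclideanSpace.single i 1)) x
        (EuclideanSpace.single i 1)) := fun i =>
    integrable_of_cont_compact hK hKU _ (hw.continuous.continuousOn.mul (hddv i))
      (fun x hx => by simp [hwK x hx])
  have I3 : ∀ i : Fin d, Integrable (fun x => w x *
      fderiv ℝ v x (EuclideanSpace.single i 1)) := fun i =>
    integrable_of_cont_compact hK hKU _ (hw.continuous.continuousOn.mul (hdvi i).continuousOn)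
      (fun x hx => by simp [hwK x hx])
  have ibp : ∀ i : Fin d, ∫ x, fderiv ℝ w x (EuclideanSpace.single i 1) *
        fderiv ℝ v x (EuclideanSpace.single i 1) = - ∫ x, w x *
      fderiv ℝ (fun y => fderiv ℝ v y (EuclideanSpace.single i 1)) x
        (EuclideanSpace.single i 1) := by
    intro i
    have := integral_mul_fderiv_eq_neg_fderiv_mul_of_integrable (I1 i) (I2 i) (I3 i)
      (fun x _ => hw.differentiable (by norm_num) x)
      (fun x hx => ((hdvi i).contDiffAt (hU.mem_nhds (hKU (hts hx)))).differentiableAt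
        (by norm_num))
    rw [this, neg_neg]
  simp_rw [inner_grad_eq_sum]
  rw [integral_finsetSum _ (fun i _ => I1 i), Finset.sum_congr rfl (fun i _ => ibp i),
    Finset.sum_neg_distrib, ← integral_finsetSum _ (fun i _ => I2 i)]
  rw [neg_eq_zero]
  refine integral_eq_zero_of_ae (Eventually.of_forall fun x => ?_)
  simp only [← Finset.mul_sum]
  by_cases hx : x ∈ K
  · have := hlap x (hKU hx)
    unfold lap at this
    simp [this]
  · simp [hwK x hx]

/-- a.e. on a zero set, the derivative vanishes -/
theorem grad_zero_ae {d : ℕ} {U : Set (EuclideanSpace ℝ (Fin d))} (hU : IsOpen U)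
    (u : EuclideanSpace ℝ (Fin d) → ℝ) (hu : ContDiffOn ℝ 2 u U) :
    ∀ᵐ x ∂(volume.restrict U), u x = 0 → gradient u x = 0 := by
  rcases subsingleton_or_nontrivial (EuclideanSpace ℝ (Fin d)) with hs | hs
  · exact Eventually.of_forall fun x _ => Subsingleton.elim _ _
  obtain ⟨e, he⟩ := exists_ne (0 : EuclideanSpace ℝ (Fin d))
  have hd : ∀ x ∈ U, DifferentiableAt ℝ u x := fun x hx =>
    (hu.contDiffAt (hU.mem_nhds hx)).differentiableAt (by norm_num)
  set s : Set (EuclideanSpace ℝ (Fin d)) := {x | x ∈ U ∧ u x = 0} with hs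
  have hsm : MeasurableSet s := by
    have h1 : s = U \ (U ∩ u ⁻¹' {0}ᶜ) := by ext x; simp [hs]
    rw [h1]
    exact hU.measurableSet.diff
      (hu.continuousOn.isOpen_inter_preimage hU isOpen_compl_singleton).measurableSet
  have key := ApproximatesLinearOn.norm_fderiv_sub_le (f := fun x => u x • e) (A := 0) (δ := 0)
    (s := s) volume (by
      intro x hx y hy
      simp [hx.2, hy.2]) hsm
      (fun x => (fderiv ℝ u x).smulRight e)
      (fun x hx => ((hd x hx.1).hasFDerivAt.smul_const e).hasFDerivWithinAt)
  rw [ae_restrict_iff' hsm] at key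
  rw [ae_restrict_iff' hU.measurableSet]
  filter_upwards [key] with x hx hxU hx0
  have h2 := hx ⟨hxU, hx0⟩
  have h4 : fderiv ℝ u x = 0 := by
    simpa [he] using h2
  simp [gradient, h4]
end

section
/-- cutoff derivative -/
def qf (ε s : ℝ) : ℝ := min 1 (max 0 (|s| / ε - 1))

/-- cutoff function vanishing near zero -/
def phif (ε s : ℝ) : ℝ := ∫ t in (0 : ℝ)..s, qf ε t

theorem qf_cont (ε : ℝ) : Continuous (qf ε) := by unfold qf; fun_prop

theorem qf_nonneg (ε s : ℝ) : 0 ≤ qf ε s := by unfold qf; positivity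

theorem qf_le (ε s : ℝ) : qf ε s ≤ 1 := min_le_left _ _

theorem qf_abs (ε s : ℝ) : |qf ε s| ≤ 1 := by rw [abs_of_nonneg (qf_nonneg _ _)]; exact qf_le _ _

theorem qf_zero {ε s : ℝ} (hε : 0 < ε) (h : |s| ≤ ε) : qf ε s = 0 := by
  have : |s| / ε - 1 ≤ 0 := by
    have := (div_le_one hε).2 h
    linarith
  simp [qf, max_eq_left this]

theorem qf_tendsto {s : ℝ} (hs : s ≠ 0) :
    Tendsto (fun n : ℕ => qf (1 / ((n : ℝ) + 1)) s) atTop (𝓝 1) := by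
  have h1 : Tendsto (fun n : ℕ => |s| * ((n : ℝ) + 1) - 1) atTop atTop := by
    refine tendsto_atTop_add_const_right _ _ ?_
    exact (tendsto_atTop_add_const_right _ _ tendsto_natCast_atTop_atTop).const_mul_atTop
      (abs_pos.2 hs)
  refine tendsto_const_nhds.congr' ?_
  filter_upwards [h1.eventually_ge_atTop 1] with n hn
  unfold qf
  rw [div_div_eq_mul_div, div_one, max_eq_right (by linarith), min_eq_left hn]

theorem phif_deriv (ε s : ℝ) : HasDerivAt (phif ε) (qf ε s) s :=
  intervalIntegral.integral_hasDerivAt_right ((qf_cont ε).intervalIntegrable _ _)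
    ((qf_cont ε).stronglyMeasurableAtFilter _ _) (qf_cont ε).continuousAt

theorem phif_contDiff (ε : ℝ) : ContDiff ℝ 1 (phif ε) := by
  rw [contDiff_one_iff_deriv]
  refine ⟨fun s => (phif_deriv ε s).differentiableAt, ?_⟩
  have : deriv (phif ε) = qf ε := funext fun s => (phif_deriv ε s).deriv
  rw [this]; exact qf_cont ε

theorem phif_zero {ε s : ℝ} (hε : 0 < ε) (h : |s| ≤ ε) : phif ε s = 0 := by
  unfold phif
  rw [intervalIntegral.integral_congr (g := fun _ => (0 : ℝ))]
  · simp
  · intro t ht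
    refine qf_zero hε (le_trans ?_ h)
    have := abs_sub_left_of_mem_uIcc ht
    simpa using this

theorem phif_abs (ε s : ℝ) : |phif ε s| ≤ |s| := by
  have := intervalIntegral.norm_integral_le_of_norm_le_const (a := 0) (b := s) (f := qf ε) (C := 1)
    (fun t _ => qf_abs ε t)
  simpa [phif] using this

theorem phif_tendsto (s : ℝ) :
    Tendsto (fun n : ℕ => phif (1 / ((n : ℝ) + 1)) s) atTop (𝓝 s) := by
  have : Tendsto (fun n : ℕ => phif (1 / ((n : ℝ) + 1)) s) atTop (𝓝 (∫ t in (0 : ℝ)..s, (1 : ℝ))) := by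
    refine intervalIntegral.tendsto_integral_filter_of_dominated_convergence (fun _ => 1) ?_ ?_ ?_ ?_
    · exact Eventually.of_forall fun n => (qf_cont _).aestronglyMeasurable
    · exact Eventually.of_forall fun n => Eventually.of_forall fun t _ => qf_abs _ _
    · simp
    · have : ∀ᵐ t : ℝ, t ≠ 0 := by simp [ae_iff]
      filter_upwards [this] with t ht _
      exact qf_tendsto ht
  simpa using this

/-- The Dirichlet solutions on `Γ ∩ B_R`. -/
structure GoodOn {d : ℕ} (Γ : Set (EuclideanSpace ℝ (Fin d))) (u : EuclideanSpace ℝ (Fin d) → ℝ)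
    (R : ℝ) : Prop where
  cont : ContinuousOn u (closure Γ ∩ ball 0 R)
  smooth : ContDiffOn ℝ 2 u (Γ ∩ ball 0 R)
  lap0 : ∀ x ∈ Γ ∩ ball 0 R, lap u x = 0
  zero : ∀ x ∈ frontier Γ ∩ ball (0 : EuclideanSpace ℝ (Fin d)) R, u x = 0
  en : ∀ r, r < R → IntegrableOn (fun x => ‖gradient u x‖ ^ 2) (Γ ∩ ball 0 r)

section
variable {d : ℕ} {Γ : Set (EuclideanSpace ℝ (Fin d))} {u v : EuclideanSpace ℝ (Fin d) → ℝ}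
  {R : ℝ}

theorem GoodOn.grad_cont (hu : GoodOn Γ u R) (hΓ : IsOpen Γ) :
    ContinuousOn (gradient u) (Γ ∩ ball 0 R) := by
  have hU : IsOpen (Γ ∩ ball 0 R) := hΓ.inter isOpen_ball
  have := hu.smooth.continuousOn_fderiv_of_isOpen hU (by norm_num)
  exact (InnerProductSpace.toDual ℝ (EuclideanSpace ℝ (Fin d))).symm.continuous.comp_continuousOn
    this

theorem GoodOn.u_cont (hu : GoodOn Γ u R) : ContinuousOn u (Γ ∩ ball 0 R) :=
  hu.cont.mono (inter_subset_inter_left _ subset_closure)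

theorem GoodOn.bdd (hu : GoodOn Γ u R) {ρ : ℝ} (hρ : ρ < R) :
    ∃ C : ℝ, 0 ≤ C ∧ ∀ x ∈ closure Γ ∩ closedBall 0 ρ, |u x| ≤ C := by
  have hc : IsCompact (closure Γ ∩ closedBall (0 : EuclideanSpace ℝ (Fin d)) ρ) :=
    (isCompact_closedBall _ _).inter_left isClosed_closure
  obtain ⟨C, hC⟩ := hc.exists_bound_of_continuousOn
    (hu.cont.mono (inter_subset_inter_right _ (closedBall_subset_ball hρ)))
  exact ⟨max C 0, le_max_right _ _, fun x hx => (hC x hx).trans (le_max_left _ _)⟩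

theorem GoodOn.int_eta (hΓ : IsOpen Γ) (hu : GoodOn Γ u R) (hv : GoodOn Γ v R)
    (η : EuclideanSpace ℝ (Fin d) → ℝ) (hη : Continuous η) {ρ : ℝ} (hρ : ρ < R)
    (hη0 : ∀ x, ρ < ‖x‖ → η x = 0) :
    IntegrableOn (fun x => η x * inner ℝ (gradient u x) (gradient v x)) (Γ ∩ ball 0 R) := by
  have hU : IsOpen (Γ ∩ ball 0 R) := hΓ.inter isOpen_ball
  obtain ⟨C, hC⟩ := (isCompact_closedBall (0 : EuclideanSpace ℝ (Fin d)) ρ).exists_bound_of_continuousOn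
    hη.continuousOn
  obtain ⟨r', hr1, hr2⟩ := exists_between hρ
  have hb : Integrable ((Γ ∩ ball 0 r').indicator
      (fun x => max C 0 * (‖gradient u x‖ ^ 2 + ‖gradient v x‖ ^ 2))) :=
    IntegrableOn.integrable_indicator (((hu.en r' hr2).add (hv.en r' hr2)).const_mul _)
      (hΓ.inter isOpen_ball).measurableSet
  refine Integrable.mono' hb.integrableOn ?_ ?_
  · refine ContinuousOn.aestronglyMeasurable ?_ hU.measurableSet
    exact hη.continuousOn.mul ((hu.grad_cont hΓ).inner (𝕜 := ℝ) (hv.grad_cont hΓ))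
  · filter_upwards [ae_restrict_mem hU.measurableSet] with x hx
    by_cases hxρ : ρ < ‖x‖
    · rw [hη0 x hxρ]
      simp only [zero_mul, norm_zero]
      refine indicator_nonneg (fun y _ => ?_) _
      positivity
    · have hx' : x ∈ Γ ∩ ball 0 r' := ⟨hx.1, by simp; linarith⟩
      rw [indicator_of_mem hx', norm_mul]
      gcongr
      · exact (hC x (by simpa using hxρ)).trans (le_max_left _ _)
      · refine (norm_inner_le_norm _ _).trans ?_
        nlinarith [sq_nonneg (‖gradient u x‖ - ‖gradient v x‖), sq_nonneg (‖gradient u x‖ + ‖gradient v x‖)]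

theorem GoodOn.int_G (hΓ : IsOpen Γ) (hu : GoodOn Γ u R) (hv : GoodOn Γ v R)
    (G : EuclideanSpace ℝ (Fin d) → EuclideanSpace ℝ (Fin d)) (hG : Continuous G) {ρ : ℝ}
    (hρ : ρ < R) (hG0 : ∀ x, ρ < ‖x‖ → G x = 0) :
    IntegrableOn (fun x => u x * inner ℝ (G x) (gradient v x)) (Γ ∩ ball 0 R) := by
  have hU : IsOpen (Γ ∩ ball 0 R) := hΓ.inter isOpen_ball
  obtain ⟨C, hC⟩ := (isCompact_closedBall (0 : EuclideanSpace ℝ (Fin d)) ρ).exists_bound_of_continuousOn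
    hG.continuousOn
  obtain ⟨D, hD0, hD⟩ := hu.bdd hρ
  obtain ⟨r', hr1, hr2⟩ := exists_between hρ
  have hone : IntegrableOn (fun x => (1 : ℝ)) (Γ ∩ ball (0 : EuclideanSpace ℝ (Fin d)) r') :=
    integrableOn_const ((measure_mono inter_subset_right).trans_lt measure_ball_lt_top).ne
  have hb : Integrable ((Γ ∩ ball 0 r').indicator
      (fun x => D * max C 0 * (1 + ‖gradient v x‖ ^ 2))) :=
    IntegrableOn.integrable_indicator ((hone.add (hv.en r' hr2)).const_mul _)
      (hΓ.inter isOpen_ball).measurableSet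
  refine Integrable.mono' hb.integrableOn ?_ ?_
  · refine ContinuousOn.aestronglyMeasurable ?_ hU.measurableSet
    exact hu.u_cont.mul (hG.continuousOn.inner (𝕜 := ℝ) (hv.grad_cont hΓ))
  · filter_upwards [ae_restrict_mem hU.measurableSet] with x hx
    by_cases hxρ : ρ < ‖x‖
    · rw [hG0 x hxρ]
      simp only [inner_zero_left, mul_zero, norm_zero]
      refine indicator_nonneg (fun y _ => ?_) _
      positivity
    · have hx' : x ∈ Γ ∩ ball 0 r' := ⟨hx.1, by simp; linarith⟩
      rw [indicator_of_mem hx', norm_mul, mul_assoc]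
      gcongr
      · exact hD x ⟨subset_closure hx.1, by simpa using hxρ⟩
      · refine (norm_inner_le_norm _ _).trans ?_
        gcongr
        · exact (hC x (by simpa using hxρ)).trans (le_max_left _ _)
        · nlinarith [sq_nonneg (‖gradient v x‖ - 1), sq_nonneg (‖gradient v x‖)]

theorem GoodOn.weak1 (hΓ : IsOpen Γ) (hu : GoodOn Γ u R) (hv : GoodOn Γ v R)
    (η : EuclideanSpace ℝ (Fin d) → ℝ)
    (G : EuclideanSpace ℝ (Fin d) → EuclideanSpace ℝ (Fin d)) (hη : ∀ x, HasGradientAt η (G x) x)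
    (hG : Continuous G) {ρ : ℝ} (hρ : ρ < R) (hη0 : ∀ x, ρ < ‖x‖ → η x = 0)
    (hG0 : ∀ x, ρ < ‖x‖ → G x = 0) :
    ∫ x in Γ ∩ ball 0 R, η x * inner ℝ (gradient u x) (gradient v x) =
      - ∫ x in Γ ∩ ball 0 R, u x * inner ℝ (G x) (gradient v x) := by
  set U := Γ ∩ ball (0 : EuclideanSpace ℝ (Fin d)) R with hUdef
  have hU : IsOpen U := hΓ.inter isOpen_ball
  have hηd : Differentiable ℝ η := fun x => (hη x).differentiableAt
  have hηC : ContDiff ℝ 1 η := by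
    rw [contDiff_one_iff_fderiv]
    refine ⟨hηd, ?_⟩
    have : fderiv ℝ η = fun x => InnerProductSpace.toDual ℝ _ (G x) :=
      funext fun x => (hη x).hasFDerivAt.fderiv
    rw [this]
    exact (InnerProductSpace.toDual ℝ _).continuous.comp hG
  have I1 := hu.int_eta hΓ hv η hηd.continuous hρ hη0
  have I2 := hu.int_G hΓ hv G hG hρ hG0
  rw [← hUdef] at I1 I2
  -- step for each ε
  have step : ∀ ε : ℝ, 0 < ε → ∫ x in U, (qf ε (u x) * (η x * inner ℝ (gradient u x) (gradient v x))
      + phif ε (u x) * inner ℝ (G x) (gradient v x)) = 0 := by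
    intro ε hε
    set w : EuclideanSpace ℝ (Fin d) → ℝ := U.indicator (fun x => phif ε (u x) * η x) with hw
    set K : Set (EuclideanSpace ℝ (Fin d)) :=
      (closure Γ ∩ closedBall 0 ρ) ∩ (fun x => |u x|) ⁻¹' Ici ε with hKdef
    have hcK : IsCompact K := by
      have hc : IsCompact (closure Γ ∩ closedBall (0 : EuclideanSpace ℝ (Fin d)) ρ) :=
        (isCompact_closedBall _ _).inter_left isClosed_closure
      refine hc.of_isClosed_subset ?_ inter_subset_left
      refine ContinuousOn.preimage_isClosed_of_isClosed ?_ hc.isClosed isClosed_Ici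
      exact (hu.cont.mono (inter_subset_inter_right _ (closedBall_subset_ball hρ))).abs
    have hKU : K ⊆ U := by
      rintro x ⟨⟨hx1, hx2⟩, hx3⟩
      have hxb : x ∈ ball (0 : EuclideanSpace ℝ (Fin d)) R := closedBall_subset_ball hρ hx2
      refine ⟨?_, hxb⟩
      by_contra hxΓ
      have hf : x ∈ frontier Γ := by
        rw [hΓ.frontier_eq]; exact ⟨hx1, hxΓ⟩
      have h0 := hu.zero x ⟨hf, hxb⟩
      simp only [mem_preimage, mem_Ici, h0, abs_zero] at hx3
      linarith
    have hwK : ∀ x, x ∉ K → w x = 0 := by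
      intro x hx
      by_cases hxU : x ∈ U
      · rw [hw, indicator_of_mem hxU]
        by_cases hxρ : ρ < ‖x‖
        · simp [hη0 x hxρ]
        · have : ¬ (ε ≤ |u x|) := fun h => hx ⟨⟨subset_closure hxU.1, by simpa using hxρ⟩, h⟩
          simp [phif_zero hε (not_le.1 this).le]
      · rw [hw, indicator_of_notMem hxU]
    have hwU : ∀ x ∈ U, w =ᶠ[𝓝 x] fun x => phif ε (u x) * η x := fun x hx => by
      filter_upwards [hU.mem_nhds hx] with y hy
      rw [hw, indicator_of_mem hy]
    have hw0 : ∀ x, x ∉ K → w =ᶠ[𝓝 x] fun _ => 0 := fun x hx => by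
      filter_upwards [hcK.isClosed.isOpen_compl.mem_nhds hx] with y hy using hwK y hy
    have hwC : ContDiff ℝ 1 w := by
      rw [contDiff_iff_contDiffAt]
      intro x
      by_cases hx : x ∈ U
      · refine ContDiffAt.congr_of_eventuallyEq ?_ (hwU x hx)
        refine ContDiffAt.mul ?_ hηC.contDiffAt
        exact (phif_contDiff ε).contDiffAt.comp x
          ((hu.smooth.contDiffAt (hU.mem_nhds hx)).of_le (by norm_num))
      · exact contDiffAt_const.congr_of_eventuallyEq (hw0 x (fun h => hx (hKU h)))
    have h0 := weak0 hU v w hv.smooth hv.lap0 hwC hcK hKU hwK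
    rw [← setIntegral_eq_integral_of_forall_compl_eq_zero (s := U)] at h0
    · rw [← h0]
      refine setIntegral_congr_fun hU.measurableSet fun x hx => ?_
      have hud : DifferentiableAt ℝ u x :=
        (hu.smooth.contDiffAt (hU.mem_nhds hx)).differentiableAt (by norm_num)
      have hfd : HasFDerivAt (fun x => phif ε (u x) * η x)
          (phif ε (u x) • fderiv ℝ η x + η x • (qf ε (u x) • fderiv ℝ u x)) x :=
        ((phif_deriv ε (u x)).comp_hasFDerivAt x hud.hasFDerivAt).mul (hηd x).hasFDerivAt
      have hfw := (hfd.congr_of_eventuallyEq (hwU x hx)).fderiv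
      rw [inner_gradient_left (f := w), hfw]
      simp only [_root_.add_apply, _root_.smul_apply, smul_eq_mul, ← inner_gradient_left,
        (hη x).gradient]
      ring
    · intro x hx
      have : gradient w x = 0 := by
        rw [(hw0 x (fun h => hx (hKU h))).gradient_eq]
        simp [gradient]
      rw [this, inner_zero_left]
  -- limit
  have hlim : Tendsto (fun n : ℕ => ∫ x in U, (qf (1 / ((n : ℝ) + 1)) (u x) *
      (η x * inner ℝ (gradient u x) (gradient v x))
      + phif (1 / ((n : ℝ) + 1)) (u x) * inner ℝ (G x) (gradient v x))) atTop
      (𝓝 (∫ x in U, (η x * inner ℝ (gradient u x) (gradient v x)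
        + u x * inner ℝ (G x) (gradient v x)))) := by
    refine tendsto_integral_of_dominated_convergence
      (fun x => ‖η x * inner ℝ (gradient u x) (gradient v x)‖
        + ‖u x * inner ℝ (G x) (gradient v x)‖) ?_ (I1.norm.add I2.norm) ?_ ?_
    · intro n
      refine ContinuousOn.aestronglyMeasurable ?_ hU.measurableSet
      have c1 := hu.u_cont
      have c2 := hu.grad_cont hΓ
      have c3 := hv.grad_cont hΓ
      refine ContinuousOn.add (ContinuousOn.mul ?_ (ContinuousOn.mul ?_ ?_)) (ContinuousOn.mul ?_ ?_)
      · exact (qf_cont _).comp_continuousOn c1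
      · exact hηd.continuous.continuousOn
      · exact c2.inner (𝕜 := ℝ) c3
      · exact (phif_contDiff _).continuous.comp_continuousOn c1
      · exact hG.continuousOn.inner (𝕜 := ℝ) c3
    · intro n
      refine Eventually.of_forall fun x => (norm_add_le _ _).trans ?_
      gcongr ?_ + ?_
      · rw [norm_mul]
        exact mul_le_of_le_one_left (norm_nonneg _) (qf_abs _ _)
      · rw [norm_mul, norm_mul]
        gcongr
        exact phif_abs _ _
    · filter_upwards [grad_zero_ae hU u hu.smooth] with x hx
      refine Tendsto.add ?_ ((phif_tendsto (u x)).mul_const _)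
      by_cases h0 : u x = 0
      · simp [hx h0]
      · simpa using (qf_tendsto h0).mul_const (η x * inner ℝ (gradient u x) (gradient v x))
  have hzero : ∫ x in U, (η x * inner ℝ (gradient u x) (gradient v x)
        + u x * inner ℝ (G x) (gradient v x)) = 0 := by
    refine tendsto_nhds_unique hlim ?_
    refine tendsto_const_nhds.congr fun n => ?_
    exact (step _ (by positivity)).symm
  rw [integral_add I1 I2] at hzero
  linarith
end
end

section
/-- dilation -/
def dil {d : ℕ} (u : EuclideanSpace ℝ (Fin d) → ℝ) (c : ℝ) (x : EuclideanSpace ℝ (Fin d)) : ℝ :=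
  u (c • x)

section
variable {d : ℕ} {Γ : Set (EuclideanSpace ℝ (Fin d))} {u v : EuclideanSpace ℝ (Fin d) → ℝ}
  {R : ℝ}

theorem fderiv_dil (u : EuclideanSpace ℝ (Fin d) → ℝ) (c : ℝ) (x : EuclideanSpace ℝ (Fin d)) :
    fderiv ℝ (dil u c) x = c • fderiv ℝ u (c • x) :=
  fderiv_comp_smul c

theorem grad_dil (u : EuclideanSpace ℝ (Fin d) → ℝ) (c : ℝ) (x : EuclideanSpace ℝ (Fin d)) :
    gradient (dil u c) x = c • gradient u (c • x) := by
  simp [gradient, fderiv_dil]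

theorem lap_dil (u : EuclideanSpace ℝ (Fin d) → ℝ) (c : ℝ) (x : EuclideanSpace ℝ (Fin d)) :
    lap (dil u c) x = c ^ 2 * lap u (c • x) := by
  unfold lap
  rw [Finset.mul_sum]
  refine Finset.sum_congr rfl fun i _ => ?_
  have h1 : (fun y => fderiv ℝ (dil u c) y (EuclideanSpace.single i 1)) =
      c • dil (fun y => fderiv ℝ u y (EuclideanSpace.single i 1)) c := by
    ext y
    simp [fderiv_dil, dil]
  rw [h1, fderiv_const_smul_field, Pi.smul_apply, fderiv_dil]
  simp only [_root_.smul_apply, smul_eq_mul]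
  ring

theorem cone_iff (hcone : ∀ c : ℝ, 0 < c → ∀ x ∈ Γ, c • x ∈ Γ) {c : ℝ} (hc : 0 < c)
    (x : EuclideanSpace ℝ (Fin d)) : c • x ∈ Γ ↔ x ∈ Γ := by
  refine ⟨fun h => ?_, hcone c hc x⟩
  have := hcone c⁻¹ (inv_pos.2 hc) _ h
  rwa [smul_smul, inv_mul_cancel₀ hc.ne', one_smul] at this

theorem cone_closure (hcone : ∀ c : ℝ, 0 < c → ∀ x ∈ Γ, c • x ∈ Γ) {c : ℝ} (hc : 0 < c)
    {x : EuclideanSpace ℝ (Fin d)} (hx : x ∈ closure Γ) : c • x ∈ closure Γ :=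
  map_mem_closure (continuous_const_smul c) hx (fun y hy => hcone c hc y hy)

open scoped Pointwise in
theorem cone_smul (hcone : ∀ c : ℝ, 0 < c → ∀ x ∈ Γ, c • x ∈ Γ) {c : ℝ} (hc : 0 < c) (r : ℝ) :
    c • (Γ ∩ ball (0 : EuclideanSpace ℝ (Fin d)) r) = Γ ∩ ball 0 (c * r) := by
  ext x
  rw [Set.mem_smul_set_iff_inv_smul_mem₀ hc.ne']
  simp only [mem_inter_iff, cone_iff hcone (inv_pos.2 hc), mem_ball_zero_iff, norm_smul, norm_inv,
    Real.norm_eq_abs, abs_of_pos hc]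
  rw [inv_mul_lt_iff₀ hc]

theorem ball_smul_mem {c r R' : ℝ} (hc : 0 < c) (h : r * c ≤ R') {x : EuclideanSpace ℝ (Fin d)}
    (hx : x ∈ ball 0 r) : c • x ∈ ball (0 : EuclideanSpace ℝ (Fin d)) R' := by
  simp only [mem_ball_zero_iff, norm_smul, Real.norm_eq_abs, abs_of_pos hc] at hx ⊢
  calc c * ‖x‖ < c * r := by gcongr
    _ ≤ R' := by linarith

theorem GoodOn.dil {R' : ℝ} (hΓ : IsOpen Γ) (hcone : ∀ c : ℝ, 0 < c → ∀ x ∈ Γ, c • x ∈ Γ)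
    (hu : GoodOn Γ u R') {c : ℝ} (hc : 0 < c) (hR : R * c ≤ R') : GoodOn Γ (dil u c) R where
  cont := by
    refine hu.cont.comp (continuous_const_smul c).continuousOn ?_
    exact fun x hx => ⟨cone_closure hcone hc hx.1, ball_smul_mem hc hR hx.2⟩
  smooth := by
    refine hu.smooth.comp (contDiff_const_smul c).contDiffOn ?_
    exact fun x hx => ⟨hcone c hc x hx.1, ball_smul_mem hc hR hx.2⟩
  lap0 := by
    intro x hx
    rw [lap_dil, hu.lap0 _ ⟨hcone c hc x hx.1, ball_smul_mem hc hR hx.2⟩, mul_zero]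
  zero := by
    intro x hx
    refine hu.zero _ ⟨?_, ball_smul_mem hc hR hx.2⟩
    have := hx.1
    rw [hΓ.frontier_eq] at this ⊢
    exact ⟨cone_closure hcone hc this.1, fun h => this.2 ((cone_iff hcone hc x).1 h)⟩
  en := by
    intro r hr
    have hm : ∀ r, MeasurableSet (Γ ∩ ball (0 : EuclideanSpace ℝ (Fin d)) r) := fun r =>
      (hΓ.inter isOpen_ball).measurableSet
    rw [← integrable_indicator_iff (hm r)]
    have h1 := hu.en (c * r) (by nlinarith)
    rw [← integrable_indicator_iff (hm _)] at h1
    have h2 := (h1.comp_smul hc.ne').const_mul (c ^ 2)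
    refine h2.congr (Eventually.of_forall fun x => ?_)
    have : (c • x ∈ Γ ∩ ball (0 : EuclideanSpace ℝ (Fin d)) (c * r)) ↔ x ∈ Γ ∩ ball 0 r := by
      simp only [mem_inter_iff, cone_iff hcone hc, mem_ball_zero_iff, norm_smul,
        Real.norm_eq_abs, abs_of_pos hc, mul_lt_mul_iff_right₀ hc]
    beta_reduce
    by_cases hx : x ∈ Γ ∩ ball 0 r
    · rw [indicator_of_mem (this.2 hx), indicator_of_mem hx, grad_dil, norm_smul, mul_pow,
        Real.norm_eq_abs, sq_abs]
    · rw [indicator_of_notMem (fun h => hx (this.1 h)), indicator_of_notMem hx, mul_zero]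

/-- scaling of energy -/
theorem energy_scale (hcone : ∀ c : ℝ, 0 < c → ∀ x ∈ Γ, c • x ∈ Γ) {c : ℝ} (hc : 0 < c) (r : ℝ) :
    ∫ x in Γ ∩ ball 0 r, ‖gradient (dil u c) x‖ ^ 2 =
      c ^ 2 * (c ^ d)⁻¹ * ∫ x in Γ ∩ ball 0 (c * r), ‖gradient u x‖ ^ 2 := by
  have h := Measure.setIntegral_comp_smul_of_pos (volume : Measure (EuclideanSpace ℝ (Fin d)))
    (fun x => ‖gradient u x‖ ^ 2) (Γ ∩ ball 0 r) hc
  rw [cone_smul hcone hc] at h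
  simp only [grad_dil, norm_smul, Real.norm_eq_abs, mul_pow, sq_abs]
  rw [integral_const_mul, h]
  simp
  ring

/-- Radial primitive -/
def Psi (ψ : ℝ → ℝ) (ρ r : ℝ) : ℝ := ∫ t in r..ρ, t * ψ t

theorem Psi_zero {ψ : ℝ → ℝ} {α ρ : ℝ} (h0 : ∀ t, t ∉ Ioo α ρ → ψ t = 0) {r : ℝ} (hr : ρ ≤ r) :
    Psi ψ ρ r = 0 := by
  unfold Psi
  rw [intervalIntegral.integral_congr (g := fun _ => (0 : ℝ))]
  · simp
  · intro t ht
    rw [uIcc_of_ge hr] at ht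
    simp [h0 t (fun h => absurd h.2 (not_lt.2 ht.1))]

theorem Psi_deriv {ψ : ℝ → ℝ} (hψ : Continuous ψ) (ρ r : ℝ) :
    HasDerivAt (Psi ψ ρ) (-(r * ψ r)) r := by
  have hc : Continuous fun t => t * ψ t := by fun_prop
  exact intervalIntegral.integral_hasDerivAt_left (hc.intervalIntegrable _ _)
    (hc.stronglyMeasurableAtFilter _ _) hc.continuousAt

theorem Psi_grad {ψ : ℝ → ℝ} (hψ : Continuous ψ) {α ρ : ℝ} (hα : 0 < α)
    (h0 : ∀ t, t ∉ Ioo α ρ → ψ t = 0) (x : EuclideanSpace ℝ (Fin d)) :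
    HasGradientAt (fun x => Psi ψ ρ ‖x‖) (-(ψ ‖x‖ • x)) x := by
  rw [hasGradientAt_iff_hasFDerivAt]
  by_cases hx : x = 0
  · subst hx
    have h1 : (fun x : EuclideanSpace ℝ (Fin d) => Psi ψ ρ ‖x‖) =ᶠ[𝓝 0] fun _ => Psi ψ ρ 0 := by
      filter_upwards [ball_mem_nhds (0 : EuclideanSpace ℝ (Fin d)) hα] with y hy
      have hc : Continuous fun t => t * ψ t := by fun_prop
      have h2 : ∫ t in (0 : ℝ)..‖y‖, t * ψ t = 0 := by
        rw [intervalIntegral.integral_congr (g := fun _ => (0 : ℝ))]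
        · simp
        · intro t ht
          rw [uIcc_of_le (norm_nonneg y)] at ht
          have : t < α := lt_of_le_of_lt ht.2 (by simpa using hy)
          simp [h0 t (fun h => absurd h.1 (not_lt.2 this.le))]
      unfold Psi
      rw [← intervalIntegral.integral_add_adjacent_intervals (hc.intervalIntegrable 0 ‖y‖)
        (hc.intervalIntegrable ‖y‖ ρ), h2, zero_add]
    refine HasFDerivAt.congr_of_eventuallyEq ?_ h1
    simp only [smul_zero, neg_zero, map_zero]
    exact hasFDerivAt_const _ _
  · have hn : HasFDerivAt (fun y : EuclideanSpace ℝ (Fin d) => ‖y‖)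
        (‖x‖⁻¹ • innerSL ℝ x) x := by
      have h1 : HasFDerivAt (fun y : EuclideanSpace ℝ (Fin d) => ‖y‖ ^ 2) (2 • innerSL ℝ x) x :=
        (hasStrictFDerivAt_norm_sq x).hasFDerivAt
      have h2 := h1.sqrt (by simpa using hx)
      simp only [Real.sqrt_sq (norm_nonneg _)] at h2
      refine h2.congr_fderiv ?_
      ext y
      simp
      field_simp
    refine ((Psi_deriv hψ ρ ‖x‖).comp_hasFDerivAt x hn).congr_fderiv ?_
    ext y
    simp [inner_smul_left]
    field_simp [norm_ne_zero_iff.2 hx]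

theorem inter_ball_eq (hΓ : IsOpen Γ) {ρ : ℝ} (hρ : ρ ≤ R) (f : EuclideanSpace ℝ (Fin d) → ℝ)
    (h : ∀ x, ρ ≤ ‖x‖ → f x = 0) :
    ∫ x in Γ ∩ ball 0 R, f x = ∫ x in Γ ∩ ball 0 ρ, f x := by
  refine setIntegral_eq_of_subset_of_forall_sdiff_eq_zero (hΓ.inter isOpen_ball).measurableSet
    (inter_subset_inter_right _ (ball_subset_ball hρ)) ?_
  intro x hx
  refine h x (not_lt.1 fun hlt => hx.2 ⟨hx.1.1, by simpa using hlt⟩)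

/-- radial version -/
theorem GoodOn.weak2 (hΓ : IsOpen Γ) (hu : GoodOn Γ u R) (hv : GoodOn Γ v R)
    {ψ : ℝ → ℝ} (hψ : Continuous ψ) {α ρ : ℝ} (hα : 0 < α)
    (h0 : ∀ t, t ∉ Ioo α ρ → ψ t = 0) (hρ : ρ < R) :
    ∫ x in Γ ∩ ball 0 ρ, u x * (ψ ‖x‖ * inner ℝ x (gradient v x)) =
    ∫ x in Γ ∩ ball 0 ρ, Psi ψ ρ ‖x‖ * inner ℝ (gradient u x) (gradient v x) := by
  have h1 := hu.weak1 hΓ hv (fun x => Psi ψ ρ ‖x‖) (fun x => -(ψ ‖x‖ • x))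
    (fun x => Psi_grad hψ hα h0 x) (by fun_prop) hρ (fun x hx => Psi_zero h0 hx.le)
    (fun x hx => by simp [h0 ‖x‖ (fun h => absurd h.2 (not_lt.2 hx.le))])
  rw [inter_ball_eq hΓ hρ.le, inter_ball_eq hΓ hρ.le] at h1
  · rw [h1, ← integral_neg]
    congr 1
    ext x
    simp [inner_smul_left]
  · intro x hx
    simp [h0 ‖x‖ (fun h => absurd h.2 (not_lt.2 hx))]
  · intro x hx
    simp [Psi_zero h0 hx]

theorem GoodOn.int2 (hΓ : IsOpen Γ) (hu : GoodOn Γ u R) (hv : GoodOn Γ v R)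
    {ψ : ℝ → ℝ} (hψ : Continuous ψ) {α ρ : ℝ}
    (h0 : ∀ t, t ∉ Ioo α ρ → ψ t = 0) (hρ : ρ < R) :
    IntegrableOn (fun x => u x * (ψ ‖x‖ * inner ℝ x (gradient v x))) (Γ ∩ ball 0 ρ) := by
  have h1 := hu.int_G hΓ hv (fun x => ψ ‖x‖ • x) (by fun_prop) hρ
    (fun x hx => by simp [h0 ‖x‖ (fun h => absurd h.2 (not_lt.2 hx.le))])
  refine (h1.mono_set (inter_subset_inter_right _ (ball_subset_ball hρ.le))).congr ?_
  refine Eventually.of_forall fun x => ?_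
  simp [inner_smul_left]

end
end

section
section
variable {d : ℕ} {Γ : Set (EuclideanSpace ℝ (Fin d))} {u v : EuclideanSpace ℝ (Fin d) → ℝ}

theorem exp_le_of_abs {a s τ : ℝ} (ha : |a| ≤ 1) (hs : s ∈ Icc 0 τ) :
    Real.exp (a * s) ≤ Real.exp τ := by
  rw [Real.exp_le_exp]
  have := abs_le.1 ha
  nlinarith [hs.1, hs.2]

theorem GoodOn.dil_exp (hΓ : IsOpen Γ) (hcone : ∀ c : ℝ, 0 < c → ∀ x ∈ Γ, c • x ∈ Γ)
    (hu : GoodOn Γ u 1) {a s τ : ℝ} (ha : |a| ≤ 1) (hs : s ∈ Icc 0 τ) :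
    GoodOn Γ (_root_.dil u (Real.exp (a * s))) (Real.exp (-τ)) := by
  refine hu.dil hΓ hcone (Real.exp_pos _) ?_
  calc Real.exp (-τ) * Real.exp (a * s) ≤ Real.exp (-τ) * Real.exp τ := by
        gcongr; exact Real.exp_le_exp.1 (exp_le_of_abs ha hs)
    _ = 1 := by rw [← Real.exp_add]; simp

theorem mapsTo_exp (hcone : ∀ c : ℝ, 0 < c → ∀ x ∈ Γ, c • x ∈ Γ)
    {a τ ρ : ℝ} (ha : |a| ≤ 1) (hρ : ρ < Real.exp (-τ)) :
    MapsTo (fun p : ℝ × EuclideanSpace ℝ (Fin d) => Real.exp (a * p.1) • p.2)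
      (Icc 0 τ ×ˢ (Γ ∩ ball 0 ρ)) (Γ ∩ ball 0 1) := by
  rintro ⟨s, x⟩ ⟨hs, hx⟩
  refine ⟨hcone _ (Real.exp_pos _) x hx.1, ball_smul_mem (Real.exp_pos _) ?_ hx.2⟩
  have h0 : 0 < ρ := lt_of_le_of_lt (norm_nonneg x) (by simpa using hx.2)
  calc ρ * Real.exp (a * s) ≤ Real.exp (-τ) * Real.exp τ := by
        gcongr; exact Real.exp_le_exp.1 (exp_le_of_abs ha hs)
    _ = 1 := by rw [← Real.exp_add]; simp

theorem cont_u_exp (hcone : ∀ c : ℝ, 0 < c → ∀ x ∈ Γ, c • x ∈ Γ)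
    (hu : GoodOn Γ u 1) {a τ ρ : ℝ} (ha : |a| ≤ 1) (hρ : ρ < Real.exp (-τ)) :
    ContinuousOn (fun p : ℝ × EuclideanSpace ℝ (Fin d) => dil u (Real.exp (a * p.1)) p.2)
      (Icc 0 τ ×ˢ (Γ ∩ ball 0 ρ)) :=
  hu.u_cont.comp (by fun_prop) (mapsTo_exp hcone ha hρ)

theorem cont_g_exp (hΓ : IsOpen Γ) (hcone : ∀ c : ℝ, 0 < c → ∀ x ∈ Γ, c • x ∈ Γ)
    (hu : GoodOn Γ u 1) {a τ ρ : ℝ} (ha : |a| ≤ 1) (hρ : ρ < Real.exp (-τ)) :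
    ContinuousOn (fun p : ℝ × EuclideanSpace ℝ (Fin d) =>
        gradient (dil u (Real.exp (a * p.1))) p.2)
      (Icc 0 τ ×ˢ (Γ ∩ ball 0 ρ)) := by
  simp only [grad_dil]
  have h2 : ContinuousOn (fun p : ℝ × EuclideanSpace ℝ (Fin d) =>
      gradient u (Real.exp (a * p.1) • p.2)) (Icc 0 τ ×ˢ (Γ ∩ ball 0 ρ)) :=
    (hu.grad_cont hΓ).comp (by fun_prop) (mapsTo_exp hcone ha hρ)
  have h1 : ContinuousOn (fun p : ℝ × EuclideanSpace ℝ (Fin d) => Real.exp (a * p.1))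
    (Icc 0 τ ×ˢ (Γ ∩ ball 0 ρ)) := by fun_prop
  exact h1.smul h2

theorem aesm_of_cont (hΓ : IsOpen Γ) {τ ρ : ℝ} {f : ℝ × EuclideanSpace ℝ (Fin d) → ℝ}
    (hf : ContinuousOn f (Icc 0 τ ×ˢ (Γ ∩ ball 0 ρ))) :
    AEStronglyMeasurable f ((volume.restrict (Ioc 0 τ)).prod (volume.restrict (Γ ∩ ball 0 ρ))) := by
  rw [Measure.prod_restrict]
  have hm : MeasurableSet (Ioc 0 τ ×ˢ (Γ ∩ ball (0 : EuclideanSpace ℝ (Fin d)) ρ)) :=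
    measurableSet_Ioc.prod (hΓ.inter isOpen_ball).measurableSet
  exact (hf.mono (prod_mono Ioc_subset_Icc_self le_rfl)).aestronglyMeasurable hm

instance (ρ : ℝ) : IsFiniteMeasure (volume.restrict (Γ ∩ ball (0 : EuclideanSpace ℝ (Fin d)) ρ)) :=
  ⟨by
    rw [Measure.restrict_apply_univ]
    exact (measure_mono inter_subset_right).trans_lt measure_ball_lt_top⟩

theorem int_energy_prod (hΓ : IsOpen Γ) (hcone : ∀ c : ℝ, 0 < c → ∀ x ∈ Γ, c • x ∈ Γ)
    (hu : GoodOn Γ u 1) {a τ ρ : ℝ} (ha : |a| ≤ 1) (hρ : ρ < Real.exp (-τ)) :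
    Integrable (fun p : ℝ × EuclideanSpace ℝ (Fin d) =>
        ‖gradient (dil u (Real.exp (a * p.1))) p.2‖ ^ 2)
      ((volume.restrict (Ioc 0 τ)).prod (volume.restrict (Γ ∩ ball 0 ρ))) := by
  have hm := aesm_of_cont (f := fun p : ℝ × EuclideanSpace ℝ (Fin d) =>
      ‖gradient (dil u (Real.exp (a * p.1))) p.2‖ ^ 2) hΓ
    ((cont_g_exp hΓ hcone hu ha hρ).norm.pow 2)
  rw [integrable_prod_iff hm]
  constructor
  · filter_upwards [ae_restrict_mem measurableSet_Ioc] with s hs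
    exact (hu.dil_exp hΓ hcone ha (Ioc_subset_Icc_self hs)).en ρ hρ
  · have hm2 := hm.norm.integral_prod_right'
    rcases le_or_gt ρ 0 with hρ0 | hρ0
    · have : ball (0 : EuclideanSpace ℝ (Fin d)) ρ = ∅ := ball_eq_empty.2 hρ0
      simp [this]
    have hlt : Real.exp τ * ρ < 1 := by
      calc Real.exp τ * ρ < Real.exp τ * Real.exp (-τ) := by gcongr
        _ = 1 := by rw [← Real.exp_add]; simp
    have hcont : Continuous fun s : ℝ => (Real.exp (a * s)) ^ 2 * ((Real.exp (a * s)) ^ d)⁻¹ := by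
      refine Continuous.mul (by fun_prop) (Continuous.inv₀ (by fun_prop) ?_)
      intro s; positivity
    refine Integrable.mono' (g := fun s => (Real.exp (a * s)) ^ 2 * ((Real.exp (a * s)) ^ d)⁻¹ *
      ∫ x in Γ ∩ ball 0 (Real.exp τ * ρ), ‖gradient u x‖ ^ 2) ?_ hm2 ?_
    · refine Integrable.mul_const ?_ _
      exact (hcont.integrableOn_Icc (a := 0) (b := τ)).mono_set Ioc_subset_Icc_self
    · filter_upwards [ae_restrict_mem measurableSet_Ioc] with s hs
      rw [Real.norm_of_nonneg (integral_nonneg fun x => norm_nonneg _)]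
      simp only [norm_pow, norm_norm]
      rw [energy_scale hcone (Real.exp_pos _)]
      refine mul_le_mul_of_nonneg_left ?_ (by positivity)
      refine setIntegral_mono_set (hu.en _ hlt) (Eventually.of_forall fun x => by positivity) ?_
      refine (inter_subset_inter_right _ (ball_subset_ball ?_)).eventuallyLE
      exact mul_le_mul_of_nonneg_right (exp_le_of_abs ha (Ioc_subset_Icc_self hs)) hρ0.le

theorem int_T_prod (hΓ : IsOpen Γ) (hcone : ∀ c : ℝ, 0 < c → ∀ x ∈ Γ, c • x ∈ Γ)
    (hu : GoodOn Γ u 1) {a b τ ρ : ℝ} (ha : |a| ≤ 1) (hb : |b| ≤ 1) (hρ : ρ < Real.exp (-τ))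
    {ψ : ℝ → ℝ} (hψ : Continuous ψ) :
    Integrable (fun p : ℝ × EuclideanSpace ℝ (Fin d) =>
        dil u (Real.exp (a * p.1)) p.2 *
          (ψ ‖p.2‖ * inner ℝ p.2 (gradient (dil u (Real.exp (b * p.1))) p.2)))
      ((volume.restrict (Ioc 0 τ)).prod (volume.restrict (Γ ∩ ball 0 ρ))) := by
  rcases le_or_gt ρ 0 with hρ0 | hρ0
  · have : ball (0 : EuclideanSpace ℝ (Fin d)) ρ = ∅ := ball_eq_empty.2 hρ0
    simp [this]
  have hlt : Real.exp τ * ρ < 1 := by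
    calc Real.exp τ * ρ < Real.exp τ * Real.exp (-τ) := by gcongr
      _ = 1 := by rw [← Real.exp_add]; simp
  have hc1 := cont_u_exp hcone hu ha hρ
  have hc2 := cont_g_exp hΓ hcone hu hb hρ
  have hc3 : ContinuousOn (fun p : ℝ × EuclideanSpace ℝ (Fin d) => ψ ‖p.2‖)
    (Icc 0 τ ×ˢ (Γ ∩ ball 0 ρ)) := by fun_prop
  have hm := aesm_of_cont hΓ (hc1.mul (hc3.mul (continuousOn_snd.inner hc2)))
  obtain ⟨C, hC0, hC⟩ := hu.bdd hlt
  obtain ⟨M, hM⟩ := (isCompact_closedBall (0 : ℝ) ρ).exists_bound_of_continuousOn hψ.continuousOn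
  have hM0 : 0 ≤ M := (norm_nonneg _).trans (hM 0 (by simp [hρ0.le]))
  have hE := int_energy_prod hΓ hcone hu hb hρ
  refine Integrable.mono' (((integrable_const (1 : ℝ)).add hE).const_mul (C * (M * ρ))) hm ?_
  rw [Measure.prod_restrict]
  filter_upwards [ae_restrict_mem (measurableSet_Ioc.prod
    (hΓ.inter isOpen_ball).measurableSet)] with p hp
  have hx : ‖p.2‖ < ρ := by simpa using hp.2.2
  have h1 : |dil u (Real.exp (a * p.1)) p.2| ≤ C := by
    refine hC _ ⟨cone_closure hcone (Real.exp_pos _) (subset_closure hp.2.1), ?_⟩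
    rw [mem_closedBall_zero_iff, norm_smul, Real.norm_eq_abs, Real.abs_exp]
    exact mul_le_mul (exp_le_of_abs ha (Ioc_subset_Icc_self hp.1)) hx.le (norm_nonneg _)
      (Real.exp_pos _).le
  have h2 : |ψ ‖p.2‖| ≤ M := hM _ (by simpa using hx.le)
  have h3 : |inner ℝ p.2 (gradient (dil u (Real.exp (b * p.1))) p.2)| ≤
      ρ * ‖gradient (dil u (Real.exp (b * p.1))) p.2‖ :=
    (abs_real_inner_le_norm _ _).trans (by gcongr)
  simp only [norm_mul, Real.norm_eq_abs, Pi.add_apply]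
  set g := ‖gradient (dil u (Real.exp (b * p.1))) p.2‖
  have h4 : g ≤ 1 + g ^ 2 := by nlinarith [sq_nonneg (g - 1)]
  calc _ ≤ C * (M * (ρ * g)) := by gcongr
    _ = C * (M * ρ) * g := by ring
    _ ≤ C * (M * ρ) * (1 + g ^ 2) := by gcongr

theorem hasDeriv_dil (hΓ : IsOpen Γ) (hcone : ∀ c : ℝ, 0 < c → ∀ x ∈ Γ, c • x ∈ Γ)
    (hu : GoodOn Γ u 1) {a τ ρ s : ℝ} (ha : |a| ≤ 1) (hρ : ρ < Real.exp (-τ)) (hs : s ∈ Icc 0 τ)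
    {x : EuclideanSpace ℝ (Fin d)} (hx : x ∈ Γ ∩ ball 0 ρ) :
    HasDerivAt (fun s => dil u (Real.exp (a * s)) x)
      (a * inner ℝ x (gradient (dil u (Real.exp (a * s))) x)) s := by
  have hmem : Real.exp (a * s) • x ∈ Γ ∩ ball 0 1 :=
    mapsTo_exp hcone ha hρ (show (s, x) ∈ Icc 0 τ ×ˢ (Γ ∩ ball 0 ρ) from ⟨hs, hx⟩)
  have hd : DifferentiableAt ℝ u (Real.exp (a * s) • x) :=
    (hu.smooth.contDiffAt ((hΓ.inter isOpen_ball).mem_nhds hmem)).differentiableAt (by norm_num)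
  have h1 : HasDerivAt (fun s => Real.exp (a * s) • x) ((Real.exp (a * s) * (a * 1)) • x) s :=
    ((hasDerivAt_id s).const_mul a).exp.smul_const x
  have h2 := hd.hasGradientAt.hasFDerivAt.comp_hasDerivAt s h1
  refine h2.congr_deriv ?_
  rw [grad_dil]
  simp only [InnerProductSpace.toDual_apply_apply, inner_smul_right]
  rw [real_inner_comm]
  ring

theorem bulk (hΓ : IsOpen Γ) (hcone : ∀ c : ℝ, 0 < c → ∀ x ∈ Γ, c • x ∈ Γ)
    (hu : GoodOn Γ u 1) {a τ ρ : ℝ} (ha : |a| ≤ 1) (hτ : 0 ≤ τ) (hρ : ρ < Real.exp (-τ))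
    {ψ : ℝ → ℝ} (hψ : Continuous ψ) {α : ℝ} (hα : 0 < α)
    (h0 : ∀ t, t ∉ Ioo α ρ → ψ t = 0) :
    ∫ x in Γ ∩ ball 0 ρ, ψ ‖x‖ * (u (Real.exp τ • x) * u (Real.exp (a * τ) • x) - u x * u x) =
    ∫ s in (0)..τ, (1 + a) * ∫ x in Γ ∩ ball 0 ρ, Psi ψ ρ ‖x‖ *
      inner ℝ (gradient (dil u (Real.exp s)) x) (gradient (dil u (Real.exp (a * s))) x) := by
  have h1 : |(1 : ℝ)| ≤ 1 := by simp
  have hI1 := int_T_prod hΓ hcone hu ha h1 hρ hψ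
  have hI2 := (int_T_prod hΓ hcone hu h1 ha hρ hψ).const_mul a
  have hI := hI1.add hI2
  have hpt : ∀ x ∈ Γ ∩ ball 0 ρ,
      ψ ‖x‖ * (u (Real.exp τ • x) * u (Real.exp (a * τ) • x) - u x * u x) =
      ∫ s in Ioc 0 τ, (dil u (Real.exp (a * s)) x *
          (ψ ‖x‖ * inner ℝ x (gradient (dil u (Real.exp (1 * s))) x)) +
          a * (dil u (Real.exp (1 * s)) x *
          (ψ ‖x‖ * inner ℝ x (gradient (dil u (Real.exp (a * s))) x)))) := by
    intro x hx
    rw [← intervalIntegral.integral_of_le hτ]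
    have key := intervalIntegral.integral_eq_sub_of_hasDerivAt (a := 0) (b := τ)
      (f := fun s => ψ ‖x‖ * (dil u (Real.exp (1 * s)) x * dil u (Real.exp (a * s)) x))
      (f' := fun s => (dil u (Real.exp (a * s)) x *
          (ψ ‖x‖ * inner ℝ x (gradient (dil u (Real.exp (1 * s))) x)) +
          a * (dil u (Real.exp (1 * s)) x *
          (ψ ‖x‖ * inner ℝ x (gradient (dil u (Real.exp (a * s))) x))))) ?_ ?_
    · rw [key]
      simp [dil]
      ring
    · intro s hs
      rw [uIcc_of_le hτ] at hs
      refine (((hasDeriv_dil hΓ hcone hu h1 hρ hs hx).mul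
        (hasDeriv_dil hΓ hcone hu ha hρ hs hx)).const_mul (ψ ‖x‖)).congr_deriv ?_
      ring
    · refine ContinuousOn.intervalIntegrable ?_
      rw [uIcc_of_le hτ]
      have hmap : MapsTo (fun s : ℝ => (s, x)) (Icc 0 τ) (Icc 0 τ ×ˢ (Γ ∩ ball 0 ρ)) :=
        fun s hs => ⟨hs, hx⟩
      have hcs : ContinuousOn (fun s : ℝ => (s, x)) (Icc 0 τ) := by fun_prop
      have c1 := (cont_u_exp hcone hu ha hρ).comp hcs hmap
      have c2 := (cont_u_exp hcone hu h1 hρ).comp hcs hmap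
      have c3 := (cont_g_exp hΓ hcone hu ha hρ).comp hcs hmap
      have c4 := (cont_g_exp hΓ hcone hu h1 hρ).comp hcs hmap
      have cx : ContinuousOn (fun _ : ℝ => x) (Icc 0 τ) := continuousOn_const
      have cψ : ContinuousOn (fun _ : ℝ => ψ ‖x‖) (Icc 0 τ) := continuousOn_const
      have ca : ContinuousOn (fun _ : ℝ => a) (Icc 0 τ) := continuousOn_const
      exact (c1.mul (cψ.mul (cx.inner c4))).add (ca.mul (c2.mul (cψ.mul (cx.inner c3))))
  rw [setIntegral_congr_fun (hΓ.inter isOpen_ball).measurableSet hpt]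
  rw [integral_integral_swap (f := fun x s => (dil u (Real.exp (a * s)) x *
          (ψ ‖x‖ * inner ℝ x (gradient (dil u (Real.exp (1 * s))) x)) +
          a * (dil u (Real.exp (1 * s)) x *
          (ψ ‖x‖ * inner ℝ x (gradient (dil u (Real.exp (a * s))) x))))) hI.swap]
  rw [intervalIntegral.integral_of_le hτ]
  refine setIntegral_congr_fun measurableSet_Ioc fun s hs => ?_
  have hs' := Ioc_subset_Icc_self hs
  have g1 := hu.dil_exp hΓ hcone h1 hs'
  have g2 := hu.dil_exp hΓ hcone ha hs'
  beta_reduce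
  rw [integral_add (g2.int2 hΓ g1 hψ h0 hρ) ((g1.int2 hΓ g2 hψ h0 hρ).const_mul a),
    integral_const_mul, g2.weak2 hΓ g1 hψ hα h0 hρ, g1.weak2 hΓ g2 hψ hα h0 hρ, add_mul, one_mul,
    one_mul]
  congr 1
  simp only [real_inner_comm]
end
end

section
section
variable {d : ℕ} {Γ : Set (EuclideanSpace ℝ (Fin d))} {u v : EuclideanSpace ℝ (Fin d) → ℝ}

theorem polar [Nontrivial (EuclideanSpace ℝ (Fin d))] {f : EuclideanSpace ℝ (Fin d) → ℝ}
    (hf : Integrable f) :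
    ∫ x, f x = ∫ r in Ioi (0 : ℝ), r ^ (d - 1) *
      ∫ θ : sphere (0 : EuclideanSpace ℝ (Fin d)) 1, f (r • (θ : EuclideanSpace ℝ (Fin d)))
        ∂(volume : Measure (EuclideanSpace ℝ (Fin d))).toSphere := by
  set μ := (volume : Measure (EuclideanSpace ℝ (Fin d)))
  have hfr : Module.finrank ℝ (EuclideanSpace ℝ (Fin d)) = d := by simp
  have hmp := μ.measurePreserving_homeomorphUnitSphereProd
  rw [hfr] at hmp
  have hg : ∀ x : ({0}ᶜ : Set (EuclideanSpace ℝ (Fin d))),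
      f ((homeomorphUnitSphereProd _ x).2.1 • (homeomorphUnitSphereProd _ x).1.1) = f x := by
    intro x
    have : ‖(x : EuclideanSpace ℝ (Fin d))‖ ≠ 0 := norm_ne_zero_iff.2 x.2
    simp [smul_smul, this]
  have h1 : ∫ x, f x ∂μ = ∫ x : ({0}ᶜ : Set (EuclideanSpace ℝ (Fin d))), f x ∂(μ.comap (↑)) := by
    rw [integral_subtype_comap (measurableSet_singleton _).compl f, restrict_compl_singleton]
  have hI1 : Integrable (fun x : ({0}ᶜ : Set (EuclideanSpace ℝ (Fin d))) => f x) (μ.comap (↑)) :=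
    (integrableOn_iff_comap_subtypeVal (measurableSet_singleton _).compl).1 hf.integrableOn
  have h2 := hmp.integral_comp (Homeomorph.measurableEmbedding _) (fun p => f (p.2.1 • p.1.1))
  have hI2 := (hmp.integrable_comp_emb (Homeomorph.measurableEmbedding _)
    (g := fun p => f (p.2.1 • p.1.1))).1 (by
      refine hI1.congr (Eventually.of_forall fun x => ?_)
      exact (hg x).symm)
  simp only [hg] at h2
  rw [h1, h2, integral_prod_symm _ hI2]
  simp only [Measure.volumeIoiPow, ENNReal.ofReal]
  rw [integral_withDensity_eq_integral_smul, integral_subtype_comap measurableSet_Ioi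
    fun a : ℝ ↦ Real.toNNReal (a ^ (d - 1)) • ∫ θ : sphere (0 : EuclideanSpace ℝ (Fin d)) 1,
      f (a • (θ : EuclideanSpace ℝ (Fin d))) ∂μ.toSphere]
  · refine setIntegral_congr_fun measurableSet_Ioi fun x hx ↦ ?_
    beta_reduce
    rw [NNReal.smul_def, Real.coe_toNNReal _ (pow_nonneg hx.out.le _), smul_eq_mul]
  · exact (measurable_subtype_coe.pow_const _).real_toNNReal

/-- fundamental lemma -/
theorem fund {R : ℝ} {f : ℝ → ℝ} (hf : ContinuousOn f (Ioo 0 R))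
    (h : ∀ (ψ : ℝ → ℝ) (α ρ : ℝ), Continuous ψ → 0 < α → ρ < R → (∀ t, t ∉ Ioo α ρ → ψ t = 0) →
      ∫ r, ψ r * f r = 0) : ∀ r ∈ Ioo 0 R, f r = 0 := by
  have h1 := isOpen_Ioo.ae_eq_zero_of_integral_contDiff_smul_eq_zero (μ := volume) (f := f)
    (U := Ioo 0 R) (hf.locallyIntegrableOn measurableSet_Ioo) ?_
  · refine Measure.eqOn_open_of_ae_eq (μ := volume) ((ae_restrict_iff' measurableSet_Ioo).2 h1)
      isOpen_Ioo hf continuousOn_const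
  · intro g hg hgc hgs
    rcases (tsupport g).eq_empty_or_nonempty with he | hne
    · have : g = 0 := tsupport_eq_empty_iff.1 he
      simp [this]
    have hc : IsCompact (tsupport g) := hgc
    have hm := hgs (hc.sInf_mem hne)
    have hM := hgs (hc.sSup_mem hne)
    simp only [smul_eq_mul]
    refine h g (sInf (tsupport g) / 2) ((sSup (tsupport g) + R) / 2) hg.continuous (by linarith [hm.1])
      (by linarith [hM.2]) ?_
    intro t ht
    by_contra hne'
    have hts : t ∈ tsupport g := subset_tsupport g hne'
    have a1 := csInf_le hc.bddBelow hts
    have a2 := le_csSup hc.bddAbove hts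
    exact ht ⟨by linarith [hm.1], by linarith [hM.2]⟩

/-- trace of the cone on the sphere -/
def sphA (Γ : Set (EuclideanSpace ℝ (Fin d))) : Set (sphere (0 : EuclideanSpace ℝ (Fin d)) 1) :=
  (↑) ⁻¹' Γ

/-- bilinear spherical average -/
def hh (Γ : Set (EuclideanSpace ℝ (Fin d))) (u : EuclideanSpace ℝ (Fin d) → ℝ) (a b : ℝ) : ℝ :=
  ∫ θ in sphA Γ, u (a • (θ : EuclideanSpace ℝ (Fin d))) * u (b • (θ : EuclideanSpace ℝ (Fin d)))
    ∂(volume : Measure (EuclideanSpace ℝ (Fin d))).toSphere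

theorem sphA_open (hΓ : IsOpen Γ) : IsOpen (sphA Γ) := hΓ.preimage continuous_subtype_val

theorem mem_of_sphA (hcone : ∀ c : ℝ, 0 < c → ∀ x ∈ Γ, c • x ∈ Γ) {r R : ℝ}
    (hr : r ∈ Ioo 0 R) {θ : sphere (0 : EuclideanSpace ℝ (Fin d)) 1} (hθ : θ ∈ sphA Γ) :
    r • (θ : EuclideanSpace ℝ (Fin d)) ∈ Γ ∩ ball 0 R := by
  refine ⟨hcone r hr.1 _ hθ, ?_⟩
  simp [norm_smul, abs_of_pos hr.1, hr.2]

theorem cont_ray (hcone : ∀ c : ℝ, 0 < c → ∀ x ∈ Γ, c • x ∈ Γ) (hu : GoodOn Γ u 1)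
    {r : ℝ} (hr : r ∈ Ioo (0 : ℝ) 1) :
    ContinuousOn (fun θ : sphere (0 : EuclideanSpace ℝ (Fin d)) 1 =>
      u (r • (θ : EuclideanSpace ℝ (Fin d)))) (sphA Γ) :=
  hu.u_cont.comp (by fun_prop) (fun _ hθ => mem_of_sphA hcone hr hθ)

theorem cont_rad (hcone : ∀ c : ℝ, 0 < c → ∀ x ∈ Γ, c • x ∈ Γ) (hu : GoodOn Γ u 1)
    {θ : sphere (0 : EuclideanSpace ℝ (Fin d)) 1} (hθ : θ ∈ sphA Γ) :
    ContinuousOn (fun r : ℝ =>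
      u (r • (θ : EuclideanSpace ℝ (Fin d)))) (Ioo 0 1) :=
  hu.u_cont.comp (by fun_prop) (fun _ hr => mem_of_sphA hcone hr hθ)

theorem bdd_ray (hcone : ∀ c : ℝ, 0 < c → ∀ x ∈ Γ, c • x ∈ Γ) (hu : GoodOn Γ u 1)
    {q : ℝ} (hq : q < 1) : ∃ C : ℝ, 0 ≤ C ∧ ∀ r ∈ Ioo 0 q, ∀ θ ∈ sphA Γ,
      |u (r • ((θ : sphere (0 : EuclideanSpace ℝ (Fin d)) 1) : EuclideanSpace ℝ (Fin d)))| ≤ C := by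
  obtain ⟨C, hC0, hC⟩ := hu.bdd hq
  refine ⟨C, hC0, fun r hr θ hθ => hC _ ?_⟩
  have := mem_of_sphA hcone hr hθ
  exact ⟨subset_closure this.1, ball_subset_closedBall this.2⟩

theorem hh_cont (hΓ : IsOpen Γ) (hcone : ∀ c : ℝ, 0 < c → ∀ x ∈ Γ, c • x ∈ Γ) (hu : GoodOn Γ u 1) :
    ContinuousOn (fun p : ℝ × ℝ => hh Γ u p.1 p.2) (Ioo 0 1 ×ˢ Ioo 0 1) := by
  have key : ∀ q < 1, ContinuousOn (fun p : ℝ × ℝ => hh Γ u p.1 p.2) (Ioo 0 q ×ˢ Ioo 0 q) := by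
    intro q hq
    obtain ⟨C, hC0, hC⟩ := bdd_ray hcone hu hq
    have hsub : Ioo (0 : ℝ) q ⊆ Ioo 0 1 := Ioo_subset_Ioo_right hq.le
    refine continuousOn_of_dominated (bound := fun _ => C * C) ?_ ?_ (integrable_const _) ?_
    · intro p hp
      exact ((cont_ray hcone hu (hsub hp.1)).mul (cont_ray hcone hu (hsub hp.2))).aestronglyMeasurable
        (sphA_open hΓ).measurableSet
    · intro p hp
      filter_upwards [ae_restrict_mem (sphA_open hΓ).measurableSet] with θ hθ
      rw [norm_mul]
      exact mul_le_mul (hC _ hp.1 _ hθ) (hC _ hp.2 _ hθ) (norm_nonneg _) hC0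
    · filter_upwards [ae_restrict_mem (sphA_open hΓ).measurableSet] with θ hθ
      refine ContinuousOn.mul ?_ ?_
      · exact (cont_rad hcone hu hθ).comp continuousOn_fst (fun p hp => hsub hp.1)
      · exact (cont_rad hcone hu hθ).comp continuousOn_snd (fun p hp => hsub hp.2)
  rintro ⟨a, b⟩ ⟨ha, hb⟩
  obtain ⟨q, hq1, hq2⟩ := exists_between (max_lt ha.2 hb.2)
  refine ((key q hq2).continuousAt ((isOpen_Ioo.prod isOpen_Ioo).mem_nhds ?_)).continuousWithinAt
  exact ⟨⟨ha.1, (le_max_left _ _).trans_lt hq1⟩, ⟨hb.1, (le_max_right _ _).trans_lt hq1⟩⟩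

theorem int_ray (hΓ : IsOpen Γ) (hcone : ∀ c : ℝ, 0 < c → ∀ x ∈ Γ, c • x ∈ Γ) (hu : GoodOn Γ u 1)
    {a b : ℝ} (ha : a ∈ Ioo (0 : ℝ) 1) (hb : b ∈ Ioo (0 : ℝ) 1) :
    IntegrableOn (fun θ : sphere (0 : EuclideanSpace ℝ (Fin d)) 1 =>
      u (a • (θ : EuclideanSpace ℝ (Fin d))) * u (b • (θ : EuclideanSpace ℝ (Fin d))))
      (sphA Γ) (volume : Measure (EuclideanSpace ℝ (Fin d))).toSphere := by
  obtain ⟨q, hq1, hq2⟩ := exists_between (max_lt ha.2 hb.2)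
  obtain ⟨C, hC0, hC⟩ := bdd_ray hcone hu hq2
  refine Integrable.mono' (integrable_const (C * C)) (((cont_ray hcone hu ha).mul
    (cont_ray hcone hu hb)).aestronglyMeasurable (sphA_open hΓ).measurableSet) ?_
  filter_upwards [ae_restrict_mem (sphA_open hΓ).measurableSet] with θ hθ
  rw [norm_mul]
  exact mul_le_mul (hC _ ⟨ha.1, (le_max_left _ _).trans_lt hq1⟩ _ hθ)
    (hC _ ⟨hb.1, (le_max_right _ _).trans_lt hq1⟩ _ hθ) (norm_nonneg _) hC0

theorem polar_bulk [Nontrivial (EuclideanSpace ℝ (Fin d))] (hΓ : IsOpen Γ)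
    (hcone : ∀ c : ℝ, 0 < c → ∀ x ∈ Γ, c • x ∈ Γ)
    {q : EuclideanSpace ℝ (Fin d) → ℝ} {ψ : ℝ → ℝ} {α ρ : ℝ} (hα : 0 < α)
    (h0 : ∀ t, t ∉ Ioo α ρ → ψ t = 0)
    (hI : IntegrableOn (fun x => ψ ‖x‖ * q x) (Γ ∩ ball 0 ρ)) :
    ∫ x in Γ ∩ ball 0 ρ, ψ ‖x‖ * q x =
    ∫ r, ψ r * (r ^ (d - 1) * ∫ θ in sphA Γ, q (r • (θ : EuclideanSpace ℝ (Fin d)))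
      ∂(volume : Measure (EuclideanSpace ℝ (Fin d))).toSphere) := by
  have hm : MeasurableSet (Γ ∩ ball (0 : EuclideanSpace ℝ (Fin d)) ρ) :=
    (hΓ.inter isOpen_ball).measurableSet
  rw [← integral_indicator hm, polar ((integrable_indicator_iff hm).2 hI)]
  rw [← setIntegral_eq_integral_of_forall_compl_eq_zero (s := Ioi 0)
    (f := fun r => ψ r * (r ^ (d - 1) * _))]
  · refine setIntegral_congr_fun measurableSet_Ioi fun r hr => ?_
    have hr' : 0 < r := hr
    beta_reduce
    rw [← integral_indicator (sphA_open hΓ).measurableSet, mul_left_comm]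
    congr 1
    rw [← integral_const_mul]
    congr 1
    ext θ
    have hn : ‖r • (θ : EuclideanSpace ℝ (Fin d))‖ = r := by simp [norm_smul, abs_of_pos hr']
    by_cases hθ : θ ∈ sphA Γ
    · rw [indicator_of_mem hθ]
      by_cases hrρ : r < ρ
      · rw [indicator_of_mem, hn]
        exact mem_of_sphA hcone ⟨hr', hrρ⟩ hθ
      · rw [indicator_of_notMem, h0 r (fun h => hrρ h.2), zero_mul]
        intro h
        have := h.2
        rw [mem_ball_zero_iff, hn] at this
        exact hrρ this
    · rw [indicator_of_notMem hθ, indicator_of_notMem, mul_zero]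
      intro h
      exact hθ ((cone_iff hcone hr' _).1 h.1)
  · intro r hr
    rw [h0 r, zero_mul]
    intro h
    exact hr (hα.trans h.1)

theorem bulk_polar [Nontrivial (EuclideanSpace ℝ (Fin d))] (hΓ : IsOpen Γ)
    (hcone : ∀ c : ℝ, 0 < c → ∀ x ∈ Γ, c • x ∈ Γ)
    (hu : GoodOn Γ u 1) {a τ ρ : ℝ} (ha : |a| ≤ 1) (hτ : 0 ≤ τ) (hρ : ρ < Real.exp (-τ))
    {ψ : ℝ → ℝ} (hψ : Continuous ψ) {α : ℝ} (hα : 0 < α)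
    (h0 : ∀ t, t ∉ Ioo α ρ → ψ t = 0) :
    ∫ x in Γ ∩ ball 0 ρ, ψ ‖x‖ * (u (Real.exp τ • x) * u (Real.exp (a * τ) • x) - u x * u x) =
    ∫ r, ψ r * (r ^ (d - 1) * (hh Γ u (Real.exp τ * r) (Real.exp (a * τ) * r) - hh Γ u r r)) := by
  rcases le_or_gt ρ 0 with hρ0 | hρ0
  · have h1 : ball (0 : EuclideanSpace ℝ (Fin d)) ρ = ∅ := ball_eq_empty.2 hρ0
    have h2 : ∀ r, ψ r = 0 := fun r => h0 r (fun h => by linarith [h.1, h.2])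
    simp [h1, h2]
  have hτm : τ ∈ Icc 0 τ := ⟨hτ, le_rfl⟩
  have g1 := (hu.dil_exp hΓ hcone (a := 1) (by simp) hτm)
  have g2 := (hu.dil_exp hΓ hcone ha hτm)
  have g0 := (hu.dil_exp hΓ hcone (a := 0) (by simp) hτm)
  simp only [one_mul, zero_mul, Real.exp_zero] at g1 g0
  have hd0 : dil u 1 = u := by ext x; simp [dil]
  rw [hd0] at g0
  have hsub : Γ ∩ ball (0 : EuclideanSpace ℝ (Fin d)) ρ ⊆ Γ ∩ ball 0 (Real.exp (-τ)) :=
    inter_subset_inter_right _ (ball_subset_ball hρ.le)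
  have hm : MeasurableSet (Γ ∩ ball (0 : EuclideanSpace ℝ (Fin d)) ρ) :=
    (hΓ.inter isOpen_ball).measurableSet
  rw [polar_bulk hΓ hcone hα h0]
  · congr 1
    ext r
    by_cases hr : r ∈ Ioo α ρ
    · have hr0 : 0 < r := hα.trans hr.1
      have e1 : Real.exp τ * r ∈ Ioo 0 1 := by
        refine ⟨by positivity, ?_⟩
        calc Real.exp τ * r < Real.exp τ * Real.exp (-τ) := by gcongr; exact hr.2.trans hρ
          _ = 1 := by rw [← Real.exp_add]; simp
      have e2 : Real.exp (a * τ) * r ∈ Ioo 0 1 := by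
        refine ⟨by positivity, lt_of_le_of_lt ?_ e1.2⟩
        exact mul_le_mul_of_nonneg_right (exp_le_of_abs ha hτm) hr0.le
      have e3 : r ∈ Ioo (0 : ℝ) 1 := by
        refine ⟨hr0, lt_of_le_of_lt ?_ e1.2⟩
        have : 1 ≤ Real.exp τ := Real.one_le_exp hτ
        nlinarith
      simp only [hh, smul_smul]
      rw [integral_sub (int_ray hΓ hcone hu e1 e2) (int_ray hΓ hcone hu e3 e3)]
    · rw [h0 r hr, zero_mul, zero_mul]
  · obtain ⟨C1, h10, h1⟩ := g1.bdd hρ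
    obtain ⟨C2, h20, h2⟩ := g2.bdd hρ
    obtain ⟨C0, h00, h3⟩ := g0.bdd hρ
    obtain ⟨M, hM⟩ := (isCompact_closedBall (0 : ℝ) ρ).exists_bound_of_continuousOn hψ.continuousOn
    have hM0 : 0 ≤ M := (norm_nonneg _).trans (hM 0 (by simp [hρ0.le]))
    have c1 := g1.u_cont.mono hsub
    have c2 := g2.u_cont.mono hsub
    have c0 := g0.u_cont.mono hsub
    have cψ : ContinuousOn (fun x : EuclideanSpace ℝ (Fin d) => ψ ‖x‖) (Γ ∩ ball 0 ρ) := by fun_prop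
    refine Integrable.mono' (integrable_const (M * (C1 * C2 + C0 * C0)))
      ((cψ.mul ((c1.mul c2).sub (c0.mul c0))).aestronglyMeasurable hm) ?_
    filter_upwards [ae_restrict_mem hm] with x hx
    have hx' : x ∈ closure Γ ∩ closedBall 0 ρ := ⟨subset_closure hx.1, ball_subset_closedBall hx.2⟩
    have hxn : ‖x‖ < ρ := by simpa using hx.2
    have b1 := h1 x hx'
    have b2 := h2 x hx'
    have b3 := h3 x hx'
    rw [norm_mul]
    refine mul_le_mul (hM _ (by simpa using hxn.le)) ?_ (norm_nonneg _) hM0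
    refine (norm_sub_le _ _).trans ?_
    rw [norm_mul, norm_mul]
    exact add_le_add (mul_le_mul b1 b2 (norm_nonneg _) h10) (mul_le_mul b3 b3 (norm_nonneg _) h00)

theorem exp_mul_mem {τ r a : ℝ} (ha : |a| ≤ 1) (hτ : 0 ≤ τ) (hr : r ∈ Ioo 0 (Real.exp (-τ))) :
    Real.exp (a * τ) * r ∈ Ioo (0 : ℝ) 1 := by
  have hr0 := hr.1
  refine ⟨by positivity, ?_⟩
  calc Real.exp (a * τ) * r ≤ Real.exp τ * r :=
        mul_le_mul_of_nonneg_right (exp_le_of_abs ha ⟨hτ, le_rfl⟩) hr0.le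
    _ < Real.exp τ * Real.exp (-τ) := by gcongr; exact hr.2
    _ = 1 := by rw [← Real.exp_add]; simp

theorem hh_diff_cont (hΓ : IsOpen Γ) (hcone : ∀ c : ℝ, 0 < c → ∀ x ∈ Γ, c • x ∈ Γ)
    (hu : GoodOn Γ u 1) {a τ : ℝ} (ha : |a| ≤ 1) (hτ : 0 ≤ τ) :
    ContinuousOn (fun r => hh Γ u (Real.exp τ * r) (Real.exp (a * τ) * r) - hh Γ u r r)
      (Ioo 0 (Real.exp (-τ))) := by
  have h1 : |(1 : ℝ)| ≤ 1 := by simp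
  have h0 : |(0 : ℝ)| ≤ 1 := by simp
  refine ContinuousOn.sub ?_ ?_
  · exact (hh_cont hΓ hcone hu).comp (f := fun r => (Real.exp τ * r, Real.exp (a * τ) * r))
      (by fun_prop) (fun r hr =>
      ⟨by simpa using exp_mul_mem h1 hτ hr, exp_mul_mem ha hτ hr⟩)
  · exact (hh_cont hΓ hcone hu).comp (f := fun r => (r, r)) (by fun_prop) (fun r hr =>
      ⟨by simpa using exp_mul_mem h0 hτ hr, by simpa using exp_mul_mem h0 hτ hr⟩)

theorem hh_ident1 [Nontrivial (EuclideanSpace ℝ (Fin d))] (hΓ : IsOpen Γ)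
    (hcone : ∀ c : ℝ, 0 < c → ∀ x ∈ Γ, c • x ∈ Γ)
    (hu : GoodOn Γ u 1) {τ : ℝ} (hτ : 0 ≤ τ) :
    ∀ r ∈ Ioo 0 (Real.exp (-τ)), hh Γ u (Real.exp τ * r) (Real.exp (-τ) * r) = hh Γ u r r := by
  have ha : |(-1 : ℝ)| ≤ 1 := by simp
  intro r hr
  have key := fund (R := Real.exp (-τ)) (f := fun r => r ^ (d - 1) *
    (hh Γ u (Real.exp τ * r) (Real.exp (-1 * τ) * r) - hh Γ u r r))
    (ContinuousOn.mul (by fun_prop) (hh_diff_cont hΓ hcone hu ha hτ)) ?_ r hr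
  · have := hr.1
    rw [mul_eq_zero] at key
    rcases key with h | h
    · exact absurd h (by positivity)
    · simpa [sub_eq_zero] using h
  · intro ψ α ρ hψ hα hρ h0
    rw [← bulk_polar hΓ hcone hu ha hτ hρ hψ hα h0, bulk hΓ hcone hu ha hτ hρ hψ hα h0]
    simp
end
end

section
section
variable {d : ℕ} {Γ : Set (EuclideanSpace ℝ (Fin d))} {u v : EuclideanSpace ℝ (Fin d) → ℝ}

/-- energy -/
def DD (Γ : Set (EuclideanSpace ℝ (Fin d))) (u : EuclideanSpace ℝ (Fin d) → ℝ) (r : ℝ) : ℝ :=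
  ∫ x in Γ ∩ ball 0 r, ‖gradient u x‖ ^ 2

theorem DD_mono {R : ℝ} (hu : GoodOn Γ u R) {r s : ℝ} (hrs : r ≤ s) (hs : s < R) :
    DD Γ u r ≤ DD Γ u s :=
  setIntegral_mono_set (hu.en _ hs) (Eventually.of_forall fun x => by positivity)
    (inter_subset_inter_right _ (ball_subset_ball hrs)).eventuallyLE

theorem DD_nonneg (r : ℝ) : 0 ≤ DD Γ u r := integral_nonneg fun x => by positivity

theorem DD_eq {r q : ℝ} (hrq : r ≤ q) :
    DD Γ u r = ∫ x in Γ ∩ ball 0 q, (ball (0 : EuclideanSpace ℝ (Fin d)) r).indicator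
      (fun x => ‖gradient u x‖ ^ 2) x := by
  rw [integral_indicator measurableSet_ball, Measure.restrict_restrict measurableSet_ball]
  unfold DD
  congr 2
  ext x
  simp only [mem_inter_iff, mem_ball_zero_iff]
  constructor
  · rintro ⟨a, b⟩; exact ⟨b, a, b.trans_le hrq⟩
  · rintro ⟨a, b, c⟩; exact ⟨b, a⟩

theorem DD_cont [Nontrivial (EuclideanSpace ℝ (Fin d))] {R : ℝ} (hu : GoodOn Γ u R) :
    ContinuousOn (DD Γ u) (Iio R) := by
  intro r0 hr0
  obtain ⟨q, hq1, hq2⟩ := exists_between (show r0 < R from hr0)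
  refine ContinuousAt.continuousWithinAt ?_
  have h1 : (fun r => ∫ x in Γ ∩ ball 0 q, (ball (0 : EuclideanSpace ℝ (Fin d)) r).indicator
      (fun x => ‖gradient u x‖ ^ 2) x) =ᶠ[𝓝 r0] DD Γ u := by
    filter_upwards [Iio_mem_nhds hq1] with r hr
    exact (DD_eq (le_of_lt hr)).symm
  refine ContinuousAt.congr ?_ h1
  refine continuousAt_of_dominated (bound := fun x => ‖gradient u x‖ ^ 2) ?_ ?_ (hu.en q hq2) ?_
  · exact Eventually.of_forall fun r =>
      (hu.en q hq2).aestronglyMeasurable.indicator measurableSet_ball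
  · refine Eventually.of_forall fun r => Eventually.of_forall fun x => ?_
    refine (norm_indicator_le_norm_self _ _).trans ?_
    simp
  · have hs : (volume : Measure (EuclideanSpace ℝ (Fin d))) (sphere 0 r0) = 0 :=
      Measure.addHaar_sphere _ _ _
    have hae : ∀ᵐ x ∂(volume : Measure (EuclideanSpace ℝ (Fin d))), x ∉ sphere 0 r0 :=
      measure_eq_zero_iff_ae_notMem.1 hs
    filter_upwards [ae_restrict_of_ae hae] with x hx
    have hx' : ‖x‖ ≠ r0 := by simpa using hx
    rcases lt_or_gt_of_ne hx' with h | h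
    · have : (fun _ : ℝ => ‖gradient u x‖ ^ 2) =ᶠ[𝓝 r0] fun r =>
          (ball (0 : EuclideanSpace ℝ (Fin d)) r).indicator (fun x => ‖gradient u x‖ ^ 2) x := by
        filter_upwards [Ioi_mem_nhds h] with r hr
        rw [indicator_of_mem]
        simpa using hr
      exact continuousAt_const.congr this
    · have : (fun _ : ℝ => (0 : ℝ)) =ᶠ[𝓝 r0] fun r =>
          (ball (0 : EuclideanSpace ℝ (Fin d)) r).indicator (fun x => ‖gradient u x‖ ^ 2) x := by
        filter_upwards [Iio_mem_nhds h] with r hr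
        rw [indicator_of_notMem]
        simpa using le_of_lt hr
      exact continuousAt_const.congr this

theorem layer (hΓ : IsOpen Γ) {R : ℝ} (hu : GoodOn Γ u R) {ψ : ℝ → ℝ} (hψ : Continuous ψ) {ρ : ℝ}
    (hρ0 : 0 < ρ) (hρ : ρ < R) :
    ∫ x in Γ ∩ ball 0 ρ, Psi ψ ρ ‖x‖ * ‖gradient u x‖ ^ 2 =
      ∫ t in (0)..ρ, t * ψ t * DD Γ u t := by
  have hm : MeasurableSet (Γ ∩ ball (0 : EuclideanSpace ℝ (Fin d)) ρ) :=
    (hΓ.inter isOpen_ball).measurableSet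
  have hc : Continuous fun t => t * ψ t := by fun_prop
  have hI0 : Integrable (fun t => t * ψ t) (volume.restrict (Ioc 0 ρ)) :=
    (hc.integrableOn_Icc (a := 0) (b := ρ)).mono_set Ioc_subset_Icc_self
  have hS : MeasurableSet {p : EuclideanSpace ℝ (Fin d) × ℝ | ‖p.1‖ < p.2} :=
    measurableSet_lt (by fun_prop) (by fun_prop)
  have hI : Integrable (fun p : EuclideanSpace ℝ (Fin d) × ℝ => ‖gradient u p.1‖ ^ 2 * (p.2 * ψ p.2))
      ((volume.restrict (Γ ∩ ball 0 ρ)).prod (volume.restrict (Ioc 0 ρ))) :=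
    Integrable.mul_prod (f := fun x => ‖gradient u x‖ ^ 2) (g := fun t => t * ψ t) (hu.en ρ hρ) hI0
  have hI' := hI.indicator hS
  have h1 : ∀ x ∈ Γ ∩ ball 0 ρ, Psi ψ ρ ‖x‖ * ‖gradient u x‖ ^ 2 =
      ∫ t in Ioc 0 ρ, {p : EuclideanSpace ℝ (Fin d) × ℝ | ‖p.1‖ < p.2}.indicator
        (fun p => ‖gradient u p.1‖ ^ 2 * (p.2 * ψ p.2)) (x, t) := by
    intro x hx
    have hxρ : ‖x‖ < ρ := by simpa using hx.2
    have : ∀ t, {p : EuclideanSpace ℝ (Fin d) × ℝ | ‖p.1‖ < p.2}.indicator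
        (fun p => ‖gradient u p.1‖ ^ 2 * (p.2 * ψ p.2)) (x, t) =
        (Ioi ‖x‖).indicator (fun t => ‖gradient u x‖ ^ 2 * (t * ψ t)) t := fun t => by
      simp [indicator]
    simp only [this]
    rw [integral_indicator measurableSet_Ioi, Measure.restrict_restrict measurableSet_Ioi,
      inter_comm, Ioc_inter_Ioi, sup_of_le_right (norm_nonneg x), integral_const_mul, Psi,
      intervalIntegral.integral_of_le hxρ.le, mul_comm]
  rw [setIntegral_congr_fun hm h1]
  rw [integral_integral_swap (f := fun x t => {p : EuclideanSpace ℝ (Fin d) × ℝ |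
    ‖p.1‖ < p.2}.indicator (fun p => ‖gradient u p.1‖ ^ 2 * (p.2 * ψ p.2)) (x, t)) hI',
    intervalIntegral.integral_of_le hρ0.le]
  refine setIntegral_congr_fun measurableSet_Ioc fun t ht => ?_
  beta_reduce
  rw [DD_eq ht.2, ← integral_const_mul]
  congr 1
  ext x
  simp only [indicator, mem_ofPred_eq, mem_ball_zero_iff]
  split_ifs
  · ring
  · simp

theorem DD_dil (hcone : ∀ c : ℝ, 0 < c → ∀ x ∈ Γ, c • x ∈ Γ) {c : ℝ} (hc : 0 < c) (r : ℝ) :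
    DD Γ (dil u c) r = c ^ 2 * (c ^ d)⁻¹ * DD Γ u (c * r) := energy_scale hcone hc r

/-- scaled energy -/
def KK (Γ : Set (EuclideanSpace ℝ (Fin d))) (u : EuclideanSpace ℝ (Fin d) → ℝ) (s r : ℝ) : ℝ :=
  (Real.exp s) ^ 2 * ((Real.exp s) ^ d)⁻¹ * DD Γ u (Real.exp s * r)

theorem cs_cont (d : ℕ) : Continuous fun s : ℝ => (Real.exp s) ^ 2 * ((Real.exp s) ^ d)⁻¹ := by
  refine Continuous.mul (by fun_prop) (Continuous.inv₀ (by fun_prop) ?_)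
  intro s; positivity

theorem KK_cont [Nontrivial (EuclideanSpace ℝ (Fin d))] (hu : GoodOn Γ u 1) :
    ContinuousOn (fun p : ℝ × ℝ => KK Γ u p.1 p.2) {p | Real.exp p.1 * p.2 < 1} := by
  refine ContinuousOn.mul ((cs_cont d).comp continuous_fst).continuousOn ?_
  exact (DD_cont hu).comp (f := fun p : ℝ × ℝ => Real.exp p.1 * p.2) (by fun_prop)
    (fun p hp => hp)

theorem exp_mul_lt {s τ r : ℝ} (hs : s ≤ τ) (hr : r < Real.exp (-τ)) : Real.exp s * r < 1 := by
  have h1 : Real.exp s * r < Real.exp s * Real.exp (-τ) := by gcongr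
  have h2 : Real.exp s * Real.exp (-τ) ≤ 1 := by
    rw [← Real.exp_add, ← Real.exp_zero]
    exact Real.exp_le_exp.2 (by linarith)
  linarith

theorem int_psi {R : ℝ} {f : ℝ → ℝ} (hf : ContinuousOn f (Ioo 0 R)) {ψ : ℝ → ℝ} {α ρ : ℝ}
    (hψ : Continuous ψ) (hα : 0 < α) (hρ : ρ < R) (h0 : ∀ t, t ∉ Ioo α ρ → ψ t = 0) :
    Integrable fun r => ψ r * f r := by
  have : IntegrableOn (fun r => ψ r * f r) (Icc α ρ) := by
    refine ContinuousOn.integrableOn_Icc (hψ.continuousOn.mul (hf.mono ?_))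
    exact fun x hx => ⟨hα.trans_le hx.1, hx.2.trans_lt hρ⟩
  refine (integrableOn_iff_integrable_of_support_subset ?_).1 this
  intro x hx
  by_contra h
  apply hx
  simp only
  rw [h0 x (fun h' => h (Ioo_subset_Icc_self h')), zero_mul]

theorem fund2 {R : ℝ} {f g : ℝ → ℝ} (hf : ContinuousOn f (Ioo 0 R)) (hg : ContinuousOn g (Ioo 0 R))
    (h : ∀ (ψ : ℝ → ℝ) (α ρ : ℝ), Continuous ψ → 0 < α → ρ < R → (∀ t, t ∉ Ioo α ρ → ψ t = 0) →
      ∫ r, ψ r * f r = ∫ r, ψ r * g r) : ∀ r ∈ Ioo 0 R, f r = g r := by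
  intro r hr
  refine sub_eq_zero.1 (fund (f := fun r => f r - g r) (hf.sub hg) ?_ r hr)
  intro ψ α ρ hψ hα hρ h0
  simp only [mul_sub]
  rw [integral_sub (int_psi hf hψ hα hρ h0) (int_psi hg hψ hα hρ h0), h ψ α ρ hψ hα hρ h0, sub_self]

theorem KK_int_cont [Nontrivial (EuclideanSpace ℝ (Fin d))] (hu : GoodOn Γ u 1) {τ : ℝ}
    (hτ : 0 ≤ τ) :
    ContinuousOn (fun r => ∫ s in (0)..τ, KK Γ u s r) (Ioo 0 (Real.exp (-τ))) := by
  have key : ∀ q < Real.exp (-τ), ContinuousOn (fun r => ∫ s in (0)..τ, KK Γ u s r) (Ioo 0 q) := by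
    intro q hq
    simp only [intervalIntegral.integral_of_le hτ]
    refine continuousOn_of_dominated (bound := fun s => (Real.exp s) ^ 2 * ((Real.exp s) ^ d)⁻¹ *
      DD Γ u (Real.exp τ * q)) ?_ ?_ ?_ ?_
    · intro r hr
      refine ContinuousOn.aestronglyMeasurable ?_ measurableSet_Ioc
      exact (KK_cont hu).comp (f := fun s => (s, r)) (by fun_prop)
        (fun s hs => exp_mul_lt hs.2 (hr.2.trans hq))
    · intro r hr
      filter_upwards [ae_restrict_mem measurableSet_Ioc] with s hs
      rw [KK, Real.norm_of_nonneg (mul_nonneg (by positivity) (DD_nonneg _))]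
      refine mul_le_mul_of_nonneg_left (DD_mono hu ?_ (exp_mul_lt le_rfl hq)) (by positivity)
      exact mul_le_mul (Real.exp_le_exp.2 hs.2) hr.2.le hr.1.le (Real.exp_pos _).le
    · refine Integrable.mul_const ?_ _
      exact ((cs_cont d).integrableOn_Icc (a := 0) (b := τ)).mono_set Ioc_subset_Icc_self
    · filter_upwards [ae_restrict_mem measurableSet_Ioc] with s hs
      exact (KK_cont hu).comp (f := fun r => (s, r)) (by fun_prop)
        (fun r hr => exp_mul_lt hs.2 (hr.2.trans hq))
  intro r hr
  obtain ⟨q, hq1, hq2⟩ := exists_between hr.2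
  exact ((key q hq2).continuousAt (Ioo_mem_nhds hr.1 hq1)).continuousWithinAt

theorem hh_ident2 [Nontrivial (EuclideanSpace ℝ (Fin d))] (hΓ : IsOpen Γ)
    (hcone : ∀ c : ℝ, 0 < c → ∀ x ∈ Γ, c • x ∈ Γ)
    (hu : GoodOn Γ u 1) {τ : ℝ} (hτ : 0 ≤ τ) :
    ∀ r ∈ Ioo 0 (Real.exp (-τ)),
      r ^ (d - 1) * (hh Γ u (Real.exp τ * r) (Real.exp τ * r) - hh Γ u r r) =
      2 * r * ∫ s in (0)..τ, KK Γ u s r := by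
  have ha : |(1 : ℝ)| ≤ 1 := by simp
  have hc := hh_diff_cont hΓ hcone hu ha hτ
  simp only [one_mul] at hc
  refine fund2 (ContinuousOn.mul (by fun_prop) hc)
    (ContinuousOn.mul (by fun_prop) (KK_int_cont hu hτ)) ?_
  intro ψ α ρ hψ hα hρ h0
  have h1 := bulk_polar hΓ hcone hu ha hτ hρ hψ hα h0
  rw [bulk hΓ hcone hu ha hτ hρ hψ hα h0] at h1
  simp only [one_mul] at h1
  rw [← h1]
  rcases le_or_gt ρ 0 with hρ0 | hρ0
  · have h1 : ball (0 : EuclideanSpace ℝ (Fin d)) ρ = ∅ := ball_eq_empty.2 hρ0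
    have h2 : ∀ r, ψ r = 0 := fun r => h0 r (fun h => by linarith [h.1, h.2])
    simp [h1, h2]
  have h2 : ∀ s ∈ uIcc 0 τ, (1 + 1) * ∫ x in Γ ∩ ball 0 ρ, Psi ψ ρ ‖x‖ *
      inner ℝ (gradient (dil u (Real.exp s)) x) (gradient (dil u (Real.exp s)) x) =
      ∫ t in (0)..ρ, 2 * (t * ψ t) * KK Γ u s t := by
    intro s hs
    rw [uIcc_of_le hτ] at hs
    have hg := hu.dil_exp hΓ hcone ha hs
    rw [one_mul] at hg
    simp only [real_inner_self_eq_norm_sq]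
    rw [layer hΓ hg hψ hρ0 hρ, ← intervalIntegral.integral_const_mul]
    congr 1
    ext t
    rw [DD_dil hcone (Real.exp_pos s), KK]
    ring
  rw [intervalIntegral.integral_congr h2]
  rw [intervalIntegral_intervalIntegral_swap]
  · have h3 : ∫ r, ψ r * (2 * r * ∫ s in (0)..τ, KK Γ u s r) =
        ∫ r in Ioc 0 ρ, ψ r * (2 * r * ∫ s in (0)..τ, KK Γ u s r) := by
      symm
      refine setIntegral_eq_integral_of_forall_compl_eq_zero fun r hr => ?_
      rw [h0 r (fun h => hr ⟨hα.trans h.1, h.2.le⟩), zero_mul]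
    rw [h3, intervalIntegral.integral_of_le hρ0.le]
    refine setIntegral_congr_fun measurableSet_Ioc fun t ht => ?_
    beta_reduce
    rw [intervalIntegral.integral_const_mul]
    ring
  · have hcc : ContinuousOn (fun p : ℝ × ℝ => 2 * (p.2 * ψ p.2) * KK Γ u p.1 p.2)
        (Icc 0 τ ×ˢ Icc 0 ρ) := by
      refine ContinuousOn.mul (by fun_prop) ((KK_cont hu).mono ?_)
      rintro ⟨s, t⟩ ⟨hs, ht⟩
      exact exp_mul_lt hs.2 (ht.2.trans_lt hρ)
    have := hcc.integrableOn_compact (μ := volume) (isCompact_Icc.prod isCompact_Icc)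
    rw [uIoc_of_le hτ, uIoc_of_le hρ0.le]
    exact this.mono_set (prod_mono Ioc_subset_Icc_self Ioc_subset_Icc_self)
end
end

section
theorem logconv_mono {f p : ℝ → ℝ} (hpos : ∀ t < 0, 0 < f t)
    (hder : ∀ t < 0, HasDerivAt f (p t) t)
    (hconv : ∀ t τ : ℝ, 0 ≤ τ → t + τ < 0 → f t ^ 2 ≤ f (t + τ) * f (t - τ)) :
    ∀ a b : ℝ, a ≤ b → b < 0 → p a / f a ≤ p b / f b := by
  intro a b hab hb
  rcases hab.eq_or_lt with rfl | hab
  · exact le_rfl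
  have hd : ∀ t < 0, HasDerivAt (fun t => Real.log (f t)) (p t / f t) t := fun t ht =>
    (hder t ht).log (hpos t ht).ne'
  have hmid : ∀ t τ : ℝ, 0 ≤ τ → t + τ < 0 →
      Real.log (f t) - Real.log (f (t - τ)) ≤ Real.log (f (t + τ)) - Real.log (f t) := by
    intro t τ hτ ht
    have h1 := hpos t (by linarith)
    have h2 := hpos (t + τ) ht
    have h3 := hpos (t - τ) (by linarith)
    have h4 := Real.log_le_log (by positivity) (hconv t τ hτ ht)
    rw [Real.log_mul h2.ne' h3.ne', Real.log_pow] at h4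
    push_cast at h4
    linarith
  have hstep : ∀ (δ : ℝ), 0 < δ → ∀ n : ℕ, a + n * δ + δ < 0 →
      Real.log (f (a + δ)) - Real.log (f a) ≤
        Real.log (f (a + n * δ + δ)) - Real.log (f (a + n * δ)) := by
    intro δ hδ n
    induction n with
    | zero => intro _; simp
    | succ n ih =>
      intro hn
      push_cast at hn ⊢
      have h1 := ih (by nlinarith)
      have h2 := hmid (a + (n + 1) * δ) δ hδ.le hn
      have e1 : a + (n + 1) * δ - δ = a + n * δ := by ring
      have e2 : a + n * δ + δ = a + (n + 1) * δ := by ring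
      rw [e1] at h2
      rw [e2] at h1
      linarith
  set δ : ℕ → ℝ := fun n => (b - a) / ((n : ℝ) + 1) with hδ
  have hδpos : ∀ n, 0 < δ n := fun n => by
    have : 0 < b - a := by linarith
    simp only [hδ]; positivity
  have hδ0 : Tendsto δ atTop (𝓝[≠] 0) := by
    rw [tendsto_nhdsWithin_iff]
    refine ⟨?_, Eventually.of_forall fun n => (hδpos n).ne'⟩
    have := (tendsto_one_div_add_atTop_nhds_zero_nat (𝕜 := ℝ)).const_mul (b - a)
    simpa [hδ, div_eq_mul_inv] using this
  have la := (hasDerivAt_iff_tendsto_slope_zero.1 (hd a (hab.trans hb))).comp hδ0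
  have lb := (hasDerivAt_iff_tendsto_slope_zero.1 (hd b hb)).comp hδ0
  have hev : ∀ᶠ n in atTop, δ n < -b :=
    (hδ0.mono_right nhdsWithin_le_nhds).eventually (Iio_mem_nhds (by linarith))
  refine le_of_tendsto_of_tendsto la lb ?_
  filter_upwards [hev] with n hn
  simp only [Function.comp, smul_eq_mul]
  refine mul_le_mul_of_nonneg_left ?_ (inv_nonneg.2 (hδpos n).le)
  have e : a + ((n + 1 : ℕ) : ℝ) * δ n = b := by
    simp only [hδ]; push_cast; field_simp; ring
  have := hstep (δ n) (hδpos n) (n + 1) (by rw [e]; linarith)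
  rwa [e] at this

theorem logconv_zero {f : ℝ → ℝ}
    (hconv : ∀ t τ : ℝ, 0 ≤ τ → t + τ < 0 → f t ^ 2 ≤ f (t + τ) * f (t - τ))
    {z : ℝ} (hz : z < 0) (hfz : f z = 0) : ∀ t < 0, f t = 0 := by
  have h1 : ∀ z < 0, f z = 0 → ∀ t < z / 2, f t = 0 := by
    intro z hz hfz t ht
    have : f t ^ 2 ≤ 0 := by
      rcases le_total z t with h | h
      · have := hconv t (t - z) (by linarith) (by linarith)
        simpa [hfz] using this
      · have := hconv t (z - t) (by linarith) (by linarith)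
        simpa [hfz] using this
    exact pow_eq_zero_iff (two_ne_zero) |>.1 (le_antisymm this (sq_nonneg _))
  have h2 : ∀ n : ℕ, f (z * (2 / 3) ^ n) = 0 := by
    intro n
    induction n with
    | zero => simpa using hfz
    | succ n ih =>
      have hp : (0 : ℝ) < (2 / 3) ^ n := by positivity
      refine h1 _ (by nlinarith) ih _ ?_
      rw [pow_succ]
      nlinarith
  intro t ht
  have h3 : Tendsto (fun n : ℕ => z * (2 / 3 : ℝ) ^ n) atTop (𝓝 (z * 0)) :=
    (_root_.tendsto_pow_atTop_nhds_zero_of_lt_one (by norm_num) (by norm_num)).const_mul z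
  obtain ⟨n, hn⟩ := (h3.eventually (Ioi_mem_nhds (show 2 * t < z * 0 by linarith))).exists
  have hp : (0 : ℝ) < (2 / 3) ^ n := by positivity
  exact h1 _ (by nlinarith) (h2 n) t (by linarith [show 2 * t < z * (2 / 3 : ℝ) ^ n from hn])

section
variable {d : ℕ} {Γ : Set (EuclideanSpace ℝ (Fin d))} {u v : EuclideanSpace ℝ (Fin d) → ℝ}

theorem hh_cs (hΓ : IsOpen Γ) (hcone : ∀ c : ℝ, 0 < c → ∀ x ∈ Γ, c • x ∈ Γ) (hu : GoodOn Γ u 1)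
    {a b : ℝ} (ha : a ∈ Ioo (0 : ℝ) 1) (hb : b ∈ Ioo (0 : ℝ) 1) :
    hh Γ u a b ^ 2 ≤ hh Γ u a a * hh Γ u b b := by
  have h : ∀ x : ℝ, 0 ≤ hh Γ u a a * (x * x) + 2 * hh Γ u a b * x + hh Γ u b b := by
    intro x
    have i1 := int_ray hΓ hcone hu ha ha
    have i2 := int_ray hΓ hcone hu ha hb
    have i3 := int_ray hΓ hcone hu hb hb
    have e : hh Γ u a a * (x * x) + 2 * hh Γ u a b * x + hh Γ u b b =
        ∫ θ in sphA Γ, (x * x) * (u (a • (θ : EuclideanSpace ℝ (Fin d))) *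
          u (a • (θ : EuclideanSpace ℝ (Fin d)))) + (2 * x) *
          (u (a • (θ : EuclideanSpace ℝ (Fin d))) * u (b • (θ : EuclideanSpace ℝ (Fin d)))) +
          u (b • (θ : EuclideanSpace ℝ (Fin d))) * u (b • (θ : EuclideanSpace ℝ (Fin d)))
          ∂(volume : Measure (EuclideanSpace ℝ (Fin d))).toSphere := by
      have i12 : IntegrableOn (fun θ : sphere (0 : EuclideanSpace ℝ (Fin d)) 1 =>
          (x * x) * (u (a • (θ : EuclideanSpace ℝ (Fin d))) *
          u (a • (θ : EuclideanSpace ℝ (Fin d)))) + (2 * x) *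
          (u (a • (θ : EuclideanSpace ℝ (Fin d))) * u (b • (θ : EuclideanSpace ℝ (Fin d)))))
          (sphA Γ) (volume : Measure (EuclideanSpace ℝ (Fin d))).toSphere :=
        (i1.const_mul _).add (i2.const_mul _)
      rw [integral_add i12 i3,
        integral_add (i1.const_mul _) (i2.const_mul _), integral_const_mul, integral_const_mul]
      simp only [hh]
      ring
    rw [e]
    refine integral_nonneg fun θ => ?_
    have := sq_nonneg (x * u (a • (θ : EuclideanSpace ℝ (Fin d))) +
      u (b • (θ : EuclideanSpace ℝ (Fin d))))
    simp only [Pi.zero_apply]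
    nlinarith
  have := discrim_le_zero h
  rw [discrim] at this
  nlinarith

theorem exp_mem {t : ℝ} (ht : t < 0) : Real.exp t ∈ Ioo (0 : ℝ) 1 :=
  ⟨Real.exp_pos t, (Real.exp_lt_exp.2 ht).trans_eq Real.exp_zero⟩

theorem hh_conv [Nontrivial (EuclideanSpace ℝ (Fin d))] (hΓ : IsOpen Γ)
    (hcone : ∀ c : ℝ, 0 < c → ∀ x ∈ Γ, c • x ∈ Γ) (hu : GoodOn Γ u 1)
    (t τ : ℝ) (hτ : 0 ≤ τ) (ht : t + τ < 0) :
    hh Γ u (Real.exp t) (Real.exp t) ^ 2 ≤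
      hh Γ u (Real.exp (t + τ)) (Real.exp (t + τ)) *
      hh Γ u (Real.exp (t - τ)) (Real.exp (t - τ)) := by
  have h := hh_ident1 hΓ hcone hu hτ (Real.exp t)
    ⟨Real.exp_pos t, Real.exp_lt_exp.2 (by linarith)⟩
  rw [← Real.exp_add, ← Real.exp_add, add_comm τ t, show -τ + t = t - τ by ring] at h
  rw [← h]
  exact hh_cs hΓ hcone hu (exp_mem ht) (exp_mem (by linarith))

theorem hh_nonneg (r : ℝ) : 0 ≤ hh Γ u r r :=
  integral_nonneg fun θ => mul_self_nonneg _

theorem hh_pos [Nontrivial (EuclideanSpace ℝ (Fin d))] (hΓ : IsOpen Γ)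
    (hcone : ∀ c : ℝ, 0 < c → ∀ x ∈ Γ, c • x ∈ Γ) (hu : GoodOn Γ u 1)
    (hnz : ∃ x ∈ Γ ∩ ball (0 : EuclideanSpace ℝ (Fin d)) 1, u x ≠ 0) :
    ∀ t < 0, 0 < hh Γ u (Real.exp t) (Real.exp t) := by
  intro z hz
  refine lt_of_le_of_ne (hh_nonneg _) fun h0 => ?_
  have hall := logconv_zero (f := fun t => hh Γ u (Real.exp t) (Real.exp t))
    (hh_conv hΓ hcone hu) hz h0.symm
  have hall2 : ∀ r ∈ Ioo (0 : ℝ) 1, ∀ θ ∈ sphA Γ, u (r • (θ : EuclideanSpace ℝ (Fin d))) = 0 := by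
    intro r hr
    have h1 : hh Γ u r r = 0 := by
      have := hall (Real.log r) (Real.log_neg hr.1 hr.2)
      simpa [Real.exp_log hr.1] using this
    have h2 := (integral_eq_zero_iff_of_nonneg (fun θ => mul_self_nonneg _)
      (int_ray hΓ hcone hu hr hr)).1 h1
    refine Measure.eqOn_open_of_ae_eq (g := fun _ => (0 : ℝ)) ?_ (sphA_open hΓ)
      (cont_ray hcone hu hr) continuousOn_const (μ :=
        (volume : Measure (EuclideanSpace ℝ (Fin d))).toSphere)
    filter_upwards [h2] with θ hθ
    simpa using hθ
  obtain ⟨x, hx, hux⟩ := hnz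
  have hopen : IsOpen (Γ ∩ ball (0 : EuclideanSpace ℝ (Fin d)) 1) := hΓ.inter isOpen_ball
  have hca : ContinuousAt u x := hu.u_cont.continuousAt (hopen.mem_nhds hx)
  have hev : ∀ᶠ y in 𝓝 x, u y ≠ 0 ∧ y ∈ Γ ∩ ball 0 1 :=
    (hca.eventually_ne hux).and (hopen.mem_nhds hx)
  obtain ⟨y, hy0, hyu, hyΓ⟩ : ∃ y : EuclideanSpace ℝ (Fin d), y ≠ 0 ∧ u y ≠ 0 ∧ y ∈ Γ ∩ ball 0 1 := by
    by_cases hx0 : x = 0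
    · subst hx0
      haveI : (𝓝[≠] (0 : EuclideanSpace ℝ (Fin d))).NeBot := inferInstance
      obtain ⟨y, hy, hy'⟩ := ((eventually_mem_nhdsWithin (a := (0 : EuclideanSpace ℝ (Fin d)))
        (s := {0}ᶜ)).and (hev.filter_mono nhdsWithin_le_nhds)).exists
      exact ⟨y, hy, hy'⟩
    · exact ⟨x, hx0, hux, hx⟩
  have hn : 0 < ‖y‖ := norm_pos_iff.2 hy0
  apply hyu
  have hmem : ‖y‖⁻¹ • y ∈ sphere (0 : EuclideanSpace ℝ (Fin d)) 1 := by
    simp [norm_smul, hn.ne']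
  have := hall2 ‖y‖ ⟨hn, by simpa using hyΓ.2⟩ ⟨‖y‖⁻¹ • y, hmem⟩
    (hcone _ (inv_pos.2 hn) _ hyΓ.1)
  simpa [smul_smul, hn.ne'] using this

theorem KK_shift (t s : ℝ) :
    KK Γ u (t + s) 1 = (Real.exp t) ^ 2 * ((Real.exp t) ^ d)⁻¹ * KK Γ u s (Real.exp t) := by
  simp only [KK, mul_one, Real.exp_add, mul_pow, mul_inv, mul_comm (Real.exp s) (Real.exp t)]
  ring

theorem hh_ftc [Nontrivial (EuclideanSpace ℝ (Fin d))] (hd : 2 ≤ d) (hΓ : IsOpen Γ)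
    (hcone : ∀ c : ℝ, 0 < c → ∀ x ∈ Γ, c • x ∈ Γ) (hu : GoodOn Γ u 1)
    {a b : ℝ} (hab : a ≤ b) (hb : b < 0) :
    hh Γ u (Real.exp b) (Real.exp b) = hh Γ u (Real.exp a) (Real.exp a) +
      ∫ s in a..b, 2 * KK Γ u s 1 := by
  have h := hh_ident2 hΓ hcone hu (τ := b - a) (by linarith) (Real.exp a)
    ⟨Real.exp_pos a, Real.exp_lt_exp.2 (by linarith)⟩
  rw [← Real.exp_add, show b - a + a = b by ring] at h
  have h2 : ∫ s in a..b, 2 * KK Γ u s 1 = ∫ s in (0)..(b - a), 2 * KK Γ u (a + s) 1 := by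
    rw [intervalIntegral.integral_comp_add_left (fun s => 2 * KK Γ u s 1) a]
    congr 1 <;> ring
  have h3 : ∫ s in (0)..(b - a), 2 * KK Γ u (a + s) 1 =
      2 * ((Real.exp a) ^ 2 * ((Real.exp a) ^ d)⁻¹) * ∫ s in (0)..(b - a), KK Γ u s (Real.exp a) := by
    rw [← intervalIntegral.integral_const_mul]
    congr 1
    ext s
    rw [KK_shift]
    ring
  rw [h2, h3]
  have hp := Real.exp_pos a
  have hpow : Real.exp a ^ d = Real.exp a ^ (d - 1) * Real.exp a := by
    rw [← pow_succ]; congr 1; omega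
  rw [hpow]
  have : hh Γ u (Real.exp b) (Real.exp b) - hh Γ u (Real.exp a) (Real.exp a) =
      2 * (Real.exp a ^ 2 * (Real.exp a ^ (d - 1) * Real.exp a)⁻¹) *
        ∫ s in (0)..(b - a), KK Γ u s (Real.exp a) := by
    field_simp
    linarith
  linarith

theorem hh_deriv [Nontrivial (EuclideanSpace ℝ (Fin d))] (hd : 2 ≤ d) (hΓ : IsOpen Γ)
    (hcone : ∀ c : ℝ, 0 < c → ∀ x ∈ Γ, c • x ∈ Γ) (hu : GoodOn Γ u 1)
    (t : ℝ) (ht : t < 0) :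
    HasDerivAt (fun t => hh Γ u (Real.exp t) (Real.exp t)) (2 * KK Γ u t 1) t := by
  have hc : ContinuousOn (fun s => 2 * KK Γ u s 1) (Iio 0) := by
    refine continuousOn_const.mul ?_
    exact (KK_cont hu).comp (f := fun s => (s, (1 : ℝ))) (by fun_prop)
      (fun s hs => by simpa using (show s < 0 from hs))
  have h1 : HasDerivAt (fun b => hh Γ u (Real.exp (t - 1)) (Real.exp (t - 1)) +
      ∫ s in (t - 1)..b, 2 * KK Γ u s 1) (2 * KK Γ u t 1) t := by
    refine HasDerivAt.const_add _ ?_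
    refine intervalIntegral.integral_hasDerivAt_right ?_ ?_ (hc.continuousAt (Iio_mem_nhds ht))
    · refine (hc.mono ?_).intervalIntegrable
      rw [uIcc_of_le (by linarith)]
      exact fun x hx => hx.2.trans_lt ht
    · exact hc.stronglyMeasurableAtFilter isOpen_Iio t ht
  refine h1.congr_of_eventuallyEq ?_
  filter_upwards [Ioo_mem_nhds (show t - 1 < t by linarith) ht] with b hb
  exact hh_ftc hd hΓ hcone hu hb.1.le hb.2

theorem freq_mono [Nontrivial (EuclideanSpace ℝ (Fin d))] (hd : 2 ≤ d) (hΓ : IsOpen Γ)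
    (hcone : ∀ c : ℝ, 0 < c → ∀ x ∈ Γ, c • x ∈ Γ) (hu : GoodOn Γ u 1)
    (hnz : ∃ x ∈ Γ ∩ ball (0 : EuclideanSpace ℝ (Fin d)) 1, u x ≠ 0)
    {a b : ℝ} (ha : a ∈ Ioo (0 : ℝ) 1) (hb : b ∈ Ioo (0 : ℝ) 1) (hab : a ≤ b) :
    a * DD Γ u a / (a ^ (d - 1) * hh Γ u a a) ≤ b * DD Γ u b / (b ^ (d - 1) * hh Γ u b b) := by
  have h := logconv_mono (f := fun t => hh Γ u (Real.exp t) (Real.exp t))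
    (hh_pos hΓ hcone hu hnz) (hh_deriv hd hΓ hcone hu) (hh_conv hΓ hcone hu) (Real.log a)
    (Real.log b) (Real.log_le_log ha.1 hab) (Real.log_neg hb.1 hb.2)
  have key : ∀ r ∈ Ioo (0 : ℝ) 1, r * DD Γ u r / (r ^ (d - 1) * hh Γ u r r) =
      2⁻¹ * (2 * KK Γ u (Real.log r) 1 / hh Γ u (Real.exp (Real.log r)) (Real.exp (Real.log r))) := by
    intro r hr
    have hr0 := hr.1
    have hpow : r ^ d = r ^ (d - 1) * r := by
      rw [← pow_succ]; congr 1; omega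
    rw [KK, Real.exp_log hr0, mul_one, hpow]
    have hp := hh_pos hΓ hcone hu hnz (Real.log r) (Real.log_neg hr.1 hr.2)
    rw [Real.exp_log hr0] at hp
    field_simp
  rw [key a ha, key b hb]
  exact mul_le_mul_of_nonneg_left h (by norm_num)
end
end

section
section
variable {d : ℕ} {Γ : Set (EuclideanSpace ℝ (Fin d))} {u v : EuclideanSpace ℝ (Fin d) → ℝ}

theorem haus_scale_meas {s r : ℝ} (hs : 0 ≤ s) (hr : 0 < r)
    (A : Set (EuclideanSpace ℝ (Fin d))) :
    (μH[s] : Measure (sphere (0 : EuclideanSpace ℝ (Fin d)) 1))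
      ((fun θ => r • (θ : EuclideanSpace ℝ (Fin d))) ⁻¹' A) =
      (‖r⁻¹‖₊ ^ s) • μH[s] (A ∩ sphere 0 r) := by
  rw [← isometry_subtype_coe.hausdorffMeasure_image (Or.inl hs),
    ← Measure.hausdorffMeasure_smul₀ hs (inv_ne_zero hr.ne')]
  congr 1
  ext x
  rw [Set.mem_smul_set_iff_inv_smul_mem₀ (inv_ne_zero hr.ne'), inv_inv]
  constructor
  · rintro ⟨θ, hθ, rfl⟩
    refine ⟨hθ, ?_⟩
    simp [norm_smul, abs_of_pos hr]
  · rintro ⟨h1, h2⟩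
    have hx : x ∈ sphere (0 : EuclideanSpace ℝ (Fin d)) 1 := by
      simpa [norm_smul, abs_of_pos hr, hr.ne'] using h2
    exact ⟨⟨x, hx⟩, h1, rfl⟩

theorem haus_scale_int (hΓ : IsOpen Γ) (hcone : ∀ c : ℝ, 0 < c → ∀ x ∈ Γ, c • x ∈ Γ)
    {s r : ℝ} (hs : 0 ≤ s) (hr : 0 < r) (g : EuclideanSpace ℝ (Fin d) → ℝ) :
    ∫ x in sphere (0 : EuclideanSpace ℝ (Fin d)) r ∩ Γ, g x ∂μH[s] =
      r ^ s * ∫ θ in sphA Γ, g (r • (θ : EuclideanSpace ℝ (Fin d)))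
        ∂(μH[s] : Measure (sphere (0 : EuclideanSpace ℝ (Fin d)) 1)) := by
  have hφ : MeasurableEmbedding (fun θ : sphere (0 : EuclideanSpace ℝ (Fin d)) 1 =>
      r • (θ : EuclideanSpace ℝ (Fin d))) := by
    refine (Continuous.isClosedEmbedding (by fun_prop) ?_).measurableEmbedding
    intro x y hxy
    exact Subtype.ext (smul_right_injective _ hr.ne' hxy)
  have hmap : Measure.map (fun θ : sphere (0 : EuclideanSpace ℝ (Fin d)) 1 =>
      r • (θ : EuclideanSpace ℝ (Fin d))) μH[s] =
      (‖r⁻¹‖₊ ^ s) • (μH[s] : Measure (EuclideanSpace ℝ (Fin d))).restrict (sphere 0 r) := by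
    ext A hA
    rw [hφ.map_apply, haus_scale_meas hs hr, Measure.smul_apply, Measure.restrict_apply hA]
  have hpre : (fun θ : sphere (0 : EuclideanSpace ℝ (Fin d)) 1 =>
      r • (θ : EuclideanSpace ℝ (Fin d))) ⁻¹' Γ = sphA Γ := by
    ext θ
    refine ⟨fun h => ?_, fun h => hcone r hr _ h⟩
    have := hcone r⁻¹ (inv_pos.2 hr) _ h
    simpa [sphA, smul_smul, hr.ne'] using this
  have h := hφ.setIntegral_map (μ := μH[s]) g Γ
  rw [hpre] at h
  rw [← h, hmap, Measure.restrict_smul, Measure.restrict_restrict hΓ.measurableSet,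
    integral_smul_nnreal_measure, inter_comm, NNReal.smul_def, smul_eq_mul, ← mul_assoc]
  have : r ^ s * ((‖r⁻¹‖₊ ^ s : NNReal) : ℝ) = 1 := by
    rw [NNReal.coe_rpow, coe_nnnorm, norm_inv, Real.norm_of_nonneg hr.le,
      ← Real.mul_rpow hr.le (inv_nonneg.2 hr.le), mul_inv_cancel₀ hr.ne', Real.one_rpow]
  rw [this, one_mul]

theorem int_zero_of_inf (hΓ : IsOpen Γ) (hcone : ∀ c : ℝ, 0 < c → ∀ x ∈ Γ, c • x ∈ Γ)
    (hu : GoodOn Γ u 1) {r : ℝ} (hr : r ∈ Ioo (0 : ℝ) 1)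
    (μ : Measure (sphere (0 : EuclideanSpace ℝ (Fin d)) 1))
    (hμ : ∀ x : sphere (0 : EuclideanSpace ℝ (Fin d)) 1, ∀ ρ, 0 < ρ → μ (ball x ρ) = ∞) :
    ∫ θ in sphA Γ, u (r • (θ : EuclideanSpace ℝ (Fin d))) ^ 2 ∂μ = 0 := by
  by_cases h0 : ∀ θ ∈ sphA Γ, u (r • (θ : EuclideanSpace ℝ (Fin d))) = 0
  · rw [setIntegral_congr_fun (g := fun _ => (0 : ℝ)) (sphA_open hΓ).measurableSet
      (fun θ hθ => by simp [h0 θ hθ])]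
    simp
  push Not at h0
  obtain ⟨θ, hθ, hne⟩ := h0
  refine integral_undef fun h_intg => ?_
  have hc : ContinuousAt (fun θ : sphere (0 : EuclideanSpace ℝ (Fin d)) 1 =>
      u (r • (θ : EuclideanSpace ℝ (Fin d))) ^ 2) θ :=
    ((cont_ray hcone hu hr).continuousAt ((sphA_open hΓ).mem_nhds hθ)).pow 2
  have hp : 0 < u (r • (θ : EuclideanSpace ℝ (Fin d))) ^ 2 := by positivity
  set ε := u (r • (θ : EuclideanSpace ℝ (Fin d))) ^ 2 / 2 with hε
  have hev : ∀ᶠ η : sphere (0 : EuclideanSpace ℝ (Fin d)) 1 in 𝓝 θ, ε < u (r • (η : EuclideanSpace ℝ (Fin d))) ^ 2 :=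
    hc.eventually (Ioi_mem_nhds (by linarith))
  obtain ⟨ρ, hρ, hball⟩ := Metric.mem_nhds_iff.1 (hev.and ((sphA_open hΓ).mem_nhds hθ))
  have hlt := h_intg.measure_norm_ge_lt_top (ε := ε) (by linarith)
  have : μ (ball θ ρ) ≤ (μ.restrict (sphA Γ))
      {η | ε ≤ ‖u (r • (η : EuclideanSpace ℝ (Fin d))) ^ 2‖} := by
    rw [← Measure.restrict_eq_self μ (show ball θ ρ ⊆ sphA Γ from fun η hη => (hball hη).2)]
    refine measure_mono fun η hη => ?_
    exact (hball hη).1.le.trans (le_abs_self _)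
  rw [hμ θ ρ hρ] at this
  exact absurd hlt (not_lt.2 this)

theorem main_aux (hd : 2 ≤ d) (hΓ : IsOpen Γ)
    (hcone : ∀ c : ℝ, 0 < c → ∀ x ∈ Γ, c • x ∈ Γ) (hu : GoodOn Γ u 1)
    (hnz : ∃ x ∈ Γ ∩ ball (0 : EuclideanSpace ℝ (Fin d)) 1, u x ≠ 0) :
    MonotoneOn (fun r : ℝ =>
      r * (∫ x in Γ ∩ ball (0 : EuclideanSpace ℝ (Fin d)) r, ‖gradient u x‖ ^ 2) /
        ∫ x in sphere (0 : EuclideanSpace ℝ (Fin d)) r ∩ Γ, (u x) ^ 2 ∂μH[((d : ℝ) - 1)])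
      (Ioo 0 1) := by
  have hd1 : (1 : ℝ) ≤ d := by exact_mod_cast (by omega : 1 ≤ d)
  haveI : Nonempty (Fin d) := ⟨⟨0, by omega⟩⟩
  haveI : Nontrivial (EuclideanSpace ℝ (Fin d)) := inferInstance
  intro a ha b hb hab
  have hsc : ∀ r ∈ Ioo (0 : ℝ) 1, ∫ x in sphere (0 : EuclideanSpace ℝ (Fin d)) r ∩ Γ,
      (u x) ^ 2 ∂μH[((d : ℝ) - 1)] =
      r ^ (d - 1) * ∫ θ in sphA Γ, u (r • (θ : EuclideanSpace ℝ (Fin d))) ^ 2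
        ∂(μH[((d : ℝ) - 1)] : Measure (sphere (0 : EuclideanSpace ℝ (Fin d)) 1)) := by
    intro r hr
    rw [haus_scale_int hΓ hcone (by linarith) hr.1, ← Real.rpow_natCast,
      Nat.cast_sub (by omega), Nat.cast_one]
  simp only [hsc a ha, hsc b hb]
  rcases haus_sphere_cases (E := EuclideanSpace ℝ (Fin d)) ((d : ℝ) - 1) with h | h | ⟨c, hc0, hct, h⟩
  · simp [h]
  · simp [int_zero_of_inf hΓ hcone hu ha _ h, int_zero_of_inf hΓ hcone hu hb _ h]
  · have hI : ∀ r : ℝ, ∫ θ in sphA Γ, u (r • (θ : EuclideanSpace ℝ (Fin d))) ^ 2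
        ∂(μH[((d : ℝ) - 1)] : Measure (sphere (0 : EuclideanSpace ℝ (Fin d)) 1)) =
        c.toReal * hh Γ u r r := by
      intro r
      rw [h, Measure.restrict_smul, integral_smul_measure, smul_eq_mul, hh]
      simp only [sq]
    have hcp : 0 < c.toReal := ENNReal.toReal_pos hc0 hct
    have key := mul_le_mul_of_nonneg_left (freq_mono hd hΓ hcone hu hnz ha hb hab)
      (inv_nonneg.2 hcp.le)
    have e : ∀ r : ℝ, r * (∫ x in Γ ∩ ball (0 : EuclideanSpace ℝ (Fin d)) r, ‖gradient u x‖ ^ 2) /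
        (r ^ (d - 1) * (c.toReal * hh Γ u r r)) =
        c.toReal⁻¹ * (r * DD Γ u r / (r ^ (d - 1) * hh Γ u r r)) := by
      intro r
      rw [DD, mul_left_comm, div_mul_eq_div_div_swap, div_eq_mul_inv _ c.toReal]
      exact mul_comm _ _
    rw [hI, hI, e, e]
    exact key
end
end

/-- **Boundary monotonicity formula for the Dirichlet problem on a cone.**
Let `Γ ⊂ ℝ^d` be a nonempty open cone and let `u` be a nontrivial solution of the
Dirichlet problem on `Γ ∩ B_1` (harmonic inside, continuous up to the boundary,
vanishing on `∂Γ ∩ B_1`), with finite Dirichlet energy on `Γ ∩ B_r` for every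
`r ∈ (0,1)`.  Then the frequency
`F(r) = r ∫_{Γ∩B_r} |∇u|² dx / ∫_{∂B_r∩Γ} |u|² dH^{d-1}`
is monotonically nondecreasing on `(0,1)`. -/
theorem cone_dirichlet_monotonicity
    (d : ℕ) (hd : 2 ≤ d)
    (Γ : Set (EuclideanSpace ℝ (Fin d)))
    (hΓopen : IsOpen Γ) (hΓne : Γ.Nonempty)
    (hΓcone : ∀ c : ℝ, 0 < c → ∀ x ∈ Γ, c • x ∈ Γ)
    (u : EuclideanSpace ℝ (Fin d) → ℝ)
    (hucont : ContinuousOn u (closure Γ ∩ ball 0 1))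
    (huharm : HarmonicOn u (Γ ∩ ball 0 1))
    (huzero : ∀ x ∈ frontier Γ ∩ ball (0 : EuclideanSpace ℝ (Fin d)) 1, u x = 0)
    (hnz : ∃ x ∈ Γ ∩ ball (0 : EuclideanSpace ℝ (Fin d)) 1, u x ≠ 0)
    (henergy : ∀ r ∈ Ioo (0 : ℝ) 1,
      IntegrableOn (fun x => ‖gradient u x‖ ^ 2) (Γ ∩ ball 0 r)) :
    MonotoneOn (fun r : ℝ =>
      r * (∫ x in Γ ∩ ball (0 : EuclideanSpace ℝ (Fin d)) r, ‖gradient u x‖ ^ 2) /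
        ∫ x in sphere (0 : EuclideanSpace ℝ (Fin d)) r ∩ Γ, (u x) ^ 2 ∂μH[((d : ℝ) - 1)])
      (Ioo 0 1) := by
  refine main_aux hd hΓopen hΓcone ⟨hucont, huharm.1, huharm.2, huzero, fun r hr => ?_⟩ hnz
  rcases le_or_gt r 0 with h | h
  · simp [ball_eq_empty.2 h]
  · exact henergy r ⟨h, hr⟩
end
end

section
/- Let d ≥ 2, let B_1^+ = B_1 ∩ {x ∈ ℝ^d : x_d > 0} and T = B_1 ∩ {x_d = 0}. Let u be continuously differentiable on B_1^+ ∪ T, harmonic in B_1^+, not identically zero, and satisfy the Neumann condition ∂u/∂x_d = 0 on T. Then the frequency F(r) = r ∫_{B_r^+} |∇u|² dx / ∫_{∂B_r ∩ {x_d > 0}} |u|² dH^{d−1} is a monotonically nondecreasing function of r on (0,1). -/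
open MeasureTheory Topology Filter Metric Set ENNReal

noncomputable section

abbrev EE (n : ℕ) := EuclideanSpace ℝ (Fin (n+1))

abbrev SS (n : ℕ) := sphere (0 : EE n) 1

/-- surface measure on the upper half sphere -/
def sg {n : ℕ} (k : Fin (n+1)) : Measure (SS n) :=
  ((volume : Measure (EE n)).toSphere).restrict {ω | 0 < (ω : EE n) k}

instance {n : ℕ} (k : Fin (n+1)) : IsFiniteMeasure (sg k) := by unfold sg; infer_instance

lemma lemA {n : ℕ} (k : Fin (n+1)) (W : Fin (n+1) → EE n → ℝ)
    (W' : Fin (n+1) → EE n → EE n →L[ℝ] ℝ) (g : EE n → ℝ) (hW : ∀ i, Continuous (W i))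
    (hg : Continuous g) (ρ ρ' : ℝ) (hρ : ρ ≤ 1) (hρ' : ρ' < ρ)
    (hd : ∀ x : EE n, ‖x‖ < ρ → 0 < x k → ∀ i, HasFDerivAt (W i) (W' i x) x)
    (hdiv : ∀ x : EE n, ‖x‖ < ρ → 0 < x k → ∑ i, W' i x (EuclideanSpace.single i 1) = g x)
    (hk : ∀ x : EE n, ‖x‖ < ρ → x k = 0 → W k x = 0)
    (φ ψ : ℝ → ℝ) (hφ : Continuous φ) (hψ : ∀ t, HasDerivAt ψ (t * φ t) t)
    (hφ0 : ∀ t, ρ' ≤ t → φ t = 0) (hψ0 : ∀ t, ρ' ≤ t → ψ t = 0) :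
    ∫ x in {x : EE n | 0 < x k}, (ψ ‖x‖ * g x + φ ‖x‖ * ∑ i, W i x * x i) = 0 := by
  classical
  set P : Set (EE n) := {x : EE n | 0 < x k} with hP
  have hPo : IsOpen P := isOpen_lt continuous_const (by fun_prop)
  have hψc : Continuous ψ := continuous_iff_continuousAt.2 fun t => (hψ t).continuousAt
  set Q : EE n → ℝ := fun x => ψ ‖x‖ * g x + φ ‖x‖ * ∑ i, W i x * x i with hQ
  have hQc : Continuous Q := by fun_prop
  have hQ0 : ∀ x : EE n, ρ' ≤ ‖x‖ → Q x = 0 := by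
    intro x hx; simp [hQ, hφ0 _ hx, hψ0 _ hx]
  have hQs : HasCompactSupport Q := by
    apply HasCompactSupport.intro (isCompact_closedBall (0 : EE n) ρ')
    intro x hx
    apply hQ0
    simp at hx; exact hx.le
  have hQi : Integrable Q := hQc.integrable_of_hasCompactSupport hQs
  set V' : Fin (n+1) → EE n → EE n →L[ℝ] ℝ := fun i x =>
    if x ∈ P ∧ ‖x‖ < ρ then ψ ‖x‖ • W' i x + (W i x) • (φ ‖x‖ • innerSL ℝ x) else 0 with hV'
  have hnorm : ∀ x ∈ P, HasFDerivAt (fun y : EE n => ψ ‖y‖) (φ ‖x‖ • innerSL ℝ x) x := by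
    intro x hx
    have hx0 : x ≠ 0 := by rintro rfl; simp [hP] at hx
    have hx0' : ‖x‖ ≠ 0 := norm_ne_zero_iff.2 hx0
    have h1 : HasFDerivAt (fun y : EE n => ‖y‖) (‖x‖⁻¹ • innerSL ℝ x) x := by
      have h2 := (hasStrictFDerivAt_norm_sq x).hasFDerivAt
      have h3 := h2.sqrt (by positivity)
      simp only [Real.sqrt_sq (norm_nonneg _)] at h3
      refine h3.congr_fderiv ?_
      match_scalars
      field_simp
    have h4 := (hψ ‖x‖).comp_hasFDerivAt x h1
    refine h4.congr_fderiv ?_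
    match_scalars
    field_simp
  have hV : ∀ x ∈ P, ∀ i, HasFDerivAt (fun y => ψ ‖y‖ * W i y) (V' i x) x := by
    intro x hx i
    by_cases h : ‖x‖ < ρ
    · simp only [hV', hx, h, and_self, if_true]
      exact (hnorm x hx).mul (hd x h hx i)
    · simp only [hV', hx, h, and_false, if_false]
      apply (hasFDerivAt_const (0:ℝ) x).congr_of_eventuallyEq
      have : ∀ᶠ y : EE n in 𝓝 x, ρ' < ‖y‖ :=
        continuous_norm.continuousAt.eventually (lt_mem_nhds (lt_of_lt_of_le hρ' (not_lt.1 h)))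
      filter_upwards [this] with y hy
      simp [hψ0 _ hy.le]
  have hsum : ∀ x, ∑ i, V' i x (EuclideanSpace.single i 1) = P.indicator Q x := by
    intro x
    by_cases hx : x ∈ P
    · by_cases h : ‖x‖ < ρ
      · simp only [hV', hx, h, and_self, if_true, indicator_of_mem, hQ]
        rw [← hdiv x h hx, Finset.mul_sum, Finset.mul_sum, ← Finset.sum_add_distrib]
        refine Finset.sum_congr rfl fun i _ => ?_
        simp [EuclideanSpace.inner_single_right]
        ring
      · simp only [hV', hx, h, and_false, if_false, indicator_of_mem]
        rw [hQ0 x (by linarith)]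
        simp
    · simp [hV', hx]
  -- transport
  let T : (Fin (n+1) → ℝ) →L[ℝ] EE n := (EuclideanSpace.equiv (Fin (n+1)) ℝ).symm.toContinuousLinearMap
  have hT : ∀ y i, T y i = y i := fun y i => rfl
  have hmp : MeasurePreserving (T : (Fin (n+1) → ℝ) → EE n) volume volume :=
    EuclideanSpace.volume_preserving_symm_measurableEquiv_toLp (Fin (n+1)) |>.symm
  have hTe : MeasurableEmbedding (T : (Fin (n+1) → ℝ) → EE n) :=
    (EuclideanSpace.equiv (Fin (n+1)) ℝ).symm.toHomeomorph.measurableEmbedding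
  let a : Fin (n+1) → ℝ := fun i => if i = k then 0 else -1
  let b : Fin (n+1) → ℝ := fun i => 1
  have hle : a ≤ b := by intro i; simp only [a, b]; split_ifs <;> norm_num
  have hcoord : ∀ (x : EE n) i, |x i| ≤ ‖x‖ := fun x i => by
    simpa using PiLp.norm_apply_le x i
  have key := integral_divergence_of_hasFDerivAt_off_countable' a b hle
    (fun i y => ψ ‖T y‖ * W i (T y)) (fun i y => (V' i (T y)).comp T) ∅ countable_empty
    (fun i => Continuous.continuousOn (by have := hW i; fun_prop))
    (by
      intro y hy i
      have hyP : T y ∈ P := by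
        have := hy.1 k (mem_univ _)
        simp only [a, if_true] at this
        exact this.1
      exact (hV (T y) hyP i).comp y T.hasFDerivAt)
    (by
      have : Integrable (fun y => P.indicator Q (T y)) :=
        hmp.integrable_comp_of_integrable (hQi.indicator hPo.measurableSet)
      refine this.integrableOn.congr_fun (fun y _ => ?_) measurableSet_Icc
      change P.indicator Q (T y) = _
      rw [← hsum]
      rfl)
  have hface : ∀ (i : Fin (n+1)) (y : Fin n → ℝ) (c : ℝ), |c| = 1 →
      ψ ‖T (i.insertNth c y)‖ = 0 := by
    intro i y c hc
    apply hψ0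
    have := hcoord (T (i.insertNth c y)) i
    rw [hT] at this
    simp [hc] at this
    linarith
  rw [Finset.sum_eq_zero] at key
  · rw [← integral_indicator hPo.measurableSet, ← hmp.integral_comp hTe, ← key]
    rw [← setIntegral_eq_integral_of_forall_compl_eq_zero (s := Icc a b)]
    · refine setIntegral_congr_fun measurableSet_Icc fun y _ => ?_
      change P.indicator Q (T y) = _
      rw [← hsum]
      refine Finset.sum_congr rfl fun i _ => ?_
      rfl
    · intro y hy
      by_cases hyP : T y ∈ P
      · rw [indicator_of_mem hyP]
        by_contra hne
        apply hy
        have hlt : ‖T y‖ < ρ' := by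
          by_contra hh; exact hne (hQ0 _ (not_lt.1 hh))
        have : ∀ i, |y i| ≤ 1 := fun i => by
          have := hcoord (T y) i; rw [hT] at this; linarith
        constructor
        · intro i
          simp only [a]; split_ifs with hi
          · subst hi; exact le_of_lt hyP
          · exact (abs_le.1 (this i)).1
        · intro i; exact (abs_le.1 (this i)).2
      · rw [indicator_of_notMem hyP]
  · intro i _
    have h1 : ∀ y : Fin n → ℝ, ψ ‖T (i.insertNth (b i) y)‖ * W i (T (i.insertNth (b i) y)) = 0 := by
      intro y; rw [hface i y (b i) (by simp [b]), zero_mul]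
    have h2 : ∀ y : Fin n → ℝ, ψ ‖T (i.insertNth (a i) y)‖ * W i (T (i.insertNth (a i) y)) = 0 := by
      intro y
      by_cases hi : i = k
      · subst hi
        by_cases h : ‖T (i.insertNth (a i) y)‖ < ρ
        · rw [hk _ h (by rw [hT]; simp [a]), mul_zero]
        · rw [hψ0 _ (by linarith), zero_mul]
      · rw [hface i y (a i) (by simp [a, hi]), zero_mul]
    simp only [h1, h2, integral_zero, sub_self]

lemma polar_s10 {n : ℕ} (f : EE n → ℝ) (hf : Integrable f) :
    ∫ x, f x = ∫ t in Ioi (0:ℝ), t ^ n * ∫ ω : SS n, f (t • (ω : EE n)) ∂(volume : Measure (EE n)).toSphere := by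
  have hdim : Module.finrank ℝ (EE n) - 1 = n := by simp
  have hmp := (volume : Measure (EE n)).measurePreserving_homeomorphUnitSphereProd
  rw [hdim] at hmp
  have hemb := (homeomorphUnitSphereProd (EE n)).measurableEmbedding
  let g : SS n × Ioi (0:ℝ) → ℝ := fun p => f ((p.2 : ℝ) • (p.1 : EE n))
  have hg : ∀ x, g (homeomorphUnitSphereProd (EE n) x) = f x := by
    intro x
    have := congrArg Subtype.val ((homeomorphUnitSphereProd (EE n)).symm_apply_apply x)
    rw [homeomorphUnitSphereProd_symm_apply_coe] at this
    simp only [g, this]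
  have hgi : Integrable g ((volume : Measure (EE n)).toSphere.prod (Measure.volumeIoiPow n)) := by
    rw [← hmp.integrable_comp_emb hemb]
    have : g ∘ (homeomorphUnitSphereProd (EE n)) = f ∘ Subtype.val := by
      ext x; simp [hg]
    rw [this, ← integrableOn_iff_comap_subtypeVal (measurableSet_singleton _).compl]
    exact hf.integrableOn
  calc ∫ x, f x = ∫ x : ({(0)}ᶜ : Set (EE n)), f x ∂(Measure.comap Subtype.val volume) := by
        rw [integral_subtype_comap (measurableSet_singleton _).compl fun x ↦ f x,
          restrict_compl_singleton]
    _ = ∫ p, g p ∂((volume : Measure (EE n)).toSphere.prod (Measure.volumeIoiPow n)) := by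
        rw [← hmp.integral_comp hemb]
        simp [hg]
    _ = ∫ t : Ioi (0:ℝ), ∫ ω, g (ω, t) ∂(volume : Measure (EE n)).toSphere ∂(Measure.volumeIoiPow n) :=
        integral_prod_symm _ hgi
    _ = _ := by
      simp only [Measure.volumeIoiPow, ENNReal.ofReal, g]
      rw [integral_withDensity_eq_integral_smul,
        integral_subtype_comap measurableSet_Ioi fun a ↦ Real.toNNReal (a ^ n) • ∫ ω : SS n, f (a • (ω : EE n)) ∂(volume : Measure (EE n)).toSphere,
        setIntegral_congr_fun measurableSet_Ioi fun x hx ↦ ?_]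
      · simp only [NNReal.smul_def]
        rw [Real.coe_toNNReal _ (pow_nonneg hx.out.le _), smul_eq_mul]
      · exact (measurable_subtype_coe.pow_const _).real_toNNReal

lemma measP {n : ℕ} (k : Fin (n+1)) : MeasurableSet {x : EE n | 0 < x k} :=
  (isOpen_lt continuous_const (by fun_prop)).measurableSet

lemma measPS {n : ℕ} (k : Fin (n+1)) : MeasurableSet {x : SS n | 0 < (x : EE n) k} :=
  (isOpen_lt continuous_const (by fun_prop)).measurableSet

lemma polarP {n : ℕ} (k : Fin (n+1)) (f : EE n → ℝ) (hf : IntegrableOn f {x : EE n | 0 < x k}) :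
    ∫ x in {x : EE n | 0 < x k}, f x = ∫ t in Ioi (0:ℝ), t ^ n * ∫ ω : SS n, f (t • (ω : EE n)) ∂(sg k) := by
  rw [← integral_indicator (measP k), polar_s10 _ (hf.integrable_indicator (measP k))]
  refine setIntegral_congr_fun measurableSet_Ioi fun t ht => ?_
  have ht : 0 < t := ht
  simp only [sg]
  rw [← integral_indicator (measPS k)]
  congr 1
  congr 1
  ext ω
  simp [indicator, ht]

lemma cont_sph {n : ℕ} (k : Fin (n+1)) (f : ℝ → SS n → ℝ) (hf : Continuous (Function.uncurry f)) :
    Continuous fun t : ℝ => ∫ ω, f t ω ∂(sg k) := by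
  have := continuous_parametric_integral_of_continuous (μ := sg k) hf isCompact_univ
  simpa using this

lemma ballD {n : ℕ} (k : Fin (n+1)) (g : EE n → ℝ) (hg : Continuous g) (r : ℝ) (hr : 0 < r) :
    ∫ x in ball (0 : EE n) r ∩ {x : EE n | 0 < x k}, g x
      = ∫ t in (0:ℝ)..r, t ^ n * ∫ ω : SS n, g (t • (ω : EE n)) ∂(sg k) := by
  have hi : IntegrableOn g (ball (0 : EE n) r) :=
    (hg.continuousOn.integrableOn_compact (isCompact_closedBall (0 : EE n) r)).mono_set ball_subset_closedBall
  rw [inter_comm, ← setIntegral_indicator measurableSet_ball, polarP k _ (hi.integrable_indicator measurableSet_ball).integrableOn,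
    intervalIntegral.integral_of_le hr.le, integral_Ioc_eq_integral_Ioo]
  have hn : ∀ t : ℝ, 0 < t → ∀ ω : SS n, ‖t • (ω : EE n)‖ = t := by
    intro t ht ω; rw [norm_smul, norm_eq_of_mem_sphere, mul_one, Real.norm_of_nonneg ht.le]
  rw [setIntegral_eq_of_subset_of_forall_sdiff_eq_zero (s := Ioo 0 r) measurableSet_Ioi (fun t ht => ht.1)]
  · refine setIntegral_congr_fun measurableSet_Ioo fun t ht => ?_
    congr 2
    ext ω
    rw [indicator_of_mem]
    rw [mem_ball_zero_iff, hn t ht.1]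
    exact ht.2
  · intro t ht
    have ht0 : 0 < t := ht.1
    have h1 : ∀ ω : SS n, (ball (0 : EE n) r).indicator g (t • (ω : EE n)) = 0 := by
      intro ω
      rw [indicator_of_notMem]
      rw [mem_ball_zero_iff, hn t ht0]
      intro hlt
      exact ht.2 ⟨ht0, hlt⟩
    simp [h1]

lemma lemC {n : ℕ} (k : Fin (n+1)) (W : Fin (n+1) → EE n → ℝ)
    (W' : Fin (n+1) → EE n → EE n →L[ℝ] ℝ) (g : EE n → ℝ) (hW : ∀ i, Continuous (W i))
    (hg : Continuous g) (ρ : ℝ) (hρ : ρ ≤ 1)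
    (hd : ∀ x : EE n, ‖x‖ < ρ → 0 < x k → ∀ i, HasFDerivAt (W i) (W' i x) x)
    (hdiv : ∀ x : EE n, ‖x‖ < ρ → 0 < x k → ∑ i, W' i x (EuclideanSpace.single i 1) = g x)
    (hk : ∀ x : EE n, ‖x‖ < ρ → x k = 0 → W k x = 0) (r : ℝ) (hr : 0 < r) (hrρ : r < ρ) :
    ∫ x in ball (0 : EE n) r ∩ {x : EE n | 0 < x k}, g x
      = r ^ n * ∫ ω : SS n, ∑ i, W i (r • (ω : EE n)) * (ω : EE n) i ∂(sg k) := by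
  have hρ0 : 0 < ρ := hr.trans hrρ
  set a : ℝ → ℝ := fun t => t ^ n * ∫ ω : SS n, g (t • (ω : EE n)) ∂(sg k) with ha
  set b : ℝ → ℝ := fun t => t ^ n * ∫ ω : SS n, ∑ i, W i (t • (ω : EE n)) * (ω : EE n) i ∂(sg k) with hb
  have hac : Continuous a := by
    apply Continuous.mul (by fun_prop)
    exact cont_sph k (fun t ω => g (t • (ω : EE n))) (by unfold Function.uncurry; fun_prop)
  have hbc : Continuous b := by
    apply Continuous.mul (by fun_prop)
    exact cont_sph k (fun t ω => ∑ i, W i (t • (ω : EE n)) * (ω : EE n) i) (by unfold Function.uncurry; fun_prop)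
  set A : ℝ → ℝ := fun t => ∫ s in (0:ℝ)..t, a s with hA
  have hAd : ∀ t, HasDerivAt A (a t) t := fun t =>
    intervalIntegral.integral_hasDerivAt_right (hac.intervalIntegrable _ _)
      (hac.stronglyMeasurableAtFilter _ _) hac.continuousAt
  have hAc : Continuous A := continuous_iff_continuousAt.2 fun t => (hAd t).continuousAt
  have hkc : Continuous fun t => t * (b t - A t) := by fun_prop
  have hae := IsOpen.ae_eq_zero_of_integral_contDiff_smul_eq_zero (μ := (volume : Measure ℝ))
    (U := Ioo 0 ρ) isOpen_Ioo (f := fun t => t * (b t - A t)) (hkc.locallyIntegrable.locallyIntegrableOn _) (by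
      intro φ hφ hφc hφs
      have hφcont := hφ.continuous
      obtain ⟨ρ', hρ', hφ0⟩ : ∃ ρ' < ρ, ∀ t, ρ' ≤ t → φ t = 0 := by
        rcases (tsupport φ).eq_empty_or_nonempty with he | hne
        · refine ⟨ρ - 1, by linarith, fun t _ => ?_⟩
          apply image_eq_zero_of_notMem_tsupport
          simp [he]
        · obtain ⟨m, hm, hmax⟩ := hφc.exists_isMaxOn hne continuous_id.continuousOn
          have hmρ := (hφs hm).2
          refine ⟨(m + ρ) / 2, by linarith, fun t ht => ?_⟩
          apply image_eq_zero_of_notMem_tsupport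
          intro htm
          have : t ≤ m := hmax htm
          linarith
      have hsφ : Continuous fun s => s * φ s := by fun_prop
      set ψ : ℝ → ℝ := fun t => ∫ s in ρ..t, s * φ s with hψdef
      have hψ : ∀ t, HasDerivAt ψ (t * φ t) t := fun t =>
        intervalIntegral.integral_hasDerivAt_right (hsφ.intervalIntegrable _ _)
          (hsφ.stronglyMeasurableAtFilter _ _) hsφ.continuousAt
      have hψ0 : ∀ t, ρ' ≤ t → ψ t = 0 := by
        intro t ht
        apply intervalIntegral.integral_zero_ae
        refine Eventually.of_forall fun s hs => ?_
        have : min ρ t < s := hs.1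
        have h2 : ρ' ≤ min ρ t := le_min hρ'.le ht
        rw [hφ0 s (by linarith), mul_zero]
      have hψc : Continuous ψ := continuous_iff_continuousAt.2 fun t => (hψ t).continuousAt
      have h0 := lemA k W W' g hW hg ρ ρ' hρ hρ' hd hdiv hk φ ψ hφcont hψ hφ0 hψ0
      rw [polarP] at h0
      · have h1 : ∀ t ∈ Ioi (0:ℝ), t ^ n * ∫ ω : SS n, (ψ ‖t • (ω : EE n)‖ * g (t • (ω : EE n)) + φ ‖t • (ω : EE n)‖ * ∑ i, W i (t • (ω : EE n)) * (t • (ω : EE n)) i) ∂(sg k) = ψ t * a t + t * φ t * b t := by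
          intro t ht
          have ht : 0 < t := ht
          have hn : ∀ ω : SS n, ‖t • (ω : EE n)‖ = t := by
            intro ω; rw [norm_smul, norm_eq_of_mem_sphere, mul_one, Real.norm_of_nonneg ht.le]
          simp only [hn]
          rw [integral_add, integral_const_mul, integral_const_mul]
          · have : ∀ ω : SS n, ∑ i, W i (t • (ω : EE n)) * (t • (ω : EE n)) i = t * ∑ i, W i (t • (ω : EE n)) * (ω : EE n) i := by
              intro ω
              rw [Finset.mul_sum]
              refine Finset.sum_congr rfl fun i _ => ?_
              simp; ring
            simp only [this]
            rw [integral_const_mul]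
            simp only [ha, hb]
            ring
          · exact Continuous.integrable_of_hasCompactSupport (by fun_prop) (HasCompactSupport.of_compactSpace _)
          · exact Continuous.integrable_of_hasCompactSupport (by fun_prop) (HasCompactSupport.of_compactSpace _)
        rw [setIntegral_congr_fun measurableSet_Ioi h1] at h0
        have h2 : ∫ t in Ioi (0:ℝ), (ψ t * a t + t * φ t * b t) = ∫ t in (0:ℝ)..ρ, (ψ t * a t + t * φ t * b t) := by
          rw [intervalIntegral.integral_of_le hρ0.le]
          refine setIntegral_eq_of_subset_of_forall_sdiff_eq_zero measurableSet_Ioi (fun t ht => ht.1) ?_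
          intro t ht
          have : ρ < t := by
            by_contra hh
            exact ht.2 ⟨ht.1, not_lt.1 hh⟩
          rw [hψ0 t (by linarith), hφ0 t (by linarith)]
          ring
        rw [h2] at h0
        have hparts := intervalIntegral.integral_mul_deriv_eq_deriv_mul (a := 0) (b := ρ)
          (u := ψ) (v := A) (u' := fun t => t * φ t) (v' := a) (fun t _ => hψ t) (fun t _ => hAd t)
          (hsφ.intervalIntegrable _ _) (hac.intervalIntegrable _ _)
        have hA0 : A 0 = 0 := by simp [hA]
        rw [hψ0 ρ hρ'.le, hA0] at hparts
        rw [intervalIntegral.integral_add (Continuous.intervalIntegrable (by fun_prop) _ _) (Continuous.intervalIntegrable (by fun_prop) _ _), hparts] at h0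
        have h3 : ∫ t, φ t • (t * (b t - A t)) = ∫ t in (0:ℝ)..ρ, φ t • (t * (b t - A t)) := by
          rw [intervalIntegral.integral_of_le hρ0.le]
          symm
          apply setIntegral_eq_integral_of_forall_compl_eq_zero
          intro t ht
          rw [image_eq_zero_of_notMem_tsupport (f := φ), zero_smul]
          intro hh
          exact ht (Ioo_subset_Ioc_self (hφs hh))
        rw [h3]
        have h4 : ∫ t in (0:ℝ)..ρ, φ t • (t * (b t - A t)) = (∫ t in (0:ℝ)..ρ, t * φ t * b t) - ∫ t in (0:ℝ)..ρ, t * φ t * A t := by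
          rw [← intervalIntegral.integral_sub (Continuous.intervalIntegrable (by fun_prop) _ _) (Continuous.intervalIntegrable (by fun_prop) _ _)]
          refine intervalIntegral.integral_congr fun t _ => ?_
          simp only [smul_eq_mul]; ring
        rw [h4]
        linarith
      · apply Integrable.integrableOn
        apply Continuous.integrable_of_hasCompactSupport (by fun_prop)
        apply HasCompactSupport.intro (isCompact_closedBall (0 : EE n) ρ')
        intro x hx
        simp at hx
        simp [hφ0 _ hx.le, hψ0 _ hx.le])
  have heq : EqOn (fun t => t * (b t - A t)) (fun _ => 0) (Ioo 0 ρ) :=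
    Measure.eqOn_open_of_ae_eq ((ae_restrict_iff' measurableSet_Ioo).2 hae) isOpen_Ioo hkc.continuousOn continuousOn_const
  have := heq ⟨hr, hrρ⟩
  simp only [mul_eq_zero, hr.ne', false_or] at this
  rw [ballD k g hg r hr]
  change A r = b r
  linarith

lemma uniq_aux {S : Type*} [MetricSpace S] [CompactSpace S] [MeasurableSpace S] [BorelSpace S]
    (μ ν : Measure S) [IsFiniteMeasure μ] [IsFiniteMeasure ν] 
    (g h : ℝ → ℝ) (hμ : ∀ ε > 0, ∀ x, μ.real (ball x ε) = g ε)
    (hν : ∀ ε > 0, ∀ x, ν.real (ball x ε) = h ε) (hg : ∀ ε > 0, 0 < g ε) (f : S → ℝ) (hf : Continuous f) :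
    ν.real univ * ∫ x, f x ∂μ = μ.real univ * ∫ x, f x ∂ν := by
  classical
  have fub : ∀ ε > 0, ∀ f : S → ℝ, Continuous f →
      ∫ x, (∫ y in ball x ε, f y ∂μ) ∂ν = h ε * ∫ y, f y ∂μ := by
    intro ε hε f hf
    have hopen : IsOpen {p : S × S | dist p.2 p.1 < ε} := isOpen_lt (by fun_prop) continuous_const
    have hfi : Integrable (fun p : S × S => f p.2) (ν.prod μ) :=
      Continuous.integrable_of_hasCompactSupport (by fun_prop) (HasCompactSupport.of_compactSpace _)
    have hI : Integrable ({p : S × S | dist p.2 p.1 < ε}.indicator (fun p => f p.2)) (ν.prod μ) :=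
      hfi.indicator hopen.measurableSet
    have h1 : ∀ x, ∫ y in ball x ε, f y ∂μ = ∫ y, {p : S × S | dist p.2 p.1 < ε}.indicator (fun p => f p.2) (x, y) ∂μ := by
      intro x
      rw [← integral_indicator measurableSet_ball]
      rfl
    simp_rw [h1]
    rw [integral_integral_swap (f := fun x y => {p : S × S | dist p.2 p.1 < ε}.indicator (fun p => f p.2) (x, y)) hI]
    have h2 : ∀ y, ∫ x, {p : S × S | dist p.2 p.1 < ε}.indicator (fun p => f p.2) (x, y) ∂ν = h ε * f y := by
      intro y
      have : (fun x => {p : S × S | dist p.2 p.1 < ε}.indicator (fun p => f p.2) (x, y)) = (ball y ε).indicator (fun _ => f y) := by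
        ext x
        simp [indicator, dist_comm]
      rw [this, integral_indicator measurableSet_ball, setIntegral_const, hν ε hε, smul_eq_mul]
    simp_rw [h2]
    rw [integral_const_mul]
  have hone : ∀ ε > 0, g ε * ν.real univ = h ε * μ.real univ := by
    intro ε hε
    have := fub ε hε (fun _ => 1) continuous_const
    simp only [integral_const, smul_eq_mul, mul_one, measureReal_restrict_apply_univ, hμ ε hε] at this
    linarith
  have hfμ : Integrable f μ := hf.integrable_of_hasCompactSupport (HasCompactSupport.of_compactSpace _)
  have hfν : Integrable f ν := hf.integrable_of_hasCompactSupport (HasCompactSupport.of_compactSpace _)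
  have huc : UniformContinuous f := CompactSpace.uniformContinuous_of_continuous hf
  have main : ∀ δ > 0, |ν.real univ * ∫ x, f x ∂μ - μ.real univ * ∫ x, f x ∂ν| ≤ δ * (μ.real univ * ν.real univ) := by
    intro δ hδ
    obtain ⟨ε, hε, hε'⟩ := Metric.uniformContinuous_iff.1 huc δ hδ
    have hgε := hg ε hε
    have hb : ∀ x, ‖∫ y in ball x ε, f y ∂μ - g ε * f x‖ ≤ δ * g ε := by
      intro x
      have e1 : ∫ y in ball x ε, f y ∂μ - g ε * f x = ∫ y in ball x ε, (f y - f x) ∂μ := by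
        rw [integral_sub hfμ.integrableOn (integrable_const _), setIntegral_const, hμ ε hε, smul_eq_mul]
      rw [e1, ← hμ ε hε x]
      apply norm_setIntegral_le_of_norm_le_const (measure_lt_top _ _)
      intro y hy
      exact (hε' hy).le
    have hmeas : Integrable (fun x => ∫ y in ball x ε, f y ∂μ) ν := by
      have hopen : IsOpen {p : S × S | dist p.2 p.1 < ε} := isOpen_lt (by fun_prop) continuous_const
      have hfi : Integrable (fun p : S × S => f p.2) (ν.prod μ) :=
        Continuous.integrable_of_hasCompactSupport (by fun_prop) (HasCompactSupport.of_compactSpace _)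
      have hI : Integrable ({p : S × S | dist p.2 p.1 < ε}.indicator (fun p => f p.2)) (ν.prod μ) :=
        hfi.indicator hopen.measurableSet
      refine hI.integral_prod_left.congr (Eventually.of_forall fun x => ?_)
      simp only
      rw [← integral_indicator measurableSet_ball]
      rfl
    have e2 : ‖∫ x, (∫ y in ball x ε, f y ∂μ - g ε * f x) ∂ν‖ ≤ (δ * g ε) * ν.real univ :=
      norm_integral_le_of_norm_le_const (Eventually.of_forall hb)
    rw [integral_sub hmeas (hfν.const_mul _), integral_const_mul, fub ε hε f hf, Real.norm_eq_abs] at e2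
    have h1 := hone ε hε
    have hμ0 : 0 ≤ μ.real univ := measureReal_nonneg
    have e3 : g ε * |ν.real univ * ∫ x, f x ∂μ - μ.real univ * ∫ x, f x ∂ν| = μ.real univ * |h ε * ∫ x, f x ∂μ - g ε * ∫ x, f x ∂ν| := by
      rw [← abs_of_pos hgε, ← abs_mul, abs_of_pos hgε]
      nth_rw 2 [← abs_of_nonneg hμ0]
      rw [← abs_mul]
      congr 1
      linear_combination (∫ x, f x ∂μ) * h1
    have e4 := mul_le_mul_of_nonneg_left e2 hμ0
    rw [← e3] at e4
    have : g ε * |ν.real univ * ∫ x, f x ∂μ - μ.real univ * ∫ x, f x ∂ν| ≤ g ε * (δ * (μ.real univ * ν.real univ)) := by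
      linarith
    exact le_of_mul_le_mul_left this hgε
  have hz : |ν.real univ * ∫ x, f x ∂μ - μ.real univ * ∫ x, f x ∂ν| ≤ 0 := by
    have ht : Tendsto (fun δ : ℝ => δ * (μ.real univ * ν.real univ)) (𝓝[>] 0) (𝓝 0) := by
      have : Tendsto (fun δ : ℝ => δ * (μ.real univ * ν.real univ)) (𝓝 0) (𝓝 (0 * (μ.real univ * ν.real univ))) :=
        (continuous_id.mul continuous_const).tendsto 0
      rw [zero_mul] at this
      exact this.mono_left nhdsWithin_le_nhds
    exact ge_of_tendsto ht (eventually_nhdsWithin_of_forall fun δ hδ => main δ hδ)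
  have := abs_nonpos_iff.1 hz
  linarith

lemma uniq {S : Type*} [MetricSpace S] [CompactSpace S] [MeasurableSpace S] [BorelSpace S]
    (μ ν : Measure S) [IsFiniteMeasure μ] [IsFiniteMeasure ν] [Nonempty S] [μ.IsOpenPosMeasure]
    (hμ : ∀ ε x y, μ (ball x ε) = μ (ball y ε))
    (hν : ∀ ε x y, ν (ball x ε) = ν (ball y ε)) : ∃ c : NNReal, ν = c • μ := by
  obtain ⟨x0⟩ := ‹Nonempty S›
  have hpos : 0 < μ.real univ := by
    rw [measureReal_def]
    exact ENNReal.toReal_pos (isOpen_univ.measure_ne_zero _ ⟨x0, trivial⟩) (measure_ne_top _ _)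
  let c : NNReal := ⟨ν.real univ / μ.real univ, by positivity⟩
  have hc : (c : ℝ) = ν.real univ / μ.real univ := rfl
  refine ⟨c, ?_⟩
  apply ext_of_forall_integral_eq_of_IsFiniteMeasure
  intro f
  have := uniq_aux μ ν (fun ε => μ.real (ball x0 ε)) (fun ε => ν.real (ball x0 ε))
    (fun ε _ x => by simp [measureReal_def, hμ ε x x0]) (fun ε _ x => by simp [measureReal_def, hν ε x x0])
    (fun ε hε => ENNReal.toReal_pos (isOpen_ball.measure_ne_zero _ ⟨x0, mem_ball_self hε⟩) (measure_ne_top _ _))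
    f f.continuous
  rw [integral_smul_nnreal_measure, NNReal.smul_def]
  rw [hc, smul_eq_mul]
  field_simp
  linarith



/-- A linear isometry equivalence acting on the sphere. -/
def actS {n : ℕ} (L : EE n ≃ₗᵢ[ℝ] EE n) : SS n ≃ᵢ SS n where
  toFun x := ⟨L x, by simp⟩
  invFun x := ⟨L.symm x, by simp⟩
  left_inv x := by ext; simp
  right_inv x := by ext; simp
  isometry_toFun := by
    apply Isometry.of_dist_eq
    intro x y
    exact L.isometry.dist_eq (x : EE n) y

lemma exists_act {n : ℕ} (x y : SS n) : ∃ L : EE n ≃ₗᵢ[ℝ] EE n, actS L x = y := by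
  refine ⟨(ℝ ∙ ((x : EE n) - y))ᗮ.reflection, ?_⟩
  ext1
  exact Submodule.reflection_sub (by simp)

open scoped Pointwise in
lemma toSphere_inv {n : ℕ} (ε : ℝ) (x y : SS n) : (volume : Measure (EE n)).toSphere (ball x ε) = (volume : Measure (EE n)).toSphere (ball y ε) := by
  obtain ⟨L, hL⟩ := exists_act x y
  rw [← hL, ← IsometryEquiv.image_ball, Measure.toSphere_apply' _ measurableSet_ball, Measure.toSphere_apply' _ (by rw [IsometryEquiv.image_ball]; exact measurableSet_ball)]
  congr 1
  have : Ioo (0 : ℝ) 1 • ((Subtype.val : SS n → EE n) '' (actS L '' ball x ε)) = L '' (Ioo (0 : ℝ) 1 • ((Subtype.val : SS n → EE n) '' ball x ε)) := by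
    have h1 : (Subtype.val : SS n → EE n) '' (actS L '' ball x ε) = L '' ((Subtype.val : SS n → EE n) '' ball x ε) := by
      rw [image_image, image_image]; rfl
    rw [h1]
    ext z
    constructor
    · rintro ⟨t, ht, _, ⟨w, hw, rfl⟩, rfl⟩
      exact ⟨t • w, ⟨t, ht, w, hw, rfl⟩, by simp⟩
    · rintro ⟨_, ⟨t, ht, w, hw, rfl⟩, rfl⟩
      exact ⟨t, ht, L w, ⟨w, hw, rfl⟩, by simp⟩
  rw [this]
  have h2 := (LinearIsometryEquiv.measurePreserving L).measure_preimage_emb L.toHomeomorph.measurableEmbedding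
    (L '' (Ioo (0 : ℝ) 1 • ((Subtype.val : SS n → EE n) '' ball x ε)))
  rw [← h2, preimage_image_eq _ L.injective]

lemma haus_inv {n : ℕ} (s : ℝ) (ε : ℝ) (x y : SS n) : (μH[s] : Measure (SS n)) (ball x ε) = (μH[s] : Measure (SS n)) (ball y ε) := by
  obtain ⟨L, hL⟩ := exists_act x y
  rw [← hL, ← IsometryEquiv.image_ball, IsometryEquiv.hausdorffMeasure_image]

instance {n : ℕ} : Nonempty (SS n) := ⟨⟨EuclideanSpace.single 0 1, by simp⟩⟩

lemma haus_alt {n : ℕ} (s : ℝ) : (∀ U : Set (SS n), IsOpen U → U.Nonempty → (μH[s] : Measure (SS n)) U = ∞) ∨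
    ∃ c : NNReal, (μH[s] : Measure (SS n)) = c • (volume : Measure (EE n)).toSphere := by
  by_cases hfin : (μH[s] : Measure (SS n)) univ = ∞
  · left
    rintro U hU ⟨x, hx⟩
    obtain ⟨ε, hε, hsub⟩ := Metric.isOpen_iff.1 hU x hx
    by_contra hne
    have hb : (μH[s] : Measure (SS n)) (ball x ε) ≠ ∞ := ne_top_of_le_ne_top hne (measure_mono hsub)
    obtain ⟨t, ht⟩ := isCompact_univ.elim_finite_subcover (fun y : SS n => ball y ε) (fun y => isOpen_ball)
      (fun y _ => mem_iUnion.2 ⟨y, mem_ball_self hε⟩)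
    have h1 : (μH[s] : Measure (SS n)) univ ≤ ∑ y ∈ t, (μH[s] : Measure (SS n)) (ball y ε) :=
      (measure_mono ht).trans (measure_biUnion_finset_le _ _)
    rw [hfin, top_le_iff, ENNReal.sum_eq_top] at h1
    obtain ⟨y, _, hy⟩ := h1
    exact hb (by rw [haus_inv s ε x y, hy])
  · right
    have : IsFiniteMeasure (μH[s] : Measure (SS n)) := ⟨lt_top_iff_ne_top.2 hfin⟩
    exact uniq _ _ toSphere_inv (haus_inv s)

open scoped Pointwise in
lemma haus_scale {n : ℕ} (k : Fin (n+1)) (f : EE n → ℝ) (r : ℝ) (hr : 0 < r) :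
    ∫ x in sphere (0 : EE n) r ∩ {x | 0 < x k}, f x ∂μH[(n:ℝ)] =
      r ^ n * ∫ ω in {ω : SS n | 0 < (ω : EE n) k}, f (r • (ω : EE n)) ∂(μH[(n:ℝ)] : Measure (SS n)) := by
  have hr' : r ≠ 0 := hr.ne'
  have hval : MeasurableEmbedding (Subtype.val : SS n → EE n) :=
    MeasurableEmbedding.subtype_coe isClosed_sphere.measurableSet
  have hPm : MeasurableSet {x : EE n | 0 < x k} :=
    (isOpen_lt continuous_const (by fun_prop)).measurableSet
  have h1 : ∫ ω in {ω : SS n | 0 < (ω : EE n) k}, f (r • (ω : EE n)) ∂(μH[(n:ℝ)] : Measure (SS n)) =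
      ∫ x in sphere (0 : EE n) 1 ∩ {x | 0 < x k}, f (r • x) ∂μH[(n:ℝ)] := by
    have := hval.setIntegral_map (μ := (μH[(n:ℝ)] : Measure (SS n))) (fun x => f (r • x)) {x : EE n | 0 < x k}
    rw [isometry_subtype_coe.map_hausdorffMeasure (Or.inl (by positivity)), Measure.restrict_restrict hPm,
      Subtype.range_coe, inter_comm] at this
    exact this.symm
  have hme : MeasurableEmbedding (fun x : EE n => r • x) :=
    (Homeomorph.smulOfNeZero r hr').measurableEmbedding
  have hmap : Measure.map (fun x : EE n => r • x) μH[(n:ℝ)] = ENNReal.ofReal (r⁻¹ ^ n) • μH[(n:ℝ)] := by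
    ext s hs
    rw [hme.map_apply, Measure.smul_apply]
    have : (fun x : EE n => r • x) ⁻¹' s = r⁻¹ • s := by
      rw [preimage_smul_inv₀ (inv_ne_zero hr') s |>.symm, inv_inv]
    rw [this, Measure.hausdorffMeasure_smul₀ (by positivity) (inv_ne_zero hr'), ENNReal.smul_def, smul_eq_mul, smul_eq_mul]
    congr 1
    rw [NNReal.rpow_natCast, ENNReal.coe_pow, ENNReal.ofReal_pow (by positivity), ← enorm_eq_nnnorm, Real.enorm_of_nonneg (by positivity)]
  have h2 := hme.setIntegral_map (μ := μH[(n:ℝ)]) f (sphere (0 : EE n) r ∩ {x | 0 < x k})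
  have h3 : (fun x : EE n => r • x) ⁻¹' (sphere (0 : EE n) r ∩ {x | 0 < x k}) = sphere (0 : EE n) 1 ∩ {x | 0 < x k} := by
    ext x
    simp [norm_smul, abs_of_pos hr, hr, hr']
  rw [hmap, h3, Measure.restrict_smul, integral_smul_measure, ENNReal.toReal_ofReal (by positivity)] at h2
  rw [h1, ← h2, smul_eq_mul, ← mul_assoc, ← mul_pow, mul_inv_cancel₀ hr', one_pow, one_mul]

/-- The half ball with its flat boundary part. -/
def Om {n : ℕ} (k : Fin (n+1)) : Set (EE n) := {x | ‖x‖ < 1 ∧ 0 ≤ x k}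

lemma tietze {n : ℕ} (k : Fin (n+1)) (g : EE n → ℝ) (hg : ContinuousOn g (Om k)) (ρ : ℝ) (hρ : ρ < 1) :
    ∃ g' : EE n → ℝ, Continuous g' ∧ ∀ x : EE n, ‖x‖ ≤ ρ → 0 ≤ x k → g' x = g x := by
  have hcl : IsClosed {x : EE n | ‖x‖ ≤ ρ ∧ 0 ≤ x k} :=
    (isClosed_le continuous_norm continuous_const).inter
      (isClosed_le continuous_const (by fun_prop : Continuous fun x : EE n => x k))
  have hc : ContinuousOn g {x : EE n | ‖x‖ ≤ ρ ∧ 0 ≤ x k} :=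
    hg.mono fun x hx => ⟨hx.1.trans_lt hρ, hx.2⟩
  obtain ⟨g', hg'⟩ := ContinuousMap.exists_restrict_eq hcl ⟨_, hc.domRestrict⟩
  refine ⟨g', g'.continuous, fun x h1 h2 => ?_⟩
  exact congrArg (fun F : C({x : EE n | ‖x‖ ≤ ρ ∧ 0 ≤ x k}, ℝ) => F ⟨x, h1, h2⟩) hg'

lemma norm_smul_S {n : ℕ} (t : ℝ) (ht : 0 < t) (ω : SS n) : ‖t • (ω : EE n)‖ = t := by
  rw [norm_smul, norm_eq_of_mem_sphere, mul_one, Real.norm_of_nonneg ht.le]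

lemma sg_congr {n : ℕ} (k : Fin (n+1)) (f g : SS n → ℝ) (h : ∀ ω : SS n, 0 < (ω : EE n) k → f ω = g ω) :
    ∫ ω, f ω ∂(sg k) = ∫ ω, g ω ∂(sg k) :=
  setIntegral_congr_fun (measPS k) fun ω hω => h ω hω

lemma ball_congr {n : ℕ} (k : Fin (n+1)) (f g : EE n → ℝ) (r : ℝ) 
    (h : ∀ x : EE n, ‖x‖ < r → 0 < x k → f x = g x) :
    ∫ x in ball (0 : EE n) r ∩ {x : EE n | 0 < x k}, f x = ∫ x in ball (0 : EE n) r ∩ {x : EE n | 0 < x k}, g x :=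
  setIntegral_congr_fun (measurableSet_ball.inter (measP k)) fun x hx => h x (by simpa using hx.1) hx.2

lemma sg_int {n : ℕ} (k : Fin (n+1)) (f : EE n → ℝ) (hf : ContinuousOn f (Om k)) (r : ℝ) (hr : 0 < r) (hr1 : r < 1)
    (q : SS n → ℝ) (hq : ∀ ω : SS n, 0 < (ω : EE n) k → q ω = f (r • (ω : EE n))) : Integrable q (sg k) := by
  obtain ⟨f', hf', he⟩ := tietze k f hf r hr1
  have : Integrable (fun ω : SS n => f' (r • (ω : EE n))) (sg k) :=
    Continuous.integrable_of_hasCompactSupport (by fun_prop) (HasCompactSupport.of_compactSpace _)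
  refine this.congr ?_
  refine (ae_restrict_iff' (measPS k)).2 (Eventually.of_forall fun ω hω => ?_)
  simp only
  rw [hq ω hω, he _ (norm_smul_S r hr ω).le]
  have : 0 < (ω : EE n) k := hω
  simp; positivity

lemma lemD {n : ℕ} (k : Fin (n+1)) (W : Fin (n+1) → EE n → ℝ)
    (W' : Fin (n+1) → EE n → EE n →L[ℝ] ℝ) (g : EE n → ℝ) (hW : ∀ i, ContinuousOn (W i) (Om k))
    (hg : ContinuousOn g (Om k)) 
    (hd : ∀ x : EE n, ‖x‖ < 1 → 0 < x k → ∀ i, HasFDerivAt (W i) (W' i x) x)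
    (hdiv : ∀ x : EE n, ‖x‖ < 1 → 0 < x k → ∑ i, W' i x (EuclideanSpace.single i 1) = g x)
    (hk : ∀ x : EE n, ‖x‖ < 1 → x k = 0 → W k x = 0) (r : ℝ) (hr : 0 < r) (hr1 : r < 1) :
    ∫ x in ball (0 : EE n) r ∩ {x : EE n | 0 < x k}, g x
      = r ^ n * ∫ ω : SS n, ∑ i, W i (r • (ω : EE n)) * (ω : EE n) i ∂(sg k) := by
  obtain ⟨ρ, hrρ, hρ⟩ := exists_between hr1
  obtain ⟨g', hg', hge⟩ := tietze k g hg ρ hρ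
  choose V hV hVe using fun i => tietze k (W i) (hW i) ρ hρ
  have := lemC k V W' g' hV hg' ρ hρ.le ?_ ?_ ?_ r hr hrρ
  · rw [ball_congr k g g' r fun x h1 h2 => (hge x (h1.le.trans hrρ.le) h2.le).symm, this]
    congr 1
    apply sg_congr
    intro ω hω
    refine Finset.sum_congr rfl fun i _ => ?_
    rw [hVe i _ ((norm_smul_S r hr ω).le.trans hrρ.le)]
    simp; positivity
  · intro x h1 h2 i
    apply (hd x (h1.trans hρ) h2 i).congr_of_eventuallyEq
    have e1 : ∀ᶠ y : EE n in 𝓝 x, ‖y‖ < ρ := continuous_norm.continuousAt.eventually (gt_mem_nhds h1)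
    have e2 : ∀ᶠ y : EE n in 𝓝 x, 0 < y k :=
      (isOpen_lt continuous_const (by fun_prop : Continuous fun y : EE n => y k)).mem_nhds h2
    filter_upwards [e1, e2] with y h3 h4
    exact hVe i y h3.le h4.le
  · intro x h1 h2
    rw [hdiv x (h1.trans hρ) h2, hge x h1.le h2.le]
  · intro x h1 h2
    rw [hVe k x h1.le h2.ge, hk x (h1.trans hρ) h2]

lemma lemG {n : ℕ} (k : Fin (n+1)) (g : EE n → ℝ) (hg : ContinuousOn g (Om k)) (r : ℝ) (hr : 0 < r) (hr1 : r < 1) :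
    HasDerivAt (fun r => ∫ x in ball (0 : EE n) r ∩ {x : EE n | 0 < x k}, g x)
      (r ^ n * ∫ ω : SS n, g (r • (ω : EE n)) ∂(sg k)) r := by
  obtain ⟨ρ, hrρ, hρ⟩ := exists_between hr1
  obtain ⟨g', hg', hge⟩ := tietze k g hg ρ hρ
  set a : ℝ → ℝ := fun t => t ^ n * ∫ ω : SS n, g' (t • (ω : EE n)) ∂(sg k) with ha
  have hac : Continuous a := by
    apply Continuous.mul (by fun_prop)
    exact cont_sph k (fun t ω => g' (t • (ω : EE n))) (by unfold Function.uncurry; fun_prop)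
  have hAd : HasDerivAt (fun t => ∫ s in (0:ℝ)..t, a s) (a r) r :=
    intervalIntegral.integral_hasDerivAt_right (hac.intervalIntegrable _ _)
      (hac.stronglyMeasurableAtFilter _ _) hac.continuousAt
  have har : a r = r ^ n * ∫ ω : SS n, g (r • (ω : EE n)) ∂(sg k) := by
    simp only [ha]
    congr 1
    apply sg_congr
    intro ω hω
    rw [hge _ ((norm_smul_S r hr ω).le.trans hrρ.le)]
    simp; positivity
  rw [← har]
  apply hAd.congr_of_eventuallyEq
  filter_upwards [Ioo_mem_nhds hr hrρ] with t ht
  rw [ball_congr k g g' t fun x h1 h2 => (hge x (h1.le.trans ht.2.le) h2.le).symm, ballD k g' hg' t ht.1]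

lemma lemH {n : ℕ} (k : Fin (n+1)) (u : EE n → ℝ) (hu : ContinuousOn u (Om k)) (p : Fin (n+1) → EE n → ℝ)
    (hp : ∀ i, ContinuousOn (p i) (Om k))
    (hd : ∀ x : EE n, ‖x‖ < 1 → 0 < x k → ∃ L : EE n →L[ℝ] ℝ, HasFDerivAt u L x ∧ ∀ y : EE n, L y = ∑ i, p i x * y i)
    (r : ℝ) (hr : 0 < r) (hr1 : r < 1) :
    HasDerivAt (fun r => ∫ ω : SS n, u (r • (ω : EE n)) ^ 2 ∂(sg k))
      (2 * ∫ ω : SS n, u (r • (ω : EE n)) * ∑ i, p i (r • (ω : EE n)) * (ω : EE n) i ∂(sg k)) r := by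
  obtain ⟨ρ, hrρ, hρ⟩ := exists_between hr1
  obtain ⟨u', hu', hue⟩ := tietze k u hu ρ hρ
  choose q hq hqe using fun i => tietze k (p i) (hp i) ρ hρ
  have hK : IsCompact ((Icc 0 ρ) ×ˢ (univ : Set (SS n))) := isCompact_Icc.prod isCompact_univ
  obtain ⟨C, hC⟩ := hK.exists_bound_of_continuousOn (f := fun z : ℝ × SS n => 2 * (u' (z.1 • (z.2 : EE n)) * ∑ i, q i (z.1 • (z.2 : EE n)) * (z.2 : EE n) i))
    (Continuous.continuousOn (by fun_prop))
  have hS : Ioo 0 ρ ∈ 𝓝 r := Ioo_mem_nhds hr hrρ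
  have hue' : ∀ t ∈ Ioo 0 ρ, ∀ ω : SS n, 0 < (ω : EE n) k → u (t • (ω : EE n)) = u' (t • (ω : EE n)) := by
    intro t ht ω hω
    refine (hue _ ((norm_smul_S t ht.1 ω).le.trans ht.2.le) ?_).symm
    have := ht.1
    simp; positivity
  have hqe' : ∀ t ∈ Ioo 0 ρ, ∀ ω : SS n, 0 < (ω : EE n) k → ∀ i, p i (t • (ω : EE n)) = q i (t • (ω : EE n)) := by
    intro t ht ω hω i
    refine (hqe i _ ((norm_smul_S t ht.1 ω).le.trans ht.2.le) ?_).symm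
    have := ht.1
    simp; positivity
  have haeP : ∀ᵐ ω : SS n ∂(sg k), 0 < (ω : EE n) k := ae_restrict_mem (measPS k)
  have := hasDerivAt_integral_of_dominated_loc_of_deriv_le (μ := sg k) (x₀ := r) (s := Ioo 0 ρ)
    (F := fun t (ω : SS n) => u (t • (ω : EE n)) ^ 2)
    (F' := fun t (ω : SS n) => 2 * (u (t • (ω : EE n)) * ∑ i, p i (t • (ω : EE n)) * (ω : EE n) i))
    (bound := fun _ => C) hS ?_ ?_ ?_ ?_ (integrable_const _) ?_
  · have h2 := this.2
    rw [integral_const_mul] at h2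
    exact h2
  · filter_upwards [hS] with t ht
    have : AEStronglyMeasurable (fun ω : SS n => u' (t • (ω : EE n)) ^ 2) (sg k) :=
      Continuous.aestronglyMeasurable (by fun_prop)
    refine this.congr ?_
    filter_upwards [haeP] with ω hω
    rw [hue' t ht ω hω]
  · exact sg_int k (fun x => u x ^ 2) (hu.pow 2) r hr hr1 _ (fun ω _ => rfl)
  · have : AEStronglyMeasurable (fun ω : SS n => 2 * (u' (r • (ω : EE n)) * ∑ i, q i (r • (ω : EE n)) * (ω : EE n) i)) (sg k) :=
      Continuous.aestronglyMeasurable (by fun_prop)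
    refine this.congr ?_
    filter_upwards [haeP] with ω hω
    rw [hue' r ⟨hr, hrρ⟩ ω hω]
    simp only [hqe' r ⟨hr, hrρ⟩ ω hω]
  · filter_upwards [haeP] with ω hω t ht
    have := hC (t, ω) ⟨⟨ht.1.le, ht.2.le⟩, trivial⟩
    rw [hue' t ht ω hω]
    simp only [hqe' t ht ω hω]
    exact this
  · filter_upwards [haeP] with ω hω t ht
    have ht0 := ht.1
    obtain ⟨L, hL, hLe⟩ := hd (t • (ω : EE n)) (by rw [norm_smul_S t ht.1]; exact ht.2.trans hρ) (by simp; positivity)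
    have hlin : HasDerivAt (fun t : ℝ => t • (ω : EE n)) (ω : EE n) t := by
      simpa using (hasDerivAt_id t).smul_const (ω : EE n)
    have h1 := hL.comp_hasDerivAt t hlin
    have h2 := h1.pow 2
    refine h2.congr_deriv ?_
    rw [hLe]
    simp
    ring

lemma calc_mono (n : ℕ) (h I J G D : ℝ → ℝ) (hh0 : ∀ r ∈ Ioo (0:ℝ) 1, 0 ≤ h r) 
    (hD0 : ∀ r ∈ Ioo (0:ℝ) 1, 0 ≤ D r)
    (hh : ∀ r ∈ Ioo (0:ℝ) 1, HasDerivAt h (2 * I r) r)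
    (hD : ∀ r ∈ Ioo (0:ℝ) 1, HasDerivAt D (r ^ n * G r) r)
    (h1 : ∀ r ∈ Ioo (0:ℝ) 1, D r = r ^ n * I r)
    (h2 : ∀ r ∈ Ioo (0:ℝ) 1, ((n:ℝ) - 1) * D r = r ^ n * (r * G r - 2 * r * J r))
    (hCS : ∀ r ∈ Ioo (0:ℝ) 1, I r ^ 2 ≤ h r * J r) (c : ℝ) (hc : 0 ≤ c) :
    MonotoneOn (fun r => r * D r / (r ^ n * (c * h r))) (Ioo 0 1) := by
  intro a ha b hb hab
  have hsub : Icc a b ⊆ Ioo (0:ℝ) 1 := fun t ht => ⟨ha.1.trans_le ht.1, ht.2.trans_lt hb.2⟩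
  have hmono : MonotoneOn h (Icc a b) := by
    apply monotoneOn_of_deriv_nonneg (convex_Icc a b)
    · exact fun t ht => (hh t (hsub ht)).continuousAt.continuousWithinAt
    · exact fun t ht => (hh t (hsub (interior_subset ht))).differentiableAt.differentiableWithinAt
    · intro t ht
      have ht := hsub (interior_subset ht)
      rw [(hh t ht).deriv]
      have := hD0 t ht
      rw [h1 t ht] at this
      have : 0 ≤ I t := nonneg_of_mul_nonneg_right this (pow_pos ht.1 n)
      linarith
  have hb0 : 0 ≤ b * D b / (b ^ n * (c * h b)) := by
    have := hb.1.le; have := hD0 b hb; have := hh0 b hb; positivity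
  rcases (hh0 a ha).eq_or_lt with hz | hpos
  · simp only [← hz, mul_zero, _root_.div_zero]; exact hb0
  have hp : ∀ t ∈ Icc a b, 0 < h t := fun t ht => hpos.trans_le (hmono (left_mem_Icc.2 hab) ht ht.1)
  have hN : MonotoneOn (fun t => t * I t / h t) (Icc a b) := by
    have heq : EqOn (fun t => t * I t / h t) (fun t => t * (D t / t ^ n) / h t) (Icc a b) := by
      intro t ht
      have h0 : t ^ n ≠ 0 := pow_ne_zero _ (hsub ht).1.ne'
      simp only [h1 t (hsub ht)]
      field_simp
    refine MonotoneOn.congr ?_ heq.symm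
    have hder : ∀ t ∈ Icc a b, HasDerivAt (fun t => t * (D t / t ^ n) / h t) (2 * t * (h t * J t - I t ^ 2) / h t ^ 2) t := by
      intro t ht
      have htt := hsub ht
      have ht0 := htt.1.ne'
      have hne : t ^ n ≠ 0 := pow_ne_zero _ ht0
      have := ((hasDerivAt_id t).mul ((hD t htt).div (hasDerivAt_pow n t) hne)).div (hh t htt) (hp t ht).ne'
      refine this.congr_deriv ?_
      have hn : (n:ℝ) * t ^ (n-1) * t = n * t ^ n := by
        rcases n with _ | m
        · simp
        · rw [Nat.add_sub_cancel, mul_assoc, ← pow_succ]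
      have e2 := h2 t htt
      rw [h1 t htt] at e2
      have e3 : ((n:ℝ) - 1) * I t = t * G t - 2 * t * J t := by
        apply mul_left_cancel₀ hne; linarith
      have hh' := (hp t ht).ne'
      have e4 : (n:ℝ) * t ^ (n-1) = n * t ^ n / t := by
        field_simp; linarith
      simp only [Pi.mul_apply, Pi.div_apply, id, h1 t htt, e4]
      field_simp
      have e5 : G t * t = (n - 1) * I t + 2 * t * J t := by linarith
      linear_combination (h t) * e5
    apply monotoneOn_of_deriv_nonneg (convex_Icc a b)
    · exact fun t ht => (hder t ht).continuousAt.continuousWithinAt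
    · exact fun t ht => (hder t (interior_subset ht)).differentiableAt.differentiableWithinAt
    · intro t ht
      have ht := interior_subset ht
      rw [(hder t ht).deriv]
      have := hCS t (hsub ht)
      have h3 : 0 ≤ h t * J t - I t ^ 2 := by linarith
      have := (hsub ht).1.le
      positivity
  have := hN (left_mem_Icc.2 hab) (right_mem_Icc.2 hab) hab
  have hf : ∀ t ∈ Icc a b, t * D t / (t ^ n * (c * h t)) = c⁻¹ * (t * I t / h t) := by
    intro t ht
    have h0 : t ^ n ≠ 0 := pow_ne_zero _ (hsub ht).1.ne'
    rw [h1 t (hsub ht)]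
    rcases hc.eq_or_lt with rfl | hc'
    · simp
    · have := hp t ht
      field_simp
  simp only
  rw [hf a (left_mem_Icc.2 hab), hf b (right_mem_Icc.2 hab)]
  exact mul_le_mul_of_nonneg_left this (inv_nonneg.2 hc)

lemma expand {n : ℕ} (y : EE n) : y = ∑ i, y i • (EuclideanSpace.single i (1:ℝ) : EE n) := by
  ext j
  simp [Finset.sum_apply, Pi.single_apply]

lemma lin_expand {n : ℕ} (L : EE n →L[ℝ] ℝ) (y : EE n) : L y = ∑ i, L (EuclideanSpace.single i 1) * y i := by
  conv_lhs => rw [expand y]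
  rw [map_sum]
  refine Finset.sum_congr rfl fun i _ => ?_
  rw [map_smul, smul_eq_mul, mul_comm]

lemma lemE {n : ℕ} (k : Fin (n+1)) (u : EE n → ℝ) (p : Fin (n+1) → EE n → ℝ) (L : EE n → EE n →L[ℝ] ℝ)
    (q : Fin (n+1) → EE n → EE n →L[ℝ] ℝ)
    (hu : ContinuousOn u (Om k)) (hp : ∀ i, ContinuousOn (p i) (Om k))
    (hL : ∀ x : EE n, ‖x‖ < 1 → 0 < x k → HasFDerivAt u (L x) x)
    (hLp : ∀ x : EE n, ‖x‖ < 1 → 0 < x k → ∀ i, L x (EuclideanSpace.single i 1) = p i x)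
    (hq : ∀ x : EE n, ‖x‖ < 1 → 0 < x k → ∀ i, HasFDerivAt (p i) (q i x) x)
    (hsym : ∀ x : EE n, ‖x‖ < 1 → 0 < x k → ∀ i j, q i x (EuclideanSpace.single j 1) = q j x (EuclideanSpace.single i 1))
    (hharm : ∀ x : EE n, ‖x‖ < 1 → 0 < x k → ∑ i, q i x (EuclideanSpace.single i 1) = 0)
    (hN : ∀ x : EE n, ‖x‖ < 1 → x k = 0 → p k x = 0) (c : ℝ) (hc : 0 ≤ c) :
    MonotoneOn (fun r => r * (∫ x in ball (0 : EE n) r ∩ {x : EE n | 0 < x k}, ∑ i, p i x ^ 2) /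
      (r ^ n * (c * ∫ ω : SS n, u (r • (ω : EE n)) ^ 2 ∂(sg k)))) (Ioo 0 1) := by
  have hcoord : ∀ i, ContinuousOn (fun x : EE n => x i) (Om k) := fun i => (by fun_prop : Continuous fun x : EE n => x i).continuousOn
  have hg1 : ContinuousOn (fun x => ∑ i, p i x ^ 2) (Om k) := continuousOn_finsetSum _ fun i _ => (hp i).pow 2
  have hR : ContinuousOn (fun x : EE n => ∑ i, p i x * x i) (Om k) := continuousOn_finsetSum _ fun i _ => (hp i).mul (hcoord i)
  have hei : ∀ (i : Fin (n+1)) (x : EE n), HasFDerivAt (fun y : EE n => y i) (EuclideanSpace.proj i : EE n →L[ℝ] ℝ) x :=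
    fun i x => (EuclideanSpace.proj i : EE n →L[ℝ] ℝ).hasFDerivAt
  apply calc_mono n (fun r => ∫ ω : SS n, u (r • (ω : EE n)) ^ 2 ∂(sg k))
    (fun r => ∫ ω : SS n, u (r • (ω : EE n)) * ∑ i, p i (r • (ω : EE n)) * (ω : EE n) i ∂(sg k))
    (fun r => ∫ ω : SS n, (∑ i, p i (r • (ω : EE n)) * (ω : EE n) i) ^ 2 ∂(sg k))
    (fun r => ∫ ω : SS n, ∑ i, p i (r • (ω : EE n)) ^ 2 ∂(sg k))
    (fun r => ∫ x in ball (0 : EE n) r ∩ {x : EE n | 0 < x k}, ∑ i, p i x ^ 2)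
  · intro r _
    exact integral_nonneg fun ω => sq_nonneg _
  · intro r _
    exact integral_nonneg fun x => Finset.sum_nonneg fun i _ => sq_nonneg _
  · intro r hr
    exact lemH k u hu p hp (fun x h1 h2 => ⟨L x, hL x h1 h2, fun y => by
      rw [lin_expand (L x) y]; simp only [hLp x h1 h2]⟩) r hr.1 hr.2
  · intro r hr
    exact lemG k (fun x => ∑ i, p i x ^ 2) hg1 r hr.1 hr.2
  · intro r hr
    have := lemD k (fun i x => u x * p i x) (fun i x => u x • q i x + p i x • L x) (fun x => ∑ i, p i x ^ 2)
      (fun i => hu.mul (hp i)) hg1 (fun x h1 h2 i => (hL x h1 h2).mul (hq x h1 h2 i)) ?_ ?_ r hr.1 hr.2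
    · simp only [this]
      congr 2
      ext ω
      rw [Finset.mul_sum]
      exact Finset.sum_congr rfl fun i _ => by ring
    · intro x h1 h2
      simp only [_root_.add_apply, _root_.smul_apply, smul_eq_mul, hLp x h1 h2]
      rw [Finset.sum_add_distrib, ← Finset.mul_sum, hharm x h1 h2, mul_zero, zero_add]
      exact Finset.sum_congr rfl fun i _ => by ring
    · intro x h1 h2
      simp only [hN x h1 h2, mul_zero]
  · intro r hr
    have hr0 := hr.1
    have := lemD k (fun i x => (∑ j, p j x ^ 2) * x i - 2 * ((∑ j, p j x * x j) * p i x))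
      (fun i x => ((∑ j, p j x ^ 2) • (EuclideanSpace.proj i : EE n →L[ℝ] ℝ) + x i • (∑ j, (2 * p j x) • q j x))
         - (2:ℝ) • ((∑ j, p j x * x j) • q i x + p i x • ∑ j, (p j x • (EuclideanSpace.proj j : EE n →L[ℝ] ℝ) + x j • q j x)))
      (fun x => ((n:ℝ) - 1) * ∑ i, p i x ^ 2)
      (fun i => (hg1.mul (hcoord i)).sub (continuousOn_const.mul (hR.mul (hp i)))) (continuousOn_const.mul hg1) ?_ ?_ ?_ r hr.1 hr.2
    · rw [integral_const_mul] at this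
      simp only [this]
      congr 1
      rw [← integral_const_mul, ← integral_const_mul, ← integral_sub]
      · congr 1
        ext ω
        have hω : ∑ i, (ω : EE n) i ^ 2 = 1 := by
          have := EuclideanSpace.norm_sq_eq (ω : EE n)
          rw [norm_eq_of_mem_sphere] at this
          simpa using this.symm
        set G := ∑ i, p i (r • (ω : EE n)) ^ 2
        have e1 : ∑ i, p i (r • (ω : EE n)) * (r • (ω : EE n)) i = r * ∑ i, p i (r • (ω : EE n)) * (ω : EE n) i := by
          rw [Finset.mul_sum]
          exact Finset.sum_congr rfl fun i _ => by simp; ring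
        rw [e1]
        set R := ∑ i, p i (r • (ω : EE n)) * (ω : EE n) i with hRdef
        calc _ = ∑ i, (r * G * (ω : EE n) i ^ 2 - 2 * r * R * (p i (r • (ω : EE n)) * (ω : EE n) i)) :=
              Finset.sum_congr rfl fun i _ => by simp; ring
          _ = _ := by
              rw [Finset.sum_sub_distrib, ← Finset.mul_sum, ← Finset.mul_sum, hω, ← hRdef]; ring
      · exact (sg_int k _ hg1 r hr.1 hr.2 _ fun ω _ => rfl).const_mul _
      · refine (sg_int k (fun x => (r⁻¹ * ∑ i, p i x * x i) ^ 2) ((continuousOn_const.mul hR).pow 2) r hr.1 hr.2 _ fun ω _ => ?_).const_mul _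
        rw [Finset.mul_sum]
        congr 1
        refine Finset.sum_congr rfl fun i _ => ?_
        simp; field_simp
    · intro x h1 h2 i
      have a1 : HasFDerivAt (fun x => ∑ j, p j x ^ 2) (∑ j, (2 * p j x) • q j x) x := by
        apply HasFDerivAt.fun_sum
        intro j _
        have := (hq x h1 h2 j).pow 2
        simpa using this
      have a2 : HasFDerivAt (fun x : EE n => ∑ j, p j x * x j) (∑ j, (p j x • (EuclideanSpace.proj j : EE n →L[ℝ] ℝ) + x j • q j x)) x := by
        apply HasFDerivAt.fun_sum
        intro j _
        exact (hq x h1 h2 j).mul (hei j x)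
      exact (a1.mul (hei i x)).sub ((a2.mul (hq x h1 h2 i)).const_mul 2)
    · intro x h1 h2
      simp only [_root_.add_apply, _root_.sub_apply, _root_.smul_apply, smul_eq_mul,
        _root_.sum_apply]
      have b1 : ∀ i j : Fin (n+1), (EuclideanSpace.proj j : EE n →L[ℝ] ℝ) (EuclideanSpace.single i 1) = if j = i then 1 else 0 := by
        intro i j; simp [Pi.single_apply]
      simp only [b1, mul_ite, mul_one, mul_zero, if_true, Finset.sum_add_distrib, Finset.sum_ite_eq', Finset.mem_univ, Finset.sum_sub_distrib, ← Finset.mul_sum]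
      rw [hharm x h1 h2]
      have b2 : ∑ i, x i * ∑ j, 2 * p j x * q j x (EuclideanSpace.single i 1) = 2 * ∑ i, p i x * ∑ j, x j * q j x (EuclideanSpace.single i 1) := by
        simp only [Finset.mul_sum]
        rw [Finset.sum_comm]
        refine Finset.sum_congr rfl fun i _ => Finset.sum_congr rfl fun j _ => ?_
        rw [hsym x h1 h2 i j]; ring
      simp only [mul_add, Finset.sum_add_distrib]
      rw [b2]
      simp
      have b3 : ∑ i, p i x * p i x = ∑ i, p i x ^ 2 := Finset.sum_congr rfl fun i _ => by ring
      rw [b3]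
      ring
    · intro x h1 h2
      simp [hN x h1 h2, h2]
  · intro r hr
    have hr0 := hr.1
    set R : SS n → ℝ := fun ω => ∑ i, p i (r • (ω : EE n)) * (ω : EE n) i with hRd
    have hRr : ∀ ω : SS n, R ω = r⁻¹ * ∑ i, p i (r • (ω : EE n)) * (r • (ω : EE n)) i := by
      intro ω
      rw [hRd, Finset.mul_sum]
      refine Finset.sum_congr rfl fun i _ => ?_
      simp; field_simp
    have hRc : ContinuousOn (fun x : EE n => r⁻¹ * ∑ i, p i x * x i) (Om k) := continuousOn_const.mul hR
    have i1 : Integrable (fun ω : SS n => u (r • (ω : EE n)) ^ 2) (sg k) := sg_int k _ (hu.pow 2) r hr.1 hr.2 _ fun ω _ => rfl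
    have i2 : Integrable (fun ω : SS n => u (r • (ω : EE n)) * R ω) (sg k) :=
      sg_int k _ (hu.mul hRc) r hr.1 hr.2 _ fun ω _ => by rw [hRr]; rfl
    have i3 : Integrable (fun ω : SS n => R ω ^ 2) (sg k) :=
      sg_int k _ (hRc.pow 2) r hr.1 hr.2 _ fun ω _ => by rw [hRr]; rfl
    have key : ∀ a : ℝ, 0 ≤ (∫ ω : SS n, u (r • (ω : EE n)) ^ 2 ∂(sg k)) * (a * a)
        + (2 * ∫ ω : SS n, u (r • (ω : EE n)) * R ω ∂(sg k)) * a + ∫ ω : SS n, R ω ^ 2 ∂(sg k) := by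
      intro a
      have : 0 ≤ ∫ ω : SS n, (a * a) * u (r • (ω : EE n)) ^ 2 + (2 * a) * (u (r • (ω : EE n)) * R ω) + R ω ^ 2 ∂(sg k) := by
        apply integral_nonneg
        intro ω
        have := sq_nonneg (a * u (r • (ω : EE n)) + R ω)
        simp only [Pi.zero_apply]
        linarith
      rw [integral_add (f := fun ω : SS n => (a * a) * u (r • (ω : EE n)) ^ 2 + (2 * a) * (u (r • (ω : EE n)) * R ω))
        ((i1.const_mul _).add (i2.const_mul _)) i3, integral_add (i1.const_mul _) (i2.const_mul _),
        integral_const_mul, integral_const_mul] at this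
      linarith
    have := discrim_le_zero key
    unfold discrim at this
    show (∫ ω : SS n, u (r • (ω : EE n)) * R ω ∂(sg k)) ^ 2 ≤ (∫ ω : SS n, u (r • (ω : EE n)) ^ 2 ∂(sg k)) * ∫ ω : SS n, R ω ^ 2 ∂(sg k)
    linarith
  · exact hc

lemma Om_eq {n : ℕ} (k : Fin (n+1)) : (ball (0 : EE n) 1 ∩ {x | 0 < x k}) ∪ (ball (0 : EE n) 1 ∩ {x | x k = 0}) = Om k := by
  ext x
  simp only [Om, mem_union, mem_inter_iff, mem_ball_zero_iff, mem_ofPred_eq]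
  rw [← and_or_left, le_iff_lt_or_eq, eq_comm]

lemma Om_nhds {n : ℕ} (k : Fin (n+1)) (x : EE n) (h1 : ‖x‖ < 1) (h2 : 0 < x k) :
    ball (0 : EE n) 1 ∩ {x | 0 < x k} ∈ 𝓝 x :=
  (isOpen_ball.inter (isOpen_lt continuous_const (by fun_prop : Continuous fun y : EE n => y k))).mem_nhds
    ⟨by simpa using h1, h2⟩

lemma Om_sub {n : ℕ} (k : Fin (n+1)) : ball (0 : EE n) 1 ∩ {x | 0 < x k} ⊆ Om k := by
  rw [← Om_eq]; exact subset_union_left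

lemma Om_ud {n : ℕ} (k : Fin (n+1)) : UniqueDiffOn ℝ (Om k) := by
  apply uniqueDiffOn_convex
  · have : Om k = ball (0 : EE n) 1 ∩ {x : EE n | 0 ≤ (EuclideanSpace.proj k : EE n →L[ℝ] ℝ) x} := by
      ext x; simp [Om]
    rw [this]
    exact (convex_ball _ _).inter (convex_halfSpace_ge (EuclideanSpace.proj k : EE n →L[ℝ] ℝ).toLinearMap.isLinear 0)
  · refine ⟨(1/2 : ℝ) • EuclideanSpace.single k (1:ℝ), ?_⟩
    rw [mem_interior_iff_mem_nhds]
    refine mem_of_superset (Om_nhds k _ ?_ ?_) (Om_sub k)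
    · rw [norm_smul]; simp; norm_num
    · simp

lemma grad_sq {n : ℕ} (u : EE n → ℝ) (x : EE n) :
    ‖gradient u x‖ ^ 2 = ∑ i, (fderiv ℝ u x (EuclideanSpace.single i 1)) ^ 2 := by
  rw [EuclideanSpace.norm_sq_eq]
  refine Finset.sum_congr rfl fun i _ => ?_
  have : fderiv ℝ u x (EuclideanSpace.single i 1) = gradient u x i := by
    have h := InnerProductSpace.toDual_symm_apply (𝕜 := ℝ) (x := (EuclideanSpace.single i 1 : EE n)) (y := fderiv ℝ u x)
    rw [EuclideanSpace.inner_single_right] at h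
    rw [← h]
    simp [gradient]
  rw [this]; simp

lemma inf_zero {n : ℕ} (k : Fin (n+1)) (μ : Measure (SS n)) (hμ : ∀ U : Set (SS n), IsOpen U → U.Nonempty → μ U = ∞)
    (f : SS n → ℝ) (hf : ContinuousOn f {ω : SS n | 0 < (ω : EE n) k}) :
    ∫ ω in {ω : SS n | 0 < (ω : EE n) k}, f ω ^ 2 ∂μ = 0 := by
  have hop : IsOpen {ω : SS n | 0 < (ω : EE n) k} := isOpen_lt continuous_const (by fun_prop)
  by_cases h : ∀ ω : SS n, 0 < (ω : EE n) k → f ω = 0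
  · rw [setIntegral_congr_fun (g := fun _ => (0:ℝ)) hop.measurableSet fun ω hω => by simp [h ω hω]]
    simp
  push Not at h
  obtain ⟨ω₀, h1, h2⟩ := h
  apply integral_undef
  intro hintg
  have hpos : 0 < f ω₀ ^ 2 / 2 := by positivity
  have hU : IsOpen ({ω : SS n | 0 < (ω : EE n) k} ∩ (fun ω => f ω ^ 2) ⁻¹' (Ioi (f ω₀ ^ 2 / 2))) :=
    (hf.pow 2).isOpen_inter_preimage hop isOpen_Ioi
  have hinf := hμ _ hU ⟨ω₀, h1, by simp; positivity⟩
  have hfin := hintg.measure_norm_ge_lt_top hpos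
  have hle : μ ({ω : SS n | 0 < (ω : EE n) k} ∩ (fun ω => f ω ^ 2) ⁻¹' (Ioi (f ω₀ ^ 2 / 2)))
      ≤ (μ.restrict {ω : SS n | 0 < (ω : EE n) k}) {x | f ω₀ ^ 2 / 2 ≤ ‖f x ^ 2‖} := by
    rw [Measure.restrict_apply' hop.measurableSet]
    apply measure_mono
    rintro ω ⟨a, b⟩
    refine ⟨?_, a⟩
    have b' : f ω₀ ^ 2 / 2 < f ω ^ 2 := b
    simp only [mem_ofPred_eq]
    exact b'.le.trans (le_abs_self _)
  rw [hinf] at hle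
  exact absurd (hle.trans_lt hfin) (lt_irrefl _)

lemma main_aux_s10 {n : ℕ} (k : Fin (n+1)) (u : EE n → ℝ) (huC1 : ContDiffOn ℝ 1 u (Om k))
    (huharm : HarmonicOn u (ball (0 : EE n) 1 ∩ {x | 0 < x k}))
    (hN : ∀ x ∈ ball (0 : EE n) 1 ∩ {x : EE n | x k = 0}, fderivWithin ℝ u (Om k) x (EuclideanSpace.single k 1) = 0) :
    MonotoneOn (fun r : ℝ =>
      r * (∫ x in ball (0 : EE n) r ∩ {x | 0 < x k}, ‖gradient u x‖ ^ 2) /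
        ∫ x in sphere (0 : EE n) r ∩ {x | 0 < x k}, (u x) ^ 2 ∂μH[(n : ℝ)]) (Ioo 0 1) := by
  have hfd : ∀ x : EE n, ‖x‖ < 1 → 0 < x k → fderivWithin ℝ u (Om k) x = fderiv ℝ u x := fun x h1 h2 =>
    fderivWithin_of_mem_nhds (mem_of_superset (Om_nhds k x h1 h2) (Om_sub k))
  have hev : ∀ x : EE n, ‖x‖ < 1 → 0 < x k → ∀ᶠ y in 𝓝 x, fderivWithin ℝ u (Om k) y = fderiv ℝ u y := by
    intro x h1 h2
    filter_upwards [Om_nhds k x h1 h2] with y hy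
    exact hfd y (by simpa using hy.1) hy.2
  have hC2 : ∀ x : EE n, ‖x‖ < 1 → 0 < x k → ContDiffAt ℝ 2 u x := fun x h1 h2 =>
    huharm.1.contDiffAt (Om_nhds k x h1 h2)
  have hd2 : ∀ x : EE n, ‖x‖ < 1 → 0 < x k → DifferentiableAt ℝ (fderiv ℝ u) x := fun x h1 h2 =>
    ((hC2 x h1 h2).fderiv_right (m := 1) (by norm_num)).differentiableAt (by norm_num)
  have hd2' : ∀ x : EE n, ‖x‖ < 1 → 0 < x k → ∀ i : Fin (n+1), HasFDerivAt (fun y => fderiv ℝ u y (EuclideanSpace.single i 1))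
      ((fderiv ℝ (fderiv ℝ u) x).flip (EuclideanSpace.single i 1)) x := by
    intro x h1 h2 i
    have := (hd2 x h1 h2).hasFDerivAt.clm_apply (hasFDerivAt_const (EuclideanSpace.single i (1:ℝ) : EE n) x)
    simpa using this
  have key := lemE k u (fun i x => fderivWithin ℝ u (Om k) x (EuclideanSpace.single i 1)) (fderiv ℝ u)
    (fun i x => (fderiv ℝ (fderiv ℝ u) x).flip (EuclideanSpace.single i 1)) huC1.continuousOn
    (fun i => (huC1.continuousOn_fderivWithin (Om_ud k) le_rfl).clm_apply continuousOn_const)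
    (fun x h1 h2 => ((hC2 x h1 h2).differentiableAt (by norm_num)).hasFDerivAt)
    (fun x h1 h2 i => by rw [hfd x h1 h2])
    (fun x h1 h2 i => (hd2' x h1 h2 i).congr_of_eventuallyEq (by
      filter_upwards [hev x h1 h2] with y hy
      rw [hy]))
    (fun x h1 h2 i j => by
      have := ((hC2 x h1 h2).isSymmSndFDerivAt (by simp)) (EuclideanSpace.single j 1) (EuclideanSpace.single i 1)
      simpa using this)
    (fun x h1 h2 => by
      have := huharm.2 x ⟨by simpa using h1, h2⟩
      unfold lap at this
      rw [← this]
      exact Finset.sum_congr rfl fun i _ => by rw [(hd2' x h1 h2 i).fderiv])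
    (fun x h1 h2 => hN x ⟨by simpa using h1, h2⟩)
  have hnum : ∀ r ∈ Ioo (0:ℝ) 1, ∫ x in ball (0 : EE n) r ∩ {x | 0 < x k}, ‖gradient u x‖ ^ 2
      = ∫ x in ball (0 : EE n) r ∩ {x : EE n | 0 < x k}, ∑ i, (fderivWithin ℝ u (Om k) x (EuclideanSpace.single i 1)) ^ 2 := by
    intro r hr
    apply ball_congr
    intro x h1 h2
    rw [grad_sq, hfd x (h1.trans hr.2) h2]
  rcases haus_alt (n := n) (n : ℝ) with hinf | ⟨c, hc⟩
  · have hz : ∀ r ∈ Ioo (0:ℝ) 1, ∫ x in sphere (0 : EE n) r ∩ {x | 0 < x k}, (u x) ^ 2 ∂μH[(n : ℝ)] = 0 := by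
      intro r hr
      rw [haus_scale k (fun x => u x ^ 2) r hr.1, inf_zero k _ hinf (fun ω => u (r • (ω : EE n))), mul_zero]
      refine huC1.continuousOn.comp (Continuous.continuousOn (by fun_prop)) fun ω hω => ?_
      have hω' : 0 < (ω : EE n) k := hω
      have hr0 := hr.1
      refine ⟨by rw [norm_smul_S r hr.1]; exact hr.2, ?_⟩
      simp; positivity
    intro a ha b hb _
    simp only [hz a ha, hz b hb, _root_.div_zero, le_refl]
  · refine (key c c.2).congr fun r hr => ?_
    simp only
    rw [hnum r hr, haus_scale k (fun x => u x ^ 2) r hr.1, hc, Measure.restrict_smul]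
    congr 2
    rw [integral_smul_nnreal_measure]
    rfl

/-- **Boundary monotonicity formula for the Neumann problem on a half space.**
Let `B_1^+ = B_1 ∩ {x_d > 0}` and `T = B_1 ∩ {x_d = 0}` in `ℝ^d`, `d ≥ 2`.  If `u` is
continuously differentiable on `B_1^+ ∪ T`, harmonic in `B_1^+`, not identically zero,
and satisfies the Neumann condition `∂u/∂x_d = 0` on `T`, then the frequency
`F(r) = r ∫_{B_r^+} |∇u|² dx / ∫_{∂B_r ∩ {x_d>0}} |u|² dH^{d-1}`
is monotonically nondecreasing on `(0,1)`. -/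
theorem halfspace_neumann_monotonicity
    (d : ℕ) (hd : 2 ≤ d)
    (u : EuclideanSpace ℝ (Fin d) → ℝ)
    (huC1 : ContDiffOn ℝ 1 u
      ((ball (0 : EuclideanSpace ℝ (Fin d)) 1 ∩ {x | 0 < x ⟨d - 1, by omega⟩}) ∪
        (ball (0 : EuclideanSpace ℝ (Fin d)) 1 ∩ {x | x ⟨d - 1, by omega⟩ = 0})))
    (huharm : HarmonicOn u (ball (0 : EuclideanSpace ℝ (Fin d)) 1 ∩
      {x | 0 < x ⟨d - 1, by omega⟩}))
    (hNeumann : ∀ x ∈ ball (0 : EuclideanSpace ℝ (Fin d)) 1 ∩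
        {x : EuclideanSpace ℝ (Fin d) | x ⟨d - 1, by omega⟩ = 0},
      fderivWithin ℝ u
        ((ball (0 : EuclideanSpace ℝ (Fin d)) 1 ∩ {x | 0 < x ⟨d - 1, by omega⟩}) ∪
          (ball (0 : EuclideanSpace ℝ (Fin d)) 1 ∩ {x | x ⟨d - 1, by omega⟩ = 0})) x
        (EuclideanSpace.single ⟨d - 1, by omega⟩ 1) = 0)
    (hnz : ∃ x ∈ ball (0 : EuclideanSpace ℝ (Fin d)) 1 ∩
      {x : EuclideanSpace ℝ (Fin d) | 0 < x ⟨d - 1, by omega⟩}, u x ≠ 0) :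
    MonotoneOn (fun r : ℝ =>
      r * (∫ x in ball (0 : EuclideanSpace ℝ (Fin d)) r ∩ {x | 0 < x ⟨d - 1, by omega⟩},
            ‖gradient u x‖ ^ 2) /
        ∫ x in sphere (0 : EuclideanSpace ℝ (Fin d)) r ∩ {x | 0 < x ⟨d - 1, by omega⟩},
          (u x) ^ 2 ∂μH[((d : ℝ) - 1)]) (Ioo 0 1) := by
  obtain ⟨n, rfl⟩ : ∃ n, d = n + 1 := ⟨d - 1, by omega⟩
  have hn : (((n + 1 : ℕ) : ℝ) - 1) = (n : ℝ) := by push_cast; ring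
  rw [hn]
  have hk := Om_eq (⟨n + 1 - 1, by omega⟩ : Fin (n+1))
  rw [hk] at huC1
  rw [hk] at hNeumann
  exact main_aux_s10 _ u huC1 huharm hNeumann
end
end
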